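/- Let (R,m) be an analytically unramified Cohen-Macaulay local ring of dimension d ≥ 3 with infinite residue field, I m-primary with minimal reduction J. If ē₁(I) = e₀(I) − λ(R/closure(I)) + 1 and ē₃(I) = 0, then Σ_{n≥1} λ(closure(I^{n+1})/(J ∩ closure(I^{n+1}))) = 1. -/

import Mathlib

set_option synthInstance.maxHeartbeats 1000000
set_option maxHeartbeats 2000000

open IsLocalRing Polynomial Finset

variable {R : Type*}

/-- `x` is integral over the ideal `I`: it satisfies an equation
`x^n + a₁ x^{n-1} + ⋯ + aₙ = 0` with `aᵢ ∈ Iⁱ`. -/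
def IsIntegralOverIdeal [CommRing R] (I : Ideal R) (x : R) : Prop :=
  ∃ n : ℕ, 0 < n ∧ ∃ a : ℕ → R, (∀ i ∈ Finset.Icc 1 n, a i ∈ I ^ i) ∧
    x ^ n + ∑ i ∈ Finset.Icc 1 n, a i * x ^ (n - i) = 0

/-- The integral closure of an ideal (the set of integral elements is an ideal,
so the span equals it). -/
def intCl [CommRing R] (I : Ideal R) : Ideal R :=
  Ideal.span {x | IsIntegralOverIdeal I x}

/-- Length of a module, as the Krull dimension of its lattice of submodules. -/
noncomputable def mlen (R M : Type*) [CommRing R] [AddCommGroup M] [Module R M] :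
    WithBot ℕ∞ :=
  Order.krullDim (Submodule R M)

/-- The quotient module `N/(K ∩ N)` for ideals `N K`. -/
abbrev idealQuot [CommRing R] (N K : Ideal R) :=
  N ⧸ (Submodule.comap N.subtype K)

/-- Depth of `M` with respect to the ideal `J`: sup of lengths of `M`-regular
sequences contained in `J`. -/
noncomputable def rdepth (A : Type*) [CommRing A] (J : Ideal A)
    (M : Type*) [AddCommGroup M] [Module A M] : ℕ∞ :=
  sSup {n : ℕ∞ | ∃ rs : List A, (rs.length : ℕ∞) = n ∧ (∀ x ∈ rs, x ∈ J) ∧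
    RingTheory.Sequence.IsRegular M rs}

/-- A local ring is Cohen-Macaulay if its depth equals its Krull dimension. -/
def IsCMLocal (R : Type*) [CommRing R] [IsLocalRing R] : Prop :=
  (rdepth R (maximalIdeal R) R : WithBot ℕ∞) = ringKrullDim R

/-- A local ring is analytically unramified if its `m`-adic completion is reduced. -/
def AnalyticallyUnramified (R : Type*) [CommRing R] [IsLocalRing R] : Prop :=
  IsReduced (AdicCompletion (maximalIdeal R) R)

/-- An ideal is `m`-primary. -/
def IsMPrimary [CommRing R] [IsLocalRing R] (I : Ideal R) : Prop :=
  I.radical = maximalIdeal R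

/-- `J ⊆ I` is a minimal reduction: generated by `d = dim R` elements and
`I^{n+1} = J I^n` for `n ≫ 0`. -/
def IsMinimalReduction [CommRing R] (d : ℕ) (J I : Ideal R) : Prop :=
  J ≤ I ∧ (∃ s : Fin d → R, J = Ideal.span (Set.range s)) ∧
    ∃ N : ℕ, ∀ n ≥ N, I ^ (n + 1) = J * I ^ n

/-- Normal Hilbert data: `L n = λ(R/ intCl(I^{n+1}))` and for `n ≫ 0` this agrees
with the polynomial whose normalized coefficients are the `e i`. -/
def NormalHilbertData [CommRing R] (d : ℕ) (I : Ideal R) (L : ℕ → ℕ) (e : ℕ → ℤ) : Prop :=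
  (∀ n, mlen R (R ⧸ intCl (I ^ (n + 1))) = (L n : WithBot ℕ∞)) ∧
    ∃ N : ℕ, ∀ n ≥ N, (L n : ℤ) =
      ∑ i ∈ Finset.range (d + 1), (-1 : ℤ) ^ i * e i * ((n + d - i).choose (d - i))

/-- `t` is the Cohen-Macaulay type of the local ring `R` of dimension `d`:
`t = λ((Q : m)/Q)` for every ideal `Q` generated by a maximal regular sequence in `m`. -/
def CMTypeData (R : Type*) [CommRing R] [IsLocalRing R] (d t : ℕ) : Prop :=
  ∀ s : List R, s.length = d → (∀ x ∈ s, x ∈ maximalIdeal R) →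
    RingTheory.Sequence.IsRegular R s →
      mlen R (idealQuot ((Ideal.span {x | x ∈ s}).colon (maximalIdeal R))
        (Ideal.span {x | x ∈ s})) = (t : WithBot ℕ∞)

/-- The quotient module `N/(K ∩ N)` for submodules `N K` of a module. -/
abbrev submoduleQuot {A M : Type*} [CommRing A] [AddCommGroup M] [Module A M]
    (N K : Submodule A M) :=
  N ⧸ (Submodule.comap N.subtype K)


set_option linter.unusedSectionVars false
set_option linter.unusedVariables false
universe u

-- part 1

/-! ### Artin-Rees consequence -/

lemma artinRees_colon {T : Type*} [CommRing T] [IsNoetherianRing T] (b : Ideal T) (y : T)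
    (hy : y ∈ nonZeroDivisors T) : ∃ c : ℕ, ∀ n z, y * z ∈ b ^ (n + c) → z ∈ b ^ n := by
  obtain ⟨k, hk⟩ := Ideal.exists_pow_inf_eq_pow_smul b (Ideal.span {y} : Submodule T T)
  refine ⟨k, fun n z hz => ?_⟩
  have h1 : y * z ∈ (b ^ (n + k) • (⊤ : Submodule T T) ⊓ (Ideal.span {y} : Submodule T T)) := by
    refine ⟨by simpa using hz, ?_⟩
    exact Ideal.mul_mem_right _ _ (Ideal.mem_span_singleton_self y)
  rw [hk (n + k) (by omega)] at h1
  have h2 : y * z ∈ b ^ n * Ideal.span {y} := by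
    have : (b ^ (n + k - k) • (b ^ k • (⊤ : Submodule T T) ⊓ (Ideal.span {y} : Submodule T T)))
      ≤ b ^ n • (Ideal.span {y} : Submodule T T) := by
      rw [Nat.add_sub_cancel]
      exact Submodule.smul_mono le_rfl inf_le_right
    exact this h1
  rw [Ideal.mem_mul_span_singleton] at h2
  obtain ⟨w, hw, e⟩ := h2
  have : y * (z - w) = 0 := by rw [mul_sub, ← e]; ring
  have h3 := (mul_left_mem_nonZeroDivisors_eq_zero_iff hy).1 this
  rw [sub_eq_zero] at h3
  rwa [h3]

lemma artinRees_pow {T : Type*} [CommRing T] [IsNoetherianRing T] (b : Ideal T) (y : T)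
    (hy : y ∈ nonZeroDivisors T) :
    ∃ c : ℕ, ∀ o m, y ^ o ∈ b ^ (m + c * o) → (1 : T) ∈ b ^ m := by
  obtain ⟨c, hc⟩ := artinRees_colon b y hy
  refine ⟨c, fun o => ?_⟩
  induction o with
  | zero => intro m h; simpa using h
  | succ o ih =>
    intro m h
    apply ih
    apply hc
    rw [← pow_succ']
    convert h using 2; ring

/-! ### The asymptotic order filtration -/

/-- `y` has asymptotic order at least `α` -/
def vset [CommRing R] (J : Ideal R) (α : ℝ) (y : R) : Prop :=
  ∀ β < α, ∃ C : ℝ, ∀ n N : ℕ, (N : ℝ) ≤ β * n - C → y ^ n ∈ J ^ N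

section vset
variable [CommRing R] {J : Ideal R} {α β : ℝ} {y z : R}

lemma mem_floor {y : R} {n : ℕ} {t : ℝ} (h : ∀ N : ℕ, (N : ℝ) ≤ t → y ^ n ∈ J ^ N) :
    y ^ n ∈ J ^ ⌊t⌋₊ := by
  by_cases ht : 0 ≤ t
  · exact h _ (Nat.floor_le ht)
  · rw [Nat.floor_of_nonpos (by linarith)]; simp

lemma vset_mono (h : β ≤ α) (hy : vset J α y) : vset J β y := fun γ hγ => hy γ (by linarith)

lemma vset_of_forall_lt (h : ∀ β < α, vset J β y) : vset J α y := by
  intro γ hγ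
  obtain ⟨δ, h1, h2⟩ := exists_between hγ
  exact h δ h2 γ h1

lemma vset_add (hy : vset J α y) (hz : vset J α z) : vset J α (y + z) := by
  intro γ hγ
  obtain ⟨C1, h1⟩ := hy γ hγ
  obtain ⟨C2, h2⟩ := hz γ hγ
  refine ⟨C1 + C2 + 2, fun n N hN => ?_⟩
  rw [add_pow]
  refine Ideal.sum_mem _ fun i hi => ?_
  have hi' : i ≤ n := by simp at hi; omega
  apply Ideal.mul_mem_right
  have e1 := mem_floor (h1 i)
  have e2 := mem_floor (h2 (n - i))
  have := Ideal.mul_mem_mul e1 e2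
  rw [← pow_add] at this
  refine Ideal.pow_le_pow_right ?_ this
  have f1 := Nat.lt_floor_add_one (γ * i - C1)
  have f2 := Nat.lt_floor_add_one (γ * (n - i : ℕ) - C2)
  rw [Nat.cast_sub hi'] at f2 ⊢
  have : (N : ℝ) ≤ (⌊γ * ↑i - C1⌋₊ + ⌊γ * (↑n - ↑i) - C2⌋₊ : ℕ) := by push_cast; linarith
  exact_mod_cast this

lemma vset_mul (hy : vset J α y) (hz : vset J β z) : vset J (α + β) (y * z) := by
  intro γ hγ
  obtain ⟨C1, h1⟩ := hy (α - (α + β - γ) / 2) (by linarith)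
  obtain ⟨C2, h2⟩ := hz (β - (α + β - γ) / 2) (by linarith)
  refine ⟨C1 + C2 + 2, fun n N hN => ?_⟩
  rw [mul_pow]
  have e1 := mem_floor (h1 n)
  have e2 := mem_floor (h2 n)
  have := Ideal.mul_mem_mul e1 e2
  rw [← pow_add] at this
  refine Ideal.pow_le_pow_right ?_ this
  have f1 := Nat.lt_floor_add_one ((α - (α + β - γ) / 2) * n - C1)
  have f2 := Nat.lt_floor_add_one ((β - (α + β - γ) / 2) * n - C2)
  have : (N : ℝ) ≤ (⌊(α - (α + β - γ) / 2) * n - C1⌋₊ + ⌊(β - (α + β - γ) / 2) * n - C2⌋₊ : ℕ) := by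
    push_cast; linarith
  exact_mod_cast this

lemma vset_of_mem_pow {n : ℕ} (hy : y ∈ J ^ n) : vset J n y := by
  intro γ hγ
  refine ⟨0, fun m N hN => ?_⟩
  have := Ideal.pow_mem_pow hy m
  rw [← pow_mul] at this
  refine Ideal.pow_le_pow_right ?_ this
  have : (N : ℝ) ≤ (n * m : ℕ) := by push_cast; nlinarith [(Nat.cast_nonneg m : (0 : ℝ) ≤ m)]
  exact_mod_cast this

lemma vset_of_nonpos (h : α ≤ 0) : vset J α y :=
  vset_mono h (by simpa using vset_of_mem_pow (J := J) (n := 0) (y := y) (by simp))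

lemma vset_zero : vset J α 0 := by
  intro γ hγ
  refine ⟨max 0 (|γ|), fun m N hN => ?_⟩
  by_cases hm : m = 0
  · subst hm
    have : N = 0 := by
      have : (N : ℝ) ≤ 0 := by
        have := le_max_left 0 (|γ|)
        simp at hN; linarith [abs_nonneg γ]
      have : N ≤ 0 := by exact_mod_cast this
      omega
    simp [this]
  · simp [zero_pow hm]

lemma vset_mul_left (r : R) (hy : vset J α y) : vset J α (r * y) := by
  simpa using vset_mul (vset_of_nonpos (J := J) (α := 0) (y := r) le_rfl) hy

lemma vset_of_pow {s : ℕ} (hs : 0 < s) (h : vset J (s * α) (y ^ s)) : vset J α y := by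
  intro γ hγ
  have hs' : (0 : ℝ) < s := by exact_mod_cast hs
  obtain ⟨C, hC⟩ := h (s * γ) (by nlinarith)
  refine ⟨C + |γ| * s, fun n N hN => ?_⟩
  rw [← Nat.div_add_mod n s, pow_add]
  apply Ideal.mul_mem_right
  rw [pow_mul]
  apply hC
  have h1 : (n : ℝ) = s * (n / s : ℕ) + (n % s : ℕ) := by
    exact_mod_cast (Nat.div_add_mod n s).symm
  have h2 : ((n % s : ℕ) : ℝ) ≤ s := by exact_mod_cast (Nat.mod_lt n hs).le
  have h3 : γ * (n % s : ℕ) ≤ |γ| * s := by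
    calc γ * (n % s : ℕ) ≤ |γ| * (n % s : ℕ) := by
          apply mul_le_mul_of_nonneg_right (le_abs_self γ); positivity
      _ ≤ _ := by gcongr
  rw [h1] at hN
  nlinarith

lemma vset_pow (s : ℕ) (h : vset J α y) : vset J (s * α) (y ^ s) := by
  induction s with
  | zero => simpa using vset_of_nonpos (J := J) (α := 0) (y := 1) le_rfl
  | succ s ih => rw [pow_succ]; push_cast; rw [add_mul, one_mul]; exact vset_mul ih h

/-- one good power is enough -/
lemma vset_of_witness {j N : ℕ} (hj : 0 < j) (h : y ^ j ∈ J ^ N) (hβ : β * j ≤ N) :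
    vset J β y := by
  apply vset_of_pow hj
  exact vset_mono (by linarith) (vset_of_mem_pow h)

/-- the order of a power is bounded by the asymptotic order -/
lemma vset_of_eventually {C : ℝ} (h : ∀ n N : ℕ, (N : ℝ) ≤ α * n - C → y ^ n ∈ J ^ N) :
    vset J α y := by
  intro γ hγ
  refine ⟨C, fun n N hN => h n N ?_⟩
  nlinarith [(Nat.cast_nonneg n : (0 : ℝ) ≤ n)]

end vset

/-- ideal of elements of asymptotic order `≥ α` -/
def vge [CommRing R] (J : Ideal R) (α : ℝ) : Ideal R where
  carrier := {y | vset J α y}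
  add_mem' := vset_add
  zero_mem' := vset_zero
  smul_mem' := fun r _ h => vset_mul_left r h

/-- ideal of elements of asymptotic order `> α` -/
def vgt [CommRing R] (J : Ideal R) (α : ℝ) : Ideal R where
  carrier := {y | ∃ β, α < β ∧ vset J β y}
  add_mem' := by
    rintro y z ⟨β, h1, h2⟩ ⟨γ, h3, h4⟩
    exact ⟨min β γ, lt_min h1 h3, vset_add (vset_mono (min_le_left _ _) h2)
      (vset_mono (min_le_right _ _) h4)⟩
  zero_mem' := ⟨α + 1, by linarith, vset_zero⟩
  smul_mem' := by
    rintro r y ⟨β, h1, h2⟩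
    exact ⟨β, h1, vset_mul_left r h2⟩

section vge
variable [CommRing R] {J : Ideal R} {α β : ℝ} {y z : R}

lemma mem_vge : y ∈ vge J α ↔ vset J α y := Iff.rfl
lemma mem_vgt : y ∈ vgt J α ↔ ∃ β, α < β ∧ vset J β y := Iff.rfl
lemma vge_anti (h : β ≤ α) : vge J α ≤ vge J β := fun _ => vset_mono h
lemma vgt_le_vge : vgt J α ≤ vge J α := fun _ ⟨_, h1, h2⟩ => vset_mono h1.le h2
lemma vge_le_vgt (h : β < α) : vge J α ≤ vgt J β := fun _ hy => ⟨α, h, hy⟩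
lemma mul_mem_vge (hy : y ∈ vge J α) (hz : z ∈ vge J β) : y * z ∈ vge J (α + β) := vset_mul hy hz
lemma mul_mem_vgt (hy : y ∈ vge J α) (hz : z ∈ vgt J β) : y * z ∈ vgt J (α + β) := by
  obtain ⟨γ, h1, h2⟩ := hz
  exact ⟨α + γ, by linarith, vset_mul hy h2⟩
lemma mul_mem_vgt' (hy : y ∈ vgt J α) (hz : z ∈ vge J β) : y * z ∈ vgt J (α + β) := by
  rw [mul_comm, add_comm]; exact mul_mem_vgt hz hy
lemma pow_le_vge (n : ℕ) : J ^ n ≤ vge J n := fun _ h => vset_of_mem_pow h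
lemma vgt_of_sq (h : y * y ∈ vgt J (α + α)) : y ∈ vgt J α := by
  obtain ⟨γ, h1, h2⟩ := h
  refine ⟨γ / 2, by linarith, vset_of_pow (s := 2) (by norm_num) ?_⟩
  rw [pow_two]; convert h2 using 1; push_cast; ring
end vge


-- part 2

/-! ### integral closure and the asymptotic order -/

lemma IsIntegralOverIdeal.pow_mem [CommRing R] {Q : Ideal R} {y : R}
    (h : IsIntegralOverIdeal Q y) : ∃ m : ℕ, ∀ j, y ^ (m + j) ∈ Q ^ j := by
  obtain ⟨n, hn, a, ha, he⟩ := h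
  refine ⟨n - 1, fun j => ?_⟩
  induction j using Nat.strong_induction_on with
  | _ j ih =>
    rcases j with _ | j
    · simp
    have e1 : y ^ (n - 1 + (j + 1)) = - ∑ i ∈ Finset.Icc 1 n, a i * y ^ (n - i + j) := by
      have : n - 1 + (j + 1) = n + j := by omega
      rw [this, pow_add, eq_neg_of_add_eq_zero_left he, neg_mul, Finset.sum_mul]
      congr 1
      refine Finset.sum_congr rfl fun i _ => ?_
      rw [pow_add]; ring
    rw [e1]
    refine neg_mem (Ideal.sum_mem _ fun i hi => ?_)
    have hai := ha i hi
    rw [Finset.mem_Icc] at hi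
    by_cases hij : i ≤ j + 1
    · have := ih (j + 1 - i) (by omega)
      have h2 := Ideal.mul_mem_mul hai this
      rw [← pow_add] at h2
      have e3 : i + (j + 1 - i) = j + 1 := by omega
      have e4 : n - 1 + (j + 1 - i) = n - i + j := by omega
      rwa [e3, e4] at h2
    · exact Ideal.mul_mem_right _ _ (Ideal.pow_le_pow_right (by omega) hai)

lemma IsIntegralOverIdeal.mono [CommRing R] {Q Q' : Ideal R} (hQ : Q ≤ Q') {y : R}
    (h : IsIntegralOverIdeal Q y) : IsIntegralOverIdeal Q' y := by
  obtain ⟨n, hn, a, ha, he⟩ := h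
  exact ⟨n, hn, a, fun i hi => Ideal.pow_right_mono hQ i (ha i hi), he⟩

/-- test for integrality: asymptotically large powers -/
lemma isIntegralOverIdeal_of_pow_mem [CommRing R] [IsNoetherianRing R] (Q : Ideal R) (y : R)
    (h : ∀ c : ℕ, ∃ j o : ℕ, (1 + c) * o + 1 ≤ j ∧ y ^ j ∈ Q ^ (j - o)) :
    IsIntegralOverIdeal Q y := by
  classical
  let Ly := Localization.Away y
  let inv : Ly := IsLocalization.Away.invSelf y
  have hinv : algebraMap R Ly y * inv = 1 := IsLocalization.Away.mul_invSelf y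
  let φ : R[X] →ₐ[R] Ly := Polynomial.aeval inv
  let T : Subalgebra R Ly := (reesAlgebra Q).map φ
  have : IsNoetherianRing T := by
    let f : reesAlgebra Q →+* T :=
      (φ.toRingHom.comp (reesAlgebra Q).val.toRingHom).codRestrict T (fun x => ⟨x.1, x.2, rfl⟩)
    refine isNoetherianRing_of_surjective _ _ f ?_
    rintro ⟨t, p, hp, rfl⟩
    exact ⟨⟨p, hp⟩, rfl⟩
  have hmemT : ∀ a ∈ Q, algebraMap R Ly a * inv ∈ T := by
    intro a ha
    refine ⟨Polynomial.monomial 1 a, ?_, ?_⟩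
    · exact reesAlgebra.monomial_mem.2 (by simpa using ha)
    · simp [φ, Polynomial.aeval_monomial]
  let S : Set T := {t | ∃ a ∈ Q, (t : Ly) = algebraMap R Ly a * inv}
  let b : Ideal T := Ideal.span S
  let yT : T := algebraMap R T y
  have hyT : (yT : Ly) = algebraMap R Ly y := rfl
  have hynzd : yT ∈ nonZeroDivisors T := by
    rw [mem_nonZeroDivisors_iff_right]
    intro x hx
    have : (x : Ly) * algebraMap R Ly y = 0 := congrArg Subtype.val hx
    have h2 : (x : Ly) = 0 := by
      calc (x : Ly) = x * (algebraMap R Ly y * inv) := by rw [hinv, mul_one]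
        _ = 0 := by rw [← mul_assoc, this, zero_mul]
    exact Subtype.ext h2
  have hQb : Q.map (algebraMap R T) ≤ Ideal.span {yT} * b := by
    rw [Ideal.map_le_iff_le_comap]
    intro a ha
    rw [Ideal.mem_comap]
    have : algebraMap R T a = yT * ⟨_, hmemT a ha⟩ := by
      apply Subtype.ext
      change algebraMap R Ly a = algebraMap R Ly y * (algebraMap R Ly a * inv)
      rw [mul_left_comm, hinv, mul_one]
    rw [this]
    exact Ideal.mul_mem_mul (Ideal.mem_span_singleton_self _) (Ideal.subset_span ⟨a, ha, rfl⟩)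
  have hkey : ∀ j o, o ≤ j → y ^ j ∈ Q ^ (j - o) → yT ^ o ∈ b ^ (j - o) := by
    intro j o hoj hy
    have h1 : algebraMap R T (y ^ j) ∈ (Q ^ (j - o)).map (algebraMap R T) := Ideal.mem_map_of_mem _ hy
    rw [Ideal.map_pow] at h1
    have h2 := Ideal.pow_right_mono hQb (j - o) h1
    rw [mul_pow, Ideal.span_singleton_pow, Ideal.mem_span_singleton_mul] at h2
    obtain ⟨z, hz, e⟩ := h2
    rw [map_pow] at e
    have e2 : yT ^ (j - o) * (z - yT ^ o) = 0 := by
      rw [mul_sub, e, ← pow_add, Nat.sub_add_cancel hoj]; simp [yT]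
    have e3 := (mul_left_mem_nonZeroDivisors_eq_zero_iff (pow_mem hynzd _)).1 e2
    rw [sub_eq_zero] at e3
    rwa [← e3]
  obtain ⟨c, hc⟩ := artinRees_pow b yT hynzd
  obtain ⟨j, o, hjo, hy⟩ := h c
  have hjo' : c * o + o + 1 ≤ j := by nlinarith
  have h1 := hc o (j - o - c * o) (by
    rw [Nat.sub_add_cancel (by omega)]; exact hkey j o (by nlinarith) hy)
  have h1b : (1 : T) ∈ b := Ideal.pow_le_self (by omega) h1
  have hb : ∀ t ∈ b, ∃ p ∈ reesAlgebra Q, p.coeff 0 = 0 ∧ φ p = t := by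
    intro t ht
    induction ht using Submodule.span_induction with
    | mem x hx =>
      obtain ⟨a, ha, e⟩ := hx
      refine ⟨Polynomial.monomial 1 a, reesAlgebra.monomial_mem.2 (by simpa using ha), ?_, ?_⟩
      · simp [Polynomial.coeff_monomial]
      · rw [e]; simp [φ, Polynomial.aeval_monomial]
    | zero => exact ⟨0, zero_mem _, by simp, by simp⟩
    | add x z _ _ hx hz =>
      obtain ⟨p, hp, h0, e⟩ := hx
      obtain ⟨p', hp', h0', e'⟩ := hz
      exact ⟨p + p', add_mem hp hp', by simp [h0, h0'], by simp [e, e']⟩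
    | smul r x _ hx =>
      obtain ⟨p, hp, h0, e⟩ := hx
      obtain ⟨r', hr', er⟩ := r.2
      refine ⟨r' * p, mul_mem hr' hp, by simp [Polynomial.mul_coeff_zero, h0], ?_⟩
      rw [map_mul, e]
      change φ r' = _ at er
      rw [er]; rfl
  obtain ⟨p, hp, hp0, hp1⟩ := hb 1 h1b
  set s := p.natDegree with hs
  have e1 : algebraMap R Ly (∑ i ∈ Finset.range (s + 1), p.coeff i * y ^ (s - i))
      = algebraMap R Ly (y ^ s) := by
    have e2 : ∑ i ∈ Finset.range (s + 1), algebraMap R Ly (p.coeff i) * inv ^ i = 1 := by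
      have : φ p = 1 := by rw [hp1]; rfl
      rw [← this]; simp only [φ]; rw [Polynomial.aeval_eq_sum_range]
      simp [Algebra.smul_def]; rfl
    rw [map_sum, map_pow]
    calc _ = algebraMap R Ly y ^ s * ∑ i ∈ Finset.range (s + 1), algebraMap R Ly (p.coeff i) * inv ^ i := by
          rw [Finset.mul_sum]
          refine Finset.sum_congr rfl fun i hi => ?_
          have : i ≤ s := by simp at hi; omega
          rw [map_mul, map_pow]
          have h3 : algebraMap R Ly y ^ s = algebraMap R Ly y ^ (s - i) * algebraMap R Ly y ^ i := by
            rw [← pow_add, Nat.sub_add_cancel this]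
          have h4 : algebraMap R Ly y ^ i * inv ^ i = 1 := by rw [← mul_pow, hinv, one_pow]
          calc _ = algebraMap R Ly (p.coeff i) * algebraMap R Ly y ^ (s - i) * (algebraMap R Ly y ^ i * inv ^ i) := by
                rw [h4, mul_one]
            _ = _ := by rw [h3]; ring
      _ = _ := by rw [e2, mul_one]
  obtain ⟨⟨u, t, rfl⟩, hu⟩ := (IsLocalization.eq_iff_exists (Submonoid.powers y) Ly).1 e1
  simp only at hu
  refine ⟨s + (t + 1), by omega, fun i => - p.coeff i, ?_, ?_⟩
  · intro i _
    exact neg_mem (hp i)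
  · have hI : ∑ i ∈ Finset.Icc 1 (s + (t + 1)), -p.coeff i * y ^ (s + (t + 1) - i)
        = - ∑ i ∈ Finset.range (s + (t + 1) + 1), p.coeff i * y ^ (s + (t + 1) - i) := by
      rw [Finset.sum_range_succ', hp0, zero_mul, add_zero, ← Finset.sum_neg_distrib]
      rw [Finset.range_eq_Ico, Finset.sum_Ico_add' (fun i => -(p.coeff i * y ^ (s + (t + 1) - i))) 0 _ 1]
      refine Finset.sum_congr ?_ fun i _ => by ring
      ext i; simp
    rw [hI]
    have hII : ∑ i ∈ Finset.range (s + (t + 1) + 1), p.coeff i * y ^ (s + (t + 1) - i)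
        = ∑ i ∈ Finset.range (s + 1), p.coeff i * y ^ (s + (t + 1) - i) := by
      symm
      apply Finset.sum_subset
      · intro i; simp; omega
      · intro i _ hi
        rw [Polynomial.coeff_eq_zero_of_natDegree_lt (by simp at hi; omega), zero_mul]
    rw [hII]
    have hIII : ∑ i ∈ Finset.range (s + 1), p.coeff i * y ^ (s + (t + 1) - i)
        = y * (y ^ t * ∑ i ∈ Finset.range (s + 1), p.coeff i * y ^ (s - i)) := by
      rw [Finset.mul_sum, Finset.mul_sum]
      refine Finset.sum_congr rfl fun i hi => ?_
      have : s + (t + 1) - i = (s - i) + (t + 1) := by simp at hi; omega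
      rw [this]; ring
    rw [hIII, hu]; ring

lemma isIntegralOverIdeal_of_vset [CommRing R] [IsNoetherianRing R] {J : Ideal R} {n : ℕ} {y : R}
    (h : vset J n y) : IsIntegralOverIdeal (J ^ n) y := by
  rcases Nat.eq_zero_or_pos n with rfl | hn
  · exact ⟨1, one_pos, fun _ => -y, by simp, by simp⟩
  apply isIntegralOverIdeal_of_pow_mem
  intro c
  have hc : (0 : ℝ) < 1 + c := by positivity
  obtain ⟨C, hC⟩ := h (n - 1 / (2 * (1 + c))) (by
    have : (0 : ℝ) < 1 / (2 * (1 + c)) := by positivity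
    linarith)
  set j := ⌈2 * ((1 + c) * (|C| + 1) + 1)⌉₊ with hj
  set o := ⌈1 / (2 * (1 + c)) * j + |C|⌉₊ with ho
  have hj1 := Nat.le_ceil (2 * ((1 + c) * (|C| + 1) + 1))
  rw [← hj] at hj1
  have ho1 := Nat.le_ceil (1 / (2 * (1 + c)) * (j : ℝ) + |C|)
  have ho2 := Nat.ceil_lt_add_one (a := 1 / (2 * (1 + c)) * (j : ℝ) + |C|) (by positivity)
  rw [← ho] at ho1 ho2
  have e1 : (1 + c) * (1 / (2 * (1 + c)) * (j : ℝ)) = j / 2 := by field_simp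
  have key : (1 + c) * o + 1 ≤ j := by
    have : ((1 + c) * o + 1 : ℝ) ≤ j := by nlinarith
    exact_mod_cast this
  have hoj : o ≤ j := by nlinarith
  refine ⟨j, o, key, ?_⟩
  rw [← pow_mul]
  apply hC
  have hn' : (1 : ℝ) ≤ n := by exact_mod_cast hn
  push_cast [Nat.cast_sub hoj]
  have : (o : ℝ) ≤ n * o := by nlinarith [(Nat.cast_nonneg o : (0:ℝ) ≤ o)]
  nlinarith [le_abs_self C]

lemma vset_of_isIntegralOverIdeal [CommRing R] {J : Ideal R} {n : ℕ} {y : R}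
    (h : IsIntegralOverIdeal (J ^ n) y) : vset J n y := by
  obtain ⟨m, hm⟩ := h.pow_mem
  refine vset_of_eventually (C := n * m) fun j N hN => ?_
  by_cases hj : m ≤ j
  · obtain ⟨i, rfl⟩ := Nat.exists_eq_add_of_le hj
    have := hm i
    rw [← pow_mul] at this
    refine Ideal.pow_le_pow_right ?_ this
    push_cast at hN
    have : (N : ℝ) ≤ (n * i : ℕ) := by push_cast; linarith
    exact_mod_cast this
  · have : (N : ℝ) ≤ 0 := by
      have : (j : ℝ) ≤ m := by exact_mod_cast (by omega : j ≤ m)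
      nlinarith [(Nat.cast_nonneg n : (0:ℝ) ≤ n)]
    have : N ≤ 0 := by exact_mod_cast this
    simp [Nat.le_zero.1 this]

lemma vset_reduction [CommRing R] {I J : Ideal R} (hred : ∃ N : ℕ, ∀ n ≥ N, I ^ (n + 1) = J * I ^ n)
    {α : ℝ} {y : R} (h : vset I α y) : vset J α y := by
  obtain ⟨N, hN⟩ := hred
  have hp : ∀ n, I ^ (N + n) ≤ J ^ n := by
    intro n
    have : I ^ (N + n) = J ^ n * I ^ N := by
      induction n with
      | zero => simp
      | succ n ih => rw [← add_assoc, hN _ (by omega), ih, pow_succ']; ring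
    rw [this]; exact Ideal.mul_le_left
  intro γ hγ
  obtain ⟨C, hC⟩ := h γ hγ
  refine ⟨C + N, fun n M hM => hp M (hC _ _ ?_)⟩
  push_cast; linarith

lemma intCl_pow_eq_vge [CommRing R] [IsNoetherianRing R] {I J : Ideal R} (hJI : J ≤ I)
    (hred : ∃ N : ℕ, ∀ n ≥ N, I ^ (n + 1) = J * I ^ n) (n : ℕ) :
    intCl (I ^ n) = vge J n := by
  apply le_antisymm
  · apply Ideal.span_le.2
    intro y hy
    exact vset_reduction hred (vset_of_isIntegralOverIdeal hy)
  · intro y hy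
    exact Ideal.subset_span ((isIntegralOverIdeal_of_vset hy).mono (Ideal.pow_right_mono hJI n))


-- part 3

/-! ## P3 : the completion is Noetherian; Chevalley -/

lemma completion_surj {S T : Type*} [CommRing S] [CommRing T] (φ : S →+* T)
    (hφ : Function.Surjective φ) (b : Ideal S) (I : Ideal T) (h : b.map φ = I) :
    ∃ Φ : AdicCompletion b S →+* AdicCompletion I T, Function.Surjective Φ := by
  have hle : ∀ n, b ^ n ≤ (I ^ n).comap φ := fun n => by
    rw [← Ideal.map_le_iff_le_comap, Ideal.map_pow, h]
  let f : ∀ n, AdicCompletion b S →+* T ⧸ I ^ n := fun n =>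
    (Ideal.quotientMap (I ^ n) φ (hle n)).comp (AdicCompletion.evalₐ b n).toRingHom
  have key : ∀ (x : AdicCompletion.AdicCauchySequence b S) n,
      f n (AdicCompletion.mk b S x) = Ideal.Quotient.mk _ (φ (x.val n)) := by
    intro x n
    simp only [f, RingHom.comp_apply]
    have : (AdicCompletion.evalₐ b n).toRingHom (AdicCompletion.mk b S x)
        = Ideal.Quotient.mk (b ^ n) (x.val n) := AdicCompletion.evalₐ_mk b n x
    rw [this, Ideal.quotientMap_mk]
  have hf : ∀ {m n : ℕ} (hle : m ≤ n), (Ideal.Quotient.factorPow I hle).comp (f n) = f m := by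
    intro m n hmn
    ext x
    obtain ⟨x, rfl⟩ := AdicCompletion.mk_surjective b S x
    rw [RingHom.comp_apply, key, key]
    simp only [Ideal.Quotient.factorPow, Ideal.Quotient.factor_mk]
    rw [Ideal.Quotient.eq, ← map_sub]
    have := x.property hmn
    rw [SModEq.sub_mem] at this
    have h2 := hle m (by simpa using this)
    rw [← neg_sub, map_neg]
    exact (Ideal.neg_mem_iff _).2 h2
  refine ⟨AdicCompletion.liftRingHom I f hf, fun y => ?_⟩
  obtain ⟨y, rfl⟩ := AdicCompletion.mk_surjective I T y
  have hs : ∀ n, ∃ s ∈ b ^ n, φ s = y.val (n + 1) - y.val n := by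
    intro n
    have := y.property (Nat.le_succ n)
    rw [SModEq.sub_mem] at this
    have h3 : y.val (n + 1) - y.val n ∈ (b ^ n).map φ := by
      rw [Ideal.map_pow, h]
      rw [← neg_sub]
      exact (Ideal.neg_mem_iff _).2 (by simpa using this)
    exact (Ideal.mem_map_iff_of_surjective φ hφ).1 h3
  choose s hs1 hs2 using hs
  obtain ⟨s0, hs0⟩ := hφ (y.val 0)
  let t : ℕ → S := fun n => s0 + ∑ i ∈ range n, s i
  have ht : ∀ n, φ (t n) = y.val n := by
    intro n
    induction n with
    | zero => simp [t, hs0]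
    | succ n ih =>
      have : t (n + 1) = t n + s n := by simp [t, sum_range_succ, add_assoc]
      rw [this, map_add, ih, hs2]; ring
  let x : AdicCompletion.AdicCauchySequence b S := AdicCompletion.AdicCauchySequence.mk b S t (by
    intro n
    rw [SModEq.sub_mem]
    have : t n - t (n + 1) = - s n := by simp [t, sum_range_succ]
    rw [this]
    simpa using hs1 n)
  refine ⟨AdicCompletion.mk b S x, AdicCompletion.ext_evalₐ fun n => ?_⟩
  rw [AdicCompletion.evalₐ_liftRingHom, key, AdicCompletion.evalₐ_mk]
  exact congrArg _ (ht n)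

lemma completion_noetherian {T : Type*} [CommRing T] [IsNoetherianRing T] (I : Ideal T) :
    IsNoetherianRing (AdicCompletion I T) := by
  obtain ⟨n, a, ha⟩ := Submodule.fg_iff_exists_fin_generating_family.1 (IsNoetherian.noetherian I)
  let φ : MvPolynomial (Fin n) T →+* T := (MvPolynomial.aeval a : MvPolynomial (Fin n) T →ₐ[T] T).toRingHom
  have hφ : Function.Surjective φ := fun t => ⟨MvPolynomial.C t, by simp [φ]⟩
  have hm : (MvPolynomial.idealOfVars (Fin n) T).map φ = I := by
    rw [MvPolynomial.idealOfVars, Ideal.map_span, ← Set.range_comp]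
    have : (φ ∘ MvPolynomial.X) = a := by ext i; simp [φ]
    rw [this]; exact ha
  obtain ⟨Φ, hΦ⟩ := completion_surj φ hφ _ I hm
  have e := (MvPowerSeries.toAdicCompletionAlgEquiv (Fin n) T).toRingEquiv
  exact isNoetherianRing_of_surjective _ _ (Φ.comp e.toRingHom) (hΦ.comp e.surjective)

lemma vset_map {R S : Type*} [CommRing R] [CommRing S] (φ : R →+* S) {J : Ideal R} {α : ℝ} {y : R}
    (h : vset J α y) : vset (J.map φ) α (φ y) := by
  intro β hβ
  obtain ⟨C, hC⟩ := h β hβ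
  refine ⟨C, fun n N hN => ?_⟩
  rw [← map_pow, ← Ideal.map_pow]
  exact Ideal.mem_map_of_mem _ (hC n N hN)

lemma not_vset_all {T : Type*} [CommRing T] [IsNoetherianRing T] [IsLocalRing T] [IsReduced T]
    (b : Ideal T) (hb : b ≤ maximalIdeal T) (y : T) (hy : y ≠ 0) : ∃ N : ℕ, ¬ vset b N y := by
  by_contra! hcon
  have : y ∉ nilradical T := by rwa [nilradical_eq_zero, Ideal.zero_eq_bot, Ideal.mem_bot]
  rw [nilradical_eq_sInf, Submodule.mem_sInf] at this
  push Not at this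
  obtain ⟨P, hP, hyP⟩ := this
  have hP' : Ideal.IsPrime P := hP
  have hy0 : Ideal.Quotient.mk P y ≠ 0 := by rwa [Ne, Ideal.Quotient.eq_zero_iff_mem]
  obtain ⟨c, hc⟩ := artinRees_pow (b.map (Ideal.Quotient.mk P)) (Ideal.Quotient.mk P y)
    (mem_nonZeroDivisors_of_ne_zero hy0)
  obtain ⟨C, hC⟩ := vset_map (Ideal.Quotient.mk P) (hcon (c + 2)) (c + 1) (by push_cast; linarith)
  have h1 := hc (⌈C⌉₊ + 1) 1 (hC _ _ (by
    have := Nat.le_ceil C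
    push_cast
    nlinarith))
  rw [pow_one] at h1
  obtain ⟨z, hz, hz1⟩ := (Ideal.mem_map_iff_of_surjective _ Ideal.Quotient.mk_surjective).1 h1
  rw [← map_one (Ideal.Quotient.mk P), Ideal.Quotient.eq] at hz1
  have h2 := IsLocalRing.le_maximalIdeal hP'.ne_top hz1
  have h3 := Ideal.sub_mem _ (hb hz) h2
  rw [sub_sub_cancel] at h3
  exact (Ideal.ne_top_iff_one _).1 (IsLocalRing.maximalIdeal.isMaximal T).ne_top h3

lemma quot_artinian [CommRing R] [IsLocalRing R] [IsNoetherianRing R] {j : ℕ} {Q : Ideal R}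
    (h : maximalIdeal R ^ j ≤ Q) : IsArtinianRing (R ⧸ Q) := by
  by_cases hQ : Q = ⊤
  · subst hQ
    have : Subsingleton (R ⧸ (⊤ : Ideal R)) := Ideal.Quotient.subsingleton_iff.2 rfl
    infer_instance
  · apply IsLocalRing.quotient_artinian_of_mem_minimalPrimes_of_isLocalRing
    refine ⟨⟨inferInstance, IsLocalRing.le_maximalIdeal hQ⟩, fun P hP _ => ?_⟩
    exact hP.1.le_of_pow_le (h.trans hP.2)

lemma quot_pow_artinian [CommRing R] [IsLocalRing R] [IsNoetherianRing R] (j : ℕ) :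
    IsArtinianRing (R ⧸ (maximalIdeal R) ^ j) := quot_artinian le_rfl

lemma chevalley [CommRing R] [IsLocalRing R] [IsNoetherianRing R] (hAU : AnalyticallyUnramified R)
    (J : Ideal R) (hJ : J.radical = maximalIdeal R) (k : ℕ) :
    ∃ N : ℕ, vge J N ≤ maximalIdeal R ^ k := by
  by_contra! hcon
  set m := maximalIdeal R with hm
  have hst : ∀ j, ∃ N : ℕ, ∀ M ≥ N, vge J N ⊔ m ^ j = vge J M ⊔ m ^ j := by
    intro j
    have := quot_pow_artinian (R := R) j
    let f : ℕ →o (Ideal (R ⧸ m ^ j))ᵒᵈ :=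
      ⟨fun N => OrderDual.toDual ((vge J N).map (Ideal.Quotient.mk (m ^ j))), fun a b hab =>
        Ideal.map_mono (vge_anti (by exact_mod_cast hab))⟩
    obtain ⟨N, hN⟩ := IsArtinian.monotone_stabilizes f
    refine ⟨N, fun M hM => ?_⟩
    have h1 : (vge J N).map (Ideal.Quotient.mk (m ^ j)) = (vge J M).map (Ideal.Quotient.mk (m ^ j)) :=
      hN M hM
    have h2 := congrArg (Ideal.comap (Ideal.Quotient.mk (m ^ j))) h1
    simpa [Ideal.comap_map_of_surjective _ Ideal.Quotient.mk_surjective, ← RingHom.ker_eq_comap_bot]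
      using h2
  choose N hN using hst
  set G : ℕ → Ideal R := fun j => vge J (N j) ⊔ m ^ j with hG
  have hGle : ∀ j M, G j ≤ vge J (M : ℕ) ⊔ m ^ j := by
    intro j M
    rw [hG]; simp only
    rw [hN j (max (N j) M) (le_max_left _ _)]
    exact sup_le_sup_right (vge_anti (by exact_mod_cast le_max_right _ _)) _
  have hGge : ∀ j (M : ℕ), N j ≤ M → vge J (M : ℕ) ≤ G j := fun j M hM =>
    (vge_anti (by exact_mod_cast hM)).trans le_sup_left
  have hstep : ∀ j, ∀ y ∈ G j, ∃ z ∈ G (j + 1), z - y ∈ m ^ j := by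
    intro j y hy
    obtain ⟨v, hv, u, hu, rfl⟩ := Submodule.mem_sup.1 (hGle j (N (j + 1)) hy)
    exact ⟨v, hGge _ _ le_rfl hv, by simpa using hu⟩
  obtain ⟨y0, hy0, hy0'⟩ := SetLike.not_le_iff_exists.1 (hcon (N k))
  choose! nx hnx1 hnx2 using hstep
  let z : ℕ → R := fun n => Nat.rec y0 (fun n y => nx (k + n) y) n
  have hz0 : z 0 = y0 := rfl
  have hzs : ∀ n, z (n + 1) = nx (k + n) (z n) := fun n => rfl
  have hzG : ∀ n, z n ∈ G (k + n) := by
    intro n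
    induction n with
    | zero => exact hGge _ _ le_rfl hy0
    | succ n ih => rw [hzs]; exact hnx1 _ _ ih
  have hzd : ∀ n, z (n + 1) - z n ∈ m ^ (k + n) := fun n => by rw [hzs]; exact hnx2 _ _ (hzG n)
  have hzk : ∀ n, z n ∉ m ^ k := by
    intro n
    induction n with
    | zero => exact hy0'
    | succ n ih =>
      intro h
      apply ih
      have := Ideal.sub_mem _ h (Ideal.pow_le_pow_right (Nat.le_add_right k n) (hzd n))
      simpa using this
  let x : AdicCompletion.AdicCauchySequence m R := AdicCompletion.AdicCauchySequence.mk m R z (by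
    intro n
    rw [SModEq.sub_mem, ← neg_sub]
    refine (Submodule.neg_mem_iff _).2 ?_
    simpa using Ideal.pow_le_pow_right (Nat.le_add_left n k) (hzd n))
  set ξ := AdicCompletion.mk m R x with hξ
  have hξ0 : ξ ≠ 0 := by
    intro h
    have h1 := congrArg (AdicCompletion.evalₐ m k) h
    rw [hξ, AdicCompletion.evalₐ_mk, map_zero, Ideal.Quotient.eq_zero_iff_mem] at h1
    exact hzk k h1
  have := completion_noetherian m
  have hred : IsReduced (AdicCompletion m R) := hAU
  have hJm : J ≤ m := by rw [← hJ]; exact Ideal.le_radical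
  obtain ⟨M, hM⟩ := not_vset_all (J.map (algebraMap R (AdicCompletion m R))) (by
    rw [AdicCompletion.maximalIdeal_eq_map]; exact Ideal.map_mono hJm) ξ hξ0
  apply hM
  obtain ⟨n, hn⟩ := Ideal.exists_pow_le_of_le_radical_of_fg (I := m) (J := J ^ M) (by
    rcases Nat.eq_zero_or_pos M with rfl | h
    · simp [Ideal.radical_top]
    · rw [Ideal.radical_pow J h.ne', hJ]) (IsNoetherian.noetherian _)
  have hzn : vset J M (z n) := by
    have h1 := hGle _ M (hzG n)
    have h2 : vge J (M : ℕ) ⊔ m ^ (k + n) ≤ vge J (M : ℕ) := by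
      refine sup_le le_rfl ?_
      exact (Ideal.pow_le_pow_right (Nat.le_add_left n k)).trans (hn.trans (pow_le_vge M))
    exact h2 h1
  have h3 : ξ - algebraMap R _ (z n) ∈ (J.map (algebraMap R (AdicCompletion m R))) ^ M := by
    rw [← Ideal.map_pow]
    refine Ideal.map_mono hn ?_
    have hker : ξ - algebraMap R _ (z n) ∈ (AdicCompletion.eval m R n).ker := by
      rw [LinearMap.mem_ker, map_sub, sub_eq_zero, AdicCompletion.algebraMap_apply]
      have hxn : (x : ℕ → R) n = z n := rfl
      have h5 : ξ.1 n = Submodule.mkQ (m ^ n • ⊤ : Submodule R R) ((x : ℕ → R) n) := rfl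
      rw [AdicCompletion.eval_apply, h5, hxn, Algebra.algebraMap_self_apply,
        AdicCompletion.eval_of]
    rw [← AdicCompletion.pow_smul_top_eq_ker_eval (IsNoetherian.noetherian m)] at hker
    rw [Ideal.smul_top_eq_map] at hker
    exact hker
  have := vset_add (vset_of_mem_pow h3) (vset_map (algebraMap R (AdicCompletion m R)) hzn)
  simpa using this


-- part 4

/-! ## P4 : regular generators of J -/

lemma avoid_aux [CommRing R] [IsLocalRing R] [Infinite (ResidueField R)]
    {n : ℕ} (s : Fin (n + 1) → R) (PP : Set (Ideal R)) (hfin : PP.Finite)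
    (hP : ∀ P ∈ PP, ∃ i, s i ∉ P) :
    ∃ u : Fin (n + 1) → R, IsUnit (u 0) ∧ ∀ P ∈ PP, ∑ i, u i * s i ∉ P := by
  classical
  let k := ResidueField R
  let W : Ideal R → Submodule k (Fin (n + 1) → k) := fun P =>
    { carrier := {v | ∃ u : Fin (n + 1) → R, (∑ i, u i * s i ∈ P) ∧ ∀ i, residue R (u i) = v i}
      add_mem' := by
        rintro a b ⟨u, hu, hu'⟩ ⟨w, hw, hw'⟩
        refine ⟨u + w, ?_, fun i => by simp [hu', hw']⟩
        have := P.add_mem hu hw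
        rw [← sum_add_distrib] at this
        simpa [add_mul] using this
      zero_mem' := ⟨0, by simp, by simp⟩
      smul_mem' := by
        rintro c a ⟨u, hu, hu'⟩
        obtain ⟨r, rfl⟩ := residue_surjective (R := R) c
        refine ⟨r • u, ?_, fun i => by simp [hu']⟩
        have := P.mul_mem_left r hu
        rw [mul_sum] at this
        simpa [mul_assoc] using this }
  let W0 : Submodule k (Fin (n + 1) → k) := LinearMap.ker (LinearMap.proj (0 : Fin (n + 1)))
  have hW0 : W0 ≠ ⊤ := by
    intro h
    have : (Pi.single 0 1 : Fin (n + 1) → k) ∈ W0 := by rw [h]; trivial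
    simp [W0] at this
  have hW : ∀ P ∈ PP, W P ≠ ⊤ := by
    intro P hPP h
    obtain ⟨i0, hi0⟩ := hP P hPP
    apply hi0
    have hle : Ideal.span (Set.range s) ≤ P := by
      refine Submodule.le_of_le_smul_of_le_jacobson_bot (I := maximalIdeal R) ?_ ?_ ?_
      · exact Submodule.fg_span (Set.finite_range s)
      · rw [IsLocalRing.jacobson_eq_maximalIdeal _ bot_ne_top]
      · rw [Ideal.span_le]
        rintro _ ⟨i, rfl⟩
        have : (Pi.single i 1 : Fin (n + 1) → k) ∈ W P := by rw [h]; trivial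
        obtain ⟨u, hu, hu'⟩ := this
        have h1 : s i = ∑ j, u j * s j + ∑ j, ((Pi.single i 1 : Fin (n + 1) → R) j - u j) * s j := by
          rw [← sum_add_distrib, sum_congr rfl (g := fun j => (Pi.single i 1 : Fin (n + 1) → R) j * s j)
            (fun j _ => by ring)]
          simp [Pi.single_apply]
        rw [SetLike.mem_coe, h1]
        refine Submodule.add_mem_sup hu (Submodule.sum_mem _ fun j _ => ?_)
        refine Submodule.smul_mem_smul ?_ (Ideal.subset_span ⟨j, rfl⟩)
        rw [← residue_eq_zero_iff, map_sub, hu', sub_eq_zero]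
        by_cases hij : j = i
        · subst hij; simp
        · simp [Pi.single_apply, hij]
    exact hle (Ideal.subset_span ⟨i0, rfl⟩)
  let S : Finset (Subspace k (Fin (n + 1) → k)) := insert W0 (hfin.toFinset.image W)
  have hS : ⊤ ∉ S := by
    simp only [S, Finset.mem_insert, Finset.mem_image, Set.Finite.mem_toFinset, not_or, not_exists]
    exact ⟨fun h => hW0 h.symm, fun P hP => hW P hP.1 hP.2⟩
  have := Subspace.biUnion_ne_univ_of_top_notMem hS
  rw [Set.ne_univ_iff_exists_notMem] at this
  obtain ⟨v, hv⟩ := this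
  simp only [Set.mem_iUnion, not_exists] at hv
  choose u hu using fun i => residue_surjective (R := R) (v i)
  refine ⟨u, ?_, fun P hP h => hv (W P) (by
    simp only [S, Finset.mem_insert, Finset.mem_image, Set.Finite.mem_toFinset]
    exact Or.inr ⟨P, hP, rfl⟩) ⟨u, h, hu⟩⟩
  rw [← residue_ne_zero_iff_isUnit, hu]
  intro h
  exact hv W0 (by simp [S]) (by simp [W0, h])

open CategoryTheory Abelian in
lemma exists_reg_aux {R : Type u} [CommRing R] [IsLocalRing R] [IsNoetherianRing R]
    [Infinite (ResidueField R)] (J : Ideal R) (n : ℕ) (M : ModuleCat.{u} R) [Module.Finite R M]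
    (K : Ideal R) (hK : K ≤ Module.annihilator R M) (s : Fin n → R)
    (hJ : J = K ⊔ Ideal.span (Set.range s))
    (hE : ∀ i < n, Subsingleton (Ext (ModuleCat.of R (R ⧸ J)) M i)) :
    ∃ z : Fin n → R, J = K ⊔ Ideal.span (Set.range z) ∧
      RingTheory.Sequence.IsWeaklyRegular M (List.ofFn z) := by
  induction n generalizing M K with
  | zero => exact ⟨s, hJ, by simp⟩
  | succ n ih =>
    have h0 : Subsingleton (ModuleCat.of R (R ⧸ J) ⟶ M) :=
      Ext.addEquiv₀.subsingleton_congr.mp (hE 0 n.zero_lt_succ)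
    have h0' : Subsingleton ((R ⧸ J) →ₗ[R] M) :=
      (ModuleCat.homAddEquiv (M := ModuleCat.of R (R ⧸ J)) (N := M)).symm.subsingleton
    obtain ⟨x, hx, hxr⟩ := IsSMulRegular.subsingleton_linearMap_iff.mp h0'
    rw [Ideal.annihilator_quotient] at hx
    have hass : ∀ P ∈ associatedPrimes R M, ∃ i, s i ∉ P := by
      intro P hP
      by_contra! hcon
      have hJP : J ≤ P := by
        rw [hJ]
        refine sup_le (hK.trans ?_) (Ideal.span_le.2 ?_)
        · have := IsAssociatedPrime.annihilator_le hP
          rwa [Submodule.annihilator_top] at this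
        · rintro _ ⟨i, rfl⟩; exact hcon i
      have h1 : x ∈ ⋃ p ∈ associatedPrimes R M, (p : Set R) :=
        Set.mem_iUnion₂.2 ⟨P, hP, hJP hx⟩
      rw [biUnion_associatedPrimes_eq_zero_divisors] at h1
      obtain ⟨y, hy0, hy⟩ := h1
      exact hy0 (hxr (hy.trans (smul_zero x).symm))
    obtain ⟨u, hu0, hu⟩ := avoid_aux s _ (associatedPrimes.finite R M) hass
    set z0 := ∑ i, u i * s i with hz0
    have hz0r : IsSMulRegular M z0 := by
      rw [isSMulRegular_iff_right_eq_zero_of_smul]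
      intro y hy
      by_contra hy0
      have h1 : z0 ∈ ⋃ p ∈ associatedPrimes R M, (p : Set R) := by
        rw [biUnion_associatedPrimes_eq_zero_divisors]
        exact ⟨y, hy0, hy⟩
      obtain ⟨P, hP, h2⟩ := Set.mem_iUnion₂.1 h1
      exact hu P hP h2
    have hJ' : J = (K ⊔ Ideal.span {z0}) ⊔ Ideal.span (Set.range (fun i : Fin n => s i.succ)) := by
      rw [hJ]
      apply le_antisymm
      · refine sup_le (le_sup_left.trans le_sup_left) (Ideal.span_le.2 ?_)
        have hsucc : ∀ i : Fin n, s i.succ ∈ (K ⊔ Ideal.span {z0}) ⊔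
            Ideal.span (Set.range (fun i : Fin n => s i.succ)) := fun i =>
          Ideal.mem_sup_right (Ideal.subset_span ⟨i, rfl⟩)
        rintro _ ⟨i, rfl⟩
        refine Fin.cases ?_ hsucc i
        rw [SetLike.mem_coe]
        refine (Ideal.unit_mul_mem_iff_mem _ hu0).1 ?_
        have : u 0 * s 0 = z0 - ∑ i : Fin n, u i.succ * s i.succ := by
          rw [hz0, Fin.sum_univ_succ]; ring
        rw [this]
        refine Ideal.sub_mem _ (Ideal.mem_sup_left (Ideal.mem_sup_right
          (Ideal.mem_span_singleton_self _))) (Ideal.sum_mem _ fun i _ => Ideal.mul_mem_left _ _ (hsucc i))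
      · refine sup_le (sup_le le_sup_left ?_) (le_trans ?_ le_sup_right)
        · rw [Ideal.span_singleton_le_iff_mem]
          exact Ideal.mem_sup_right (Ideal.sum_mem _ fun i _ =>
            Ideal.mul_mem_left _ _ (Ideal.subset_span ⟨i, rfl⟩))
        · apply Ideal.span_mono
          rintro _ ⟨i, rfl⟩; exact ⟨_, rfl⟩
    obtain ⟨z, hz1, hz2⟩ := ih (ModuleCat.of R (QuotSMulTop z0 M)) (K ⊔ Ideal.span {z0}) (by
      refine sup_le (hK.trans ?_) ?_
      · exact LinearMap.annihilator_le_of_surjective (Submodule.mkQ _) (Submodule.mkQ_surjective _)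
      · rw [Ideal.span_singleton_le_iff_mem, Module.mem_annihilator]
        intro y
        obtain ⟨y, rfl⟩ := Submodule.mkQ_surjective _ y
        rw [← map_smul, Submodule.mkQ_apply, Submodule.Quotient.mk_eq_zero]
        exact Submodule.smul_mem_pointwise_smul _ _ _ trivial) _ hJ' (by
      intro i hi
      have zero1 := AddCommGrpCat.isZero_of_iff_subsingleton.mpr (hE i (by omega))
      have zero2 := AddCommGrpCat.isZero_of_iff_subsingleton.mpr (hE (i + 1) (by omega))
      exact AddCommGrpCat.subsingleton_of_isZero <| ShortComplex.Exact.isZero_of_both_zeros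
        ((Ext.covariant_sequence_exact₃' _ (hz0r.smulShortComplex_shortExact)) i (i + 1) rfl)
        (zero1.eq_zero_of_src _) (zero2.eq_zero_of_tgt _))
    refine ⟨Fin.cons z0 z, ?_, ?_⟩
    · rw [hz1, Fin.range_cons, Ideal.span_insert, sup_assoc]
    · rw [List.ofFn_succ, RingTheory.Sequence.isWeaklyRegular_cons_iff]
      exact ⟨hz0r, hz2⟩

open CategoryTheory Abelian in
lemma exists_reg_gens {R : Type u} [CommRing R] [IsLocalRing R] [IsNoetherianRing R]
    [Infinite (ResidueField R)] {d : ℕ} (hdim : ringKrullDim R = d) (hCM : IsCMLocal R)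
    (J : Ideal R) (hrad : J.radical = maximalIdeal R) (s : Fin d → R)
    (hJ : J = Ideal.span (Set.range s)) :
    ∃ z : Fin d → R, J = Ideal.span (Set.range z) ∧
      RingTheory.Sequence.IsWeaklyRegular R (List.ofFn z) := by
  obtain ⟨rs, hlen, hmem, hreg⟩ : ∃ rs : List R, rs.length = d ∧
      (∀ x ∈ rs, x ∈ maximalIdeal R) ∧ RingTheory.Sequence.IsRegular R rs := by
    rw [IsCMLocal, hdim] at hCM
    have h1 : rdepth R (maximalIdeal R) R = (d : ℕ∞) := by exact_mod_cast hCM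
    unfold rdepth at h1
    have : Nonempty {n : ℕ∞ | ∃ rs : List R, (rs.length : ℕ∞) = n ∧ (∀ x ∈ rs, x ∈ maximalIdeal R) ∧
        RingTheory.Sequence.IsRegular R rs} :=
      ⟨0, [], by simp, by simp, RingTheory.Sequence.IsRegular.nil R R⟩
    have h2 := ENat.sSup_mem_of_nonempty_of_lt_top (h1.trans_lt (by simp))
    rw [h1] at h2
    obtain ⟨rs, h3, h4, h5⟩ := h2
    exact ⟨rs, by exact_mod_cast h3, h4, h5⟩
  have hE := ModuleCat.subsingleton_ext_of_exists_isRegular (maximalIdeal R)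
    (ModuleCat.of R (R ⧸ J)) (by
      rw [Module.support_eq_zeroLocus, PrimeSpectrum.zeroLocus_subset_zeroLocus_iff]
      have : Module.annihilator R (R ⧸ J) = J := Ideal.annihilator_quotient
      change maximalIdeal R ≤ (Module.annihilator R (R ⧸ J)).radical
      rw [this, hrad]) (ModuleCat.of R R) (by
      have h : (maximalIdeal R) • (⊤ : Submodule R R) = maximalIdeal R := by simp
      change (maximalIdeal R) • (⊤ : Submodule R R) < ⊤
      rw [h]
      exact lt_top_iff_ne_top.2 (IsLocalRing.maximalIdeal.isMaximal R).ne_top) rs hmem hreg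
  rw [hlen] at hE
  obtain ⟨z, h1, h2⟩ := exists_reg_aux J d (ModuleCat.of R R) ⊥ bot_le s (by simpa using hJ) hE
  exact ⟨z, by simpa using h1, h2⟩


-- part 5

/-! ## P5 : quasi-regularity -/

section QR
variable [CommRing R] {d : ℕ}

def Ik (z : Fin d → R) (k : ℕ) : Ideal R := Ideal.span {x | ∃ j : Fin d, j.val < k ∧ z j = x}

lemma z_mem_Ik (z : Fin d → R) {k : ℕ} {j : Fin d} (h : j.val < k) : z j ∈ Ik z k :=
  Ideal.subset_span ⟨j, h, rfl⟩

lemma Ik_mono (z : Fin d → R) {k l : ℕ} (h : k ≤ l) : Ik z k ≤ Ik z l :=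
  Ideal.span_mono (by rintro x ⟨j, hj, rfl⟩; exact ⟨j, by omega, rfl⟩)

lemma Ik_full (z : Fin d → R) : Ik z d = Ideal.span (Set.range z) := by
  unfold Ik; congr 1; ext x; constructor
  · rintro ⟨j, _, rfl⟩; exact ⟨j, rfl⟩
  · rintro ⟨j, rfl⟩; exact ⟨j, j.2, rfl⟩

def Fm (d : ℕ) (k n : ℕ) (a : Ideal R) : Submodule R (MvPolynomial (Fin d) R) where
  carrier := {F | ∀ m, F.coeff m ∈ a ∧
    (¬(m.degree = n ∧ ∀ j : Fin d, k ≤ j.val → m j = 0) → F.coeff m = 0)}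
  add_mem' := by
    intro F G hF hG m
    refine ⟨by rw [MvPolynomial.coeff_add]; exact a.add_mem (hF m).1 (hG m).1, fun h => ?_⟩
    rw [MvPolynomial.coeff_add, (hF m).2 h, (hG m).2 h, add_zero]
  zero_mem' := by intro m; simp
  smul_mem' := by
    intro c F hF m
    refine ⟨by rw [MvPolynomial.coeff_smul]; exact a.mul_mem_left _ (hF m).1, fun h => ?_⟩
    rw [MvPolynomial.coeff_smul, (hF m).2 h, smul_zero]

lemma mem_Fm {k n : ℕ} {a : Ideal R} {F : MvPolynomial (Fin d) R} : F ∈ Fm d k n a ↔ ∀ m, F.coeff m ∈ a ∧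
    (¬(m.degree = n ∧ ∀ j : Fin d, k ≤ j.val → m j = 0) → F.coeff m = 0) := Iff.rfl

lemma Fm_mono {k l n : ℕ} {a : Ideal R} (h : k ≤ l) : Fm d k n a ≤ Fm d l n a := by
  intro F hF m
  refine ⟨(hF m).1, fun h' => (hF m).2 fun h'' => h' ⟨h''.1, fun j hj => h''.2 j (by omega)⟩⟩

lemma Fm_mono_ideal {k n : ℕ} {a b : Ideal R} (h : a ≤ b) : Fm d k n a ≤ Fm d k n b :=
  fun _ hF m => ⟨h (hF m).1, (hF m).2⟩

lemma X_mul_mem_Fm {k n : ℕ} {a : Ideal R} {j : Fin d} (hj : j.val < k)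
    {F : MvPolynomial (Fin d) R} (hF : F ∈ Fm d k n a) :
    MvPolynomial.X j * F ∈ Fm d k (n + 1) a := by
  classical
  intro m
  rw [MvPolynomial.coeff_X_mul']
  by_cases hm : j ∈ m.support
  · rw [if_pos hm]
    refine ⟨(hF _).1, fun h => (hF _).2 fun h' => h ?_⟩
    have hm1 : Finsupp.single j 1 ≤ m := by
      rw [Finsupp.single_le_iff]
      exact Nat.one_le_iff_ne_zero.2 (by simpa using hm)
    have hm2 : m - Finsupp.single j 1 + Finsupp.single j 1 = m := tsub_add_cancel_of_le hm1
    constructor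
    · rw [← hm2, map_add, h'.1]; simp
    · intro i hi
      rw [← hm2]
      have : j ≠ i := by rintro rfl; omega
      rw [Finsupp.add_apply, h'.2 i hi, Finsupp.single_eq_of_ne (Ne.symm this), add_zero]
  · rw [if_neg hm]; simp

lemma eval_mem_of_Fm (z : Fin d → R) {k n : ℕ} {a : Ideal R} {F : MvPolynomial (Fin d) R}
    (hF : F ∈ Fm d k n a) : MvPolynomial.eval z F ∈ Ik z k ^ n * a := by
  rw [MvPolynomial.eval_eq]
  refine Ideal.sum_mem _ fun m hm => ?_
  rw [mul_comm (MvPolynomial.coeff m F)]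
  refine Ideal.mul_mem_mul ?_ (hF m).1
  have h : m.degree = n ∧ ∀ j : Fin d, k ≤ j.val → m j = 0 := by
    by_contra h
    exact (MvPolynomial.mem_support_iff.1 hm) ((hF m).2 h)
  rw [← h.1, Finsupp.degree_apply, ← Finset.prod_pow_eq_pow_sum]
  refine Ideal.prod_mem_prod fun i hi => Ideal.pow_mem_pow (z_mem_Ik z ?_) _
  by_contra h'
  exact (Finsupp.mem_support_iff.1 hi) (h.2 i (by omega))

lemma exists_Fm (z : Fin d → R) {k : ℕ} {a : Ideal R} (n : ℕ) {x : R}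
    (hx : x ∈ Ik z k ^ n * a) : ∃ F ∈ Fm d k n a, MvPolynomial.eval z F = x := by
  induction n generalizing x with
  | zero =>
    rw [pow_zero, one_mul] at hx
    refine ⟨MvPolynomial.C x, fun m => ?_, by simp⟩
    classical
    rw [MvPolynomial.coeff_C]
    by_cases h : 0 = m
    · subst h; simp [hx]
    · rw [if_neg h]; simp
  | succ n ih =>
    let T : Ideal R := (Fm d k (n + 1) a).map (MvPolynomial.aeval z : MvPolynomial (Fin d) R →ₐ[R] R).toLinearMap
    have hT : ∀ y, y ∈ T ↔ ∃ F ∈ Fm d k (n+1) a, MvPolynomial.eval z F = y := by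
      intro y; simp [T, Submodule.mem_map, MvPolynomial.aeval_eq_eval]
    rw [← hT]
    rw [pow_succ', mul_assoc] at hx
    refine (Ideal.mul_le.2 fun r hr y hy => ?_ : Ik z k * (Ik z k ^ n * a) ≤ T) hx
    obtain ⟨F, hF, rfl⟩ := ih hy
    refine Submodule.span_induction (p := fun r _ => r * MvPolynomial.eval z F ∈ T) ?_ ?_ ?_ ?_ hr
    · rintro _ ⟨j, hj, rfl⟩
      rw [hT]
      exact ⟨_, X_mul_mem_Fm hj hF, by simp⟩
    · simp
    · intro x y _ _ hx hy; rw [add_mul]; exact T.add_mem hx hy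
    · intro c x _ hx; rw [smul_eq_mul, mul_assoc]; exact T.mul_mem_left _ hx

def QRk (z : Fin d → R) (k n : ℕ) : Prop :=
  ∀ F ∈ Fm d k n (⊤ : Ideal R), MvPolynomial.eval z F ∈ Ik z k ^ (n + 1) → F ∈ Fm d k n (Ik z k)

lemma QRk_of_zero (z : Fin d → R) (k n : ℕ)
    (h : ∀ F ∈ Fm d k n (⊤ : Ideal R), MvPolynomial.eval z F = 0 → F ∈ Fm d k n (Ik z k)) : QRk z k n := by
  intro F hF hF'
  rw [pow_succ] at hF'
  obtain ⟨G, hG, hG'⟩ := exists_Fm z n hF'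
  have := h (F - G) (Submodule.sub_mem _ hF (Fm_mono_ideal le_top hG)) (by simp [hG'])
  simpa using Submodule.add_mem _ this hG

lemma QRk_nzd (z : Fin d → R) (k : ℕ) (hQ : ∀ n, QRk z k n) (c : R)
    (hc : ∀ y, c * y ∈ Ik z k → y ∈ Ik z k) (n : ℕ) (y : R) (hy : c * y ∈ Ik z k ^ n) :
    y ∈ Ik z k ^ n := by
  induction n with
  | zero => simp
  | succ n ih =>
    have h1 := ih (Ideal.pow_le_pow_right (Nat.le_succ n) hy)
    rw [← Ideal.mul_top (Ik z k ^ n)] at h1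
    obtain ⟨F, hF, rfl⟩ := exists_Fm z n h1
    have h2 := hQ n (c • F) (Submodule.smul_mem _ _ hF) (by simpa using hy)
    rw [pow_succ]
    refine eval_mem_of_Fm z fun m => ⟨hc _ ?_, (hF m).2⟩
    simpa using (h2 m).1

lemma QRk_all (z : Fin d → R)
    (hz : ∀ (i : Fin d) (y : R), z i * y ∈ Ik z i.val → y ∈ Ik z i.val) (k : ℕ) (hk : k ≤ d) :
    ∀ n, QRk z k n := by
  classical
  induction k with
  | zero =>
    intro n F hF hF'
    have h0 : Ik z 0 = ⊥ := by simp [Ik]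
    rw [h0] at hF' ⊢
    rw [Ideal.bot_pow (by omega), Ideal.mem_bot] at hF'
    have hz : ∀ m, m ≠ 0 → F.coeff m = 0 := by
      intro m hm
      refine (hF m).2 fun h => hm ?_
      ext j; exact h.2 j (by omega)
    have hF0 : F = MvPolynomial.C (F.coeff 0) := by
      ext m; rw [MvPolynomial.coeff_C]
      split_ifs with h
      · rw [h]
      · exact hz m (Ne.symm h)
    rw [hF0] at hF'
    simp only [MvPolynomial.eval_C] at hF'
    rw [hF0, hF']; simp
  | succ k ih =>
    have hQ := ih (by omega)
    let kk : Fin d := ⟨k, by omega⟩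
    have hn := QRk_nzd z k hQ (z kk) (hz kk)
    intro n
    induction n with
    | zero =>
      apply QRk_of_zero
      intro F hF hF'
      have hz : ∀ m, m ≠ 0 → F.coeff m = 0 := by
        intro m hm
        refine (hF m).2 fun h => hm ?_
        simpa [Finsupp.degree_eq_zero_iff] using h.1
      have hF0 : F = MvPolynomial.C (F.coeff 0) := by
        ext m; rw [MvPolynomial.coeff_C]
        split_ifs with h
        · rw [h]
        · exact hz m (Ne.symm h)
      rw [hF0] at hF'
      simp only [MvPolynomial.eval_C] at hF'
      rw [hF0, hF']; simp
    | succ n ihn =>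
      apply QRk_of_zero
      intro F hF hF'
      let e : Fin d →₀ ℕ := Finsupp.single kk 1
      let H := F.divMonomial e
      let G := F.modMonomial e
      have hFGH : F = MvPolynomial.X kk * H + G :=
        (MvPolynomial.divMonomial_add_modMonomial_single F kk).symm
      have hH : H ∈ Fm d (k + 1) n (⊤ : Ideal R) := by
        intro m
        refine ⟨trivial, fun h => ?_⟩
        rw [MvPolynomial.coeff_divMonomial]
        refine (hF _).2 fun h' => h ⟨?_, fun j hj => ?_⟩
        · have := h'.1; rw [map_add] at this; simp [e] at this; omega
        · have := h'.2 j hj; rw [Finsupp.add_apply] at this; omega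
      have hG : G ∈ Fm d k (n + 1) (⊤ : Ideal R) := by
        intro m
        refine ⟨trivial, fun h => ?_⟩
        by_cases hm : e ≤ m
        · exact MvPolynomial.coeff_modMonomial_of_le _ hm
        · rw [MvPolynomial.coeff_modMonomial_of_not_le _ hm]
          refine (hF _).2 fun h' => h ⟨h'.1, fun j hj => ?_⟩
          rcases Nat.eq_or_lt_of_le hj with hj | hj
          · have : j = kk := Fin.ext hj.symm
            subst this
            by_contra h3
            exact hm (by rw [Finsupp.single_le_iff]; omega)
          · exact h'.2 j hj
      have hev : MvPolynomial.eval z G + z kk * MvPolynomial.eval z H = 0 := by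
        rw [hFGH] at hF'; simpa [add_comm] using hF'
      have hG1 : MvPolynomial.eval z G ∈ Ik z k ^ (n + 1) := by
        simpa using eval_mem_of_Fm z hG
      have hH1 : MvPolynomial.eval z H ∈ Ik z k ^ (n + 1) := by
        apply hn
        rw [eq_neg_of_add_eq_zero_right hev]
        exact Ideal.neg_mem_iff _ |>.2 hG1
      have hH2 := ihn H hH (Ideal.pow_right_mono (Ik_mono z (Nat.le_succ k)) _ hH1)
      rw [← Ideal.mul_top (Ik z k ^ (n + 1))] at hH1
      obtain ⟨h, hh, hh'⟩ := exists_Fm z _ hH1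
      have h3 := hQ (n + 1) (G + z kk • h) (Submodule.add_mem _ hG (Submodule.smul_mem _ _ hh)) (by
        simp [hh', hev])
      have hG2 : G ∈ Fm d (k + 1) (n + 1) (Ik z (k + 1)) := by
        intro m
        refine ⟨?_, (Fm_mono (Nat.le_succ k) hG m).2⟩
        have h4 := Ik_mono z (Nat.le_succ k) (h3 m).1
        rw [MvPolynomial.coeff_add, MvPolynomial.coeff_smul] at h4
        refine (Ideal.add_mem_iff_left _ ?_).1 h4
        exact Ideal.mul_mem_right _ _ (z_mem_Ik z (by simp [kk]))
      rw [hFGH]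
      exact Submodule.add_mem _ (X_mul_mem_Fm (by simp [kk]) hH2) hG2

end QR

/-- elementary quasi-regularity of a sequence generating `J` -/
def QReg [CommRing R] {d : ℕ} (z : Fin d → R) : Prop :=
  ∀ (n : ℕ) (F : MvPolynomial (Fin d) R), F.IsHomogeneous n →
    MvPolynomial.eval z F ∈ (Ideal.span (Set.range z)) ^ (n + 1) →
    ∀ m, F.coeff m ∈ Ideal.span (Set.range z)

lemma mem_Fm_iff [CommRing R] {d n : ℕ} {a : Ideal R} {F : MvPolynomial (Fin d) R} :
    F ∈ Fm d d n a ↔ F.IsHomogeneous n ∧ ∀ m, F.coeff m ∈ a := by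
  constructor
  · intro h
    refine ⟨fun m hm => ?_, fun m => (h m).1⟩
    by_contra h'
    exact hm ((h m).2 fun h'' => h' (by rw [← h''.1, Finsupp.degree_eq_weight_one]; rfl))
  · rintro ⟨h1, h2⟩ m
    refine ⟨h2 m, fun h => ?_⟩
    by_contra h'
    refine h ⟨?_, fun j hj => absurd j.2 (by omega)⟩
    rw [← h1 h', Finsupp.degree_eq_weight_one]; rfl

lemma qreg_of_weaklyRegular [CommRing R] {d : ℕ} (z : Fin d → R)
    (h : RingTheory.Sequence.IsWeaklyRegular R (List.ofFn z)) : QReg z := by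
  have hz : ∀ (i : Fin d) (y : R), z i * y ∈ Ik z i.val → y ∈ Ik z i.val := by
    intro i y hy
    have h1 := h.regular_mod_prev i.val (by simp)
    have h2 : (Ideal.ofList ((List.ofFn z).take i.val) • (⊤ : Submodule R R)) = Ik z i.val := by
      simp only [smul_eq_mul, Ideal.mul_top]
      unfold Ideal.ofList Ik
      congr 1; ext x
      simp only [Set.mem_ofPred_eq, List.mem_take_iff_getElem, List.getElem_ofFn, List.length_ofFn]
      constructor
      · rintro ⟨j, hj, rfl⟩; exact ⟨⟨j, by omega⟩, by simp; omega, rfl⟩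
      · rintro ⟨j, hj, rfl⟩; exact ⟨j, by omega, rfl⟩
    rw [h2] at h1
    simp only [List.getElem_ofFn] at h1
    have h3 := @h1 (Submodule.Quotient.mk y) 0 (by
      simp only [smul_zero]
      rw [← Submodule.Quotient.mk_smul, Submodule.Quotient.mk_eq_zero]
      exact hy)
    rwa [Submodule.Quotient.mk_eq_zero] at h3
  intro n F hF hF' m
  rw [← Ik_full] at hF' ⊢
  exact (QRk_all z hz d le_rfl n F (mem_Fm_iff.2 ⟨hF, fun _ => trivial⟩) hF' m).1


-- part 6

/-! ## P6 : polynomial devissage -/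

section dev
variable [CommRing R] [IsLocalRing R]


lemma map_residue_eq_zero_iff {d : ℕ} {P : MvPolynomial (Fin d) R} :
    MvPolynomial.map (residue R) P = 0 ↔
      P ∈ Ideal.map (MvPolynomial.C : R →+* MvPolynomial (Fin d) R) (maximalIdeal R) := by
  rw [MvPolynomial.mem_map_C_iff, MvPolynomial.ext_iff]
  refine forall_congr' fun m => ?_
  rw [MvPolynomial.coeff_map, MvPolynomial.coeff_zero, residue_eq_zero_iff]

lemma exists_socle [IsNoetherianRing R] (a : Ideal R) (ha : a ≠ ⊤) {j : ℕ}
    (hj : maximalIdeal R ^ j ≤ a) :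
    ∃ v, v ∉ a ∧ ∀ r, r * v ∈ a ↔ r ∈ maximalIdeal R := by
  classical
  let j0 := Nat.find (⟨j, hj⟩ : ∃ j, maximalIdeal R ^ j ≤ a)
  have h0 : maximalIdeal R ^ j0 ≤ a := Nat.find_spec (⟨j, hj⟩ : ∃ j, maximalIdeal R ^ j ≤ a)
  have hpos : j0 ≠ 0 := by
    intro h; rw [h, pow_zero, Ideal.one_eq_top, top_le_iff] at h0; exact ha h0
  have h1 : ¬ maximalIdeal R ^ (j0 - 1) ≤ a :=
    Nat.find_min (⟨j, hj⟩ : ∃ j, maximalIdeal R ^ j ≤ a) (Nat.sub_one_lt hpos)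
  obtain ⟨v, hv, hva⟩ := SetLike.not_le_iff_exists.1 h1
  refine ⟨v, hva, fun r => ⟨fun h => ?_, fun h => h0 ?_⟩⟩
  · by_contra hr
    have hu : IsUnit r := by simpa using hr
    exact hva ((Ideal.unit_mul_mem_iff_mem a hu).1 h)
  · have := Ideal.mul_mem_mul h hv
    rwa [← pow_succ', Nat.sub_add_cancel (Nat.one_le_iff_ne_zero.2 hpos)] at this

variable {d : ℕ}

lemma socle_step {a : Ideal R} {v : R} (hv : ∀ r, r * v ∈ a ↔ r ∈ maximalIdeal R)
    (P : MvPolynomial (Fin d) R) :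
    MvPolynomial.C v * P ∈ Ideal.map MvPolynomial.C a ↔ MvPolynomial.map (residue R) P = 0 := by
  rw [map_residue_eq_zero_iff, MvPolynomial.mem_map_C_iff, MvPolynomial.mem_map_C_iff]
  refine forall_congr' fun m => ?_
  rw [MvPolynomial.coeff_C_mul, mul_comm, hv]

lemma map_sup_span (a : Ideal R) (v : R) (P : MvPolynomial (Fin d) R) :
    P ∈ Ideal.map MvPolynomial.C (a ⊔ Ideal.span {v}) ↔
      ∃ P0, P - MvPolynomial.C v * P0 ∈ Ideal.map (MvPolynomial.C : R →+* MvPolynomial (Fin d) R) a := by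
  rw [Ideal.map_sup, Ideal.map_span, Set.image_singleton, Submodule.mem_sup]
  constructor
  · rintro ⟨y, hy, w, hw, rfl⟩
    obtain ⟨c, rfl⟩ := Ideal.mem_span_singleton'.1 hw
    exact ⟨c, by rw [mul_comm, add_sub_cancel_right]; exact hy⟩
  · rintro ⟨P0, h⟩
    exact ⟨_, h, _, Ideal.mul_mem_right P0 _ (Ideal.mem_span_singleton_self _), by ring⟩

lemma mulreg [IsNoetherianRing R] {f : MvPolynomial (Fin d) R}
    (hf : MvPolynomial.map (residue R) f ≠ 0) (a : Ideal R) {j : ℕ} (hj : maximalIdeal R ^ j ≤ a)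
    (P : MvPolynomial (Fin d) R) (hP : f * P ∈ Ideal.map MvPolynomial.C a) :
    P ∈ Ideal.map MvPolynomial.C a := by
  induction a using WellFoundedGT.induction generalizing P with
  | ind a ih =>
  by_cases ha : a = ⊤
  · subst ha; rw [Ideal.map_top]; trivial
  obtain ⟨v, hva, hv⟩ := exists_socle a ha hj
  have hlt : a < a ⊔ Ideal.span {v} := by
    refine lt_of_le_of_ne le_sup_left fun h => hva ?_
    rw [h]; exact Ideal.mem_sup_right (Ideal.mem_span_singleton_self v)
  obtain ⟨P0, hP0⟩ := (map_sup_span a v P).1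
    (ih _ hlt (hj.trans hlt.le) P (Ideal.map_mono hlt.le hP))
  have h1 : MvPolynomial.C v * (f * P0) ∈ Ideal.map MvPolynomial.C a := by
    have := Ideal.sub_mem _ hP (Ideal.mul_mem_left _ f hP0)
    rwa [show f * P - f * (P - MvPolynomial.C v * P0) = MvPolynomial.C v * (f * P0) by ring] at this
  rw [socle_step hv, map_mul, mul_eq_zero, or_iff_right hf, ← socle_step hv] at h1
  simpa using Ideal.add_mem _ hP0 h1

lemma coprime_lift [IsNoetherianRing R] {f g : MvPolynomial (Fin d) R}
    (hf : MvPolynomial.map (residue R) f ≠ 0) (hg : MvPolynomial.map (residue R) g ≠ 0)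
    (hfg : IsRelPrime (MvPolynomial.map (residue R) f) (MvPolynomial.map (residue R) g))
    (a : Ideal R) {j : ℕ} (hj : maximalIdeal R ^ j ≤ a)
    (P Q : MvPolynomial (Fin d) R) (hP : f * P - g * Q ∈ Ideal.map MvPolynomial.C a) :
    ∃ T, P - g * T ∈ Ideal.map MvPolynomial.C a := by
  induction a using WellFoundedGT.induction generalizing P Q with
  | ind a ih =>
  by_cases ha : a = ⊤
  · subst ha; rw [Ideal.map_top]; exact ⟨0, trivial⟩
  obtain ⟨v, hva, hv⟩ := exists_socle a ha hj
  have hlt : a < a ⊔ Ideal.span {v} := by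
    refine lt_of_le_of_ne le_sup_left fun h => hva ?_
    rw [h]; exact Ideal.mem_sup_right (Ideal.mem_span_singleton_self v)
  obtain ⟨T, hT⟩ := ih _ hlt (hj.trans hlt.le) P Q (Ideal.map_mono hlt.le hP)
  have hQ : Q - f * T ∈ Ideal.map MvPolynomial.C (a ⊔ Ideal.span {v}) := by
    apply mulreg hg _ (hj.trans hlt.le)
    have := Ideal.sub_mem _ (Ideal.mul_mem_left _ f hT) (Ideal.map_mono hlt.le hP)
    rwa [show f * (P - g * T) - (f * P - g * Q) = g * (Q - f * T) by ring] at this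
  obtain ⟨P0, hP0⟩ := (map_sup_span a v _).1 hT
  obtain ⟨Q0, hQ0⟩ := (map_sup_span a v _).1 hQ
  have h1 : MvPolynomial.C v * (f * P0 - g * Q0) ∈ Ideal.map MvPolynomial.C a := by
    have := Ideal.sub_mem _ hP (Ideal.sub_mem _ (Ideal.mul_mem_left _ f hP0) (Ideal.mul_mem_left _ g hQ0))
    convert this using 1
    ring
  rw [socle_step hv, map_sub, map_mul, map_mul, sub_eq_zero] at h1
  have h2 : MvPolynomial.map (residue R) g ∣ MvPolynomial.map (residue R) P0 :=
    hfg.symm.dvd_of_dvd_mul_left ⟨_, h1⟩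
  obtain ⟨t, ht⟩ := h2
  obtain ⟨T0, rfl⟩ := MvPolynomial.map_surjective (residue R) residue_surjective t
  have h3 : MvPolynomial.C v * (P0 - g * T0) ∈ Ideal.map MvPolynomial.C a := by
    rw [socle_step hv, map_sub, map_mul, ht, sub_self]
  refine ⟨T + MvPolynomial.C v * T0, ?_⟩
  have := Ideal.add_mem _ hP0 h3
  convert this using 1
  ring

lemma homComp_mul_of_le {S : Type*} [CommRing S] {g T : MvPolynomial (Fin d) S} {b p : ℕ} (hg : g.IsHomogeneous b)
    (hb : b ≤ p) : MvPolynomial.homogeneousComponent p (g * T) =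
      g * MvPolynomial.homogeneousComponent (p - b) T := by
  classical
  conv_lhs => rw [← MvPolynomial.sum_homogeneousComponent T, Finset.mul_sum, map_sum]
  have : ∀ i ∈ range (T.totalDegree + 1), MvPolynomial.homogeneousComponent p
      (g * MvPolynomial.homogeneousComponent i T) =
      if p - b = i then g * MvPolynomial.homogeneousComponent i T else 0 := by
    intro i _
    rw [MvPolynomial.homogeneousComponent_of_mem (n := b + i)
      (hg.mul (MvPolynomial.homogeneousComponent_isHomogeneous i T))]
    refine if_congr ?_ rfl rfl
    omega
  rw [Finset.sum_congr rfl this, Finset.sum_ite_eq]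
  split_ifs with h
  · rfl
  · rw [MvPolynomial.homogeneousComponent_eq_zero, mul_zero]
    simp at h; omega

lemma homComp_mul_of_lt {S : Type*} [CommRing S] {g T : MvPolynomial (Fin d) S} {b p : ℕ} (hg : g.IsHomogeneous b)
    (hb : p < b) : MvPolynomial.homogeneousComponent p (g * T) = 0 := by
  classical
  rw [← MvPolynomial.sum_homogeneousComponent T, Finset.mul_sum, map_sum]
  refine Finset.sum_eq_zero fun i _ => ?_
  rw [MvPolynomial.homogeneousComponent_of_mem (n := b + i)
      (hg.mul (MvPolynomial.homogeneousComponent_isHomogeneous i T)), if_neg (by omega)]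

lemma homComp_mem_map {a : Ideal R} {P : MvPolynomial (Fin d) R} (hP : P ∈ Ideal.map MvPolynomial.C a) (p : ℕ) :
    MvPolynomial.homogeneousComponent p P ∈ Ideal.map MvPolynomial.C a := by
  rw [MvPolynomial.mem_map_C_iff] at hP ⊢
  intro m
  rw [MvPolynomial.coeff_homogeneousComponent]
  split_ifs
  · exact hP m
  · exact a.zero_mem

lemma coprime_lift_hom [IsNoetherianRing R] {f g : MvPolynomial (Fin d) R}
    (hf : MvPolynomial.map (residue R) f ≠ 0) (hg : MvPolynomial.map (residue R) g ≠ 0)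
    (hfg : IsRelPrime (MvPolynomial.map (residue R) f) (MvPolynomial.map (residue R) g))
    (a : Ideal R) {j : ℕ} (hj : maximalIdeal R ^ j ≤ a)
    (P Q : MvPolynomial (Fin d) R) (hP : f * P - g * Q ∈ Ideal.map MvPolynomial.C a)
    {b p : ℕ} (hgb : g.IsHomogeneous b) (hPp : P.IsHomogeneous p) :
    ∃ T : MvPolynomial (Fin d) R, (T = 0 ∨ b ≤ p) ∧ T.IsHomogeneous (p - b) ∧
      P - g * T ∈ Ideal.map MvPolynomial.C a ∧ Q - f * T ∈ Ideal.map MvPolynomial.C a := by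
  suffices h : ∃ T : MvPolynomial (Fin d) R, (T = 0 ∨ b ≤ p) ∧ T.IsHomogeneous (p - b) ∧
      P - g * T ∈ Ideal.map MvPolynomial.C a by
    obtain ⟨T, h1, h2, h3⟩ := h
    refine ⟨T, h1, h2, h3, ?_⟩
    apply mulreg hg _ hj
    have := Ideal.sub_mem _ (Ideal.mul_mem_left _ f h3) hP
    rwa [show f * (P - g * T) - (f * P - g * Q) = g * (Q - f * T) by ring] at this
  obtain ⟨T, hT⟩ := coprime_lift hf hg hfg a hj P Q hP
  have h1 := homComp_mem_map hT p
  rw [map_sub, MvPolynomial.homogeneousComponent_eq_self hPp] at h1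
  by_cases hb : b ≤ p
  · rw [homComp_mul_of_le hgb hb] at h1
    exact ⟨_, Or.inr hb, MvPolynomial.homogeneousComponent_isHomogeneous _ _, h1⟩
  · rw [homComp_mul_of_lt hgb (by omega)] at h1
    exact ⟨0, Or.inl rfl, MvPolynomial.isHomogeneous_zero _ _ _, by simpa using h1⟩

end dev


-- part 7

/-! ## P7 : consequences of quasi-regularity -/

structure QSetup (R : Type*) [CommRing R] [IsLocalRing R] (d : ℕ) (J : Ideal R) (z : Fin d → R) : Prop where
  hJ : J = Ideal.span (Set.range z)
  qr : QReg z
  jm : ∃ j, maximalIdeal R ^ j ≤ J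
  le : J ≤ maximalIdeal R

lemma mem_pow_of_mem_mul [CommRing R] {J a : Ideal R} {n m : ℕ} {x : R} (hx : x ∈ J ^ n * a) (h : m ≤ n) :
    x ∈ J ^ m := by
  have h1 : J ^ n * a ≤ J ^ n := Ideal.mul_le_left
  have h2 : J ^ n ≤ J ^ m := Ideal.pow_le_pow_right h
  exact h2 (h1 hx)

namespace QSetup
variable [CommRing R] [IsLocalRing R] {d : ℕ} {J : Ideal R} {z : Fin d → R}

lemma eval_mem (qs : QSetup R d J z) {a : Ideal R} {n : ℕ} {F : MvPolynomial (Fin d) R}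
    (hF : F.IsHomogeneous n) (hFa : F ∈ Ideal.map MvPolynomial.C a) :
    MvPolynomial.eval z F ∈ J ^ n * a := by
  rw [MvPolynomial.mem_map_C_iff] at hFa
  have := eval_mem_of_Fm z (mem_Fm_iff.2 ⟨hF, hFa⟩)
  rwa [Ik_full, ← qs.hJ] at this

lemma eval_mem_pow (qs : QSetup R d J z) {n : ℕ} {F : MvPolynomial (Fin d) R}
    (hF : F.IsHomogeneous n) : MvPolynomial.eval z F ∈ J ^ n := by
  have := qs.eval_mem (a := ⊤) hF (by rw [Ideal.map_top]; trivial)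
  rwa [Ideal.mul_top] at this

lemma exists_form (qs : QSetup R d J z) {a : Ideal R} {n : ℕ} {x : R} (hx : x ∈ J ^ n * a) :
    ∃ F : MvPolynomial (Fin d) R, F.IsHomogeneous n ∧ F ∈ Ideal.map MvPolynomial.C a ∧
      MvPolynomial.eval z F = x := by
  rw [qs.hJ, ← Ik_full] at hx
  obtain ⟨F, hF, h⟩ := exists_Fm z n hx
  rw [mem_Fm_iff, ← MvPolynomial.mem_map_C_iff] at hF
  exact ⟨F, hF.1, hF.2, h⟩

lemma exists_form_pow (qs : QSetup R d J z) {n : ℕ} {x : R} (hx : x ∈ J ^ n) :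
    ∃ F : MvPolynomial (Fin d) R, F.IsHomogeneous n ∧ MvPolynomial.eval z F = x := by
  rw [← Ideal.mul_top (J ^ n)] at hx
  obtain ⟨F, h1, _, h2⟩ := qs.exists_form hx
  exact ⟨F, h1, h2⟩

lemma coeff_mem (qs : QSetup R d J z) {a : Ideal R} (ha : J ≤ a) {n : ℕ} {F : MvPolynomial (Fin d) R}
    (hF : F.IsHomogeneous n) (h : MvPolynomial.eval z F ∈ J ^ n * a) :
    F ∈ Ideal.map MvPolynomial.C a := by
  obtain ⟨G, hG, hGa, hGe⟩ := qs.exists_form h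
  have h1 : F - G ∈ Ideal.map MvPolynomial.C a := by
    rw [MvPolynomial.mem_map_C_iff]
    intro m
    refine ha ?_
    have := qs.qr n (F - G) (hF.sub hG) (by rw [map_sub, hGe, sub_self]; exact Ideal.zero_mem _) m
    rwa [← qs.hJ] at this
  simpa using Ideal.add_mem _ h1 hGa

variable [IsNoetherianRing R]

lemma cancel_step (qs : QSetup R d J z) {a : Ideal R} (ha : J ≤ a) {n r : ℕ} {f : MvPolynomial (Fin d) R}
    (hf : f.IsHomogeneous r) (hf0 : MvPolynomial.map (residue R) f ≠ 0) {y : R} (hy : y ∈ J ^ n)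
    (h : MvPolynomial.eval z f * y ∈ J ^ (n + r) * a) : y ∈ J ^ n * a := by
  obtain ⟨j, hj⟩ := qs.jm
  obtain ⟨P, hP, rfl⟩ := qs.exists_form_pow hy
  rw [← map_mul, add_comm] at h
  exact qs.eval_mem hP (mulreg hf0 a (hj.trans ha) P (qs.coeff_mem ha (hf.mul hP) h))

lemma cancel_pow (qs : QSetup R d J z) {n r : ℕ} {f : MvPolynomial (Fin d) R}
    (hf : f.IsHomogeneous r) (hf0 : MvPolynomial.map (residue R) f ≠ 0) {y : R}
    (h : MvPolynomial.eval z f * y ∈ J ^ (n + r)) : y ∈ J ^ n := by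
  induction n with
  | zero => simp
  | succ n ih =>
    rw [pow_succ]
    refine qs.cancel_step le_rfl hf hf0 (ih (Ideal.pow_le_pow_right (by omega) h)) ?_
    rwa [← pow_succ, show n + r + 1 = n + 1 + r by ring]

lemma cancel (qs : QSetup R d J z) {a : Ideal R} (ha : J ≤ a) {n r : ℕ} {f : MvPolynomial (Fin d) R}
    (hf : f.IsHomogeneous r) (hf0 : MvPolynomial.map (residue R) f ≠ 0) {y : R}
    (h : MvPolynomial.eval z f * y ∈ J ^ (n + r) * a) : y ∈ J ^ n * a :=
  qs.cancel_step ha hf hf0 (qs.cancel_pow hf hf0 (mem_pow_of_mem_mul h le_rfl)) h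

lemma coprime_step (qs : QSetup R d J z) {𝔟 : Ideal R} (hb : J ≤ 𝔟) {f g : MvPolynomial (Fin d) R}
    {a b : ℕ} (hfa : f.IsHomogeneous a) (hgb : g.IsHomogeneous b)
    (hf : MvPolynomial.map (residue R) f ≠ 0) (hg : MvPolynomial.map (residue R) g ≠ 0)
    (hfg : IsRelPrime (MvPolynomial.map (residue R) f) (MvPolynomial.map (residue R) g))
    {j l : ℕ} (hjl : j + a = l + b) {y w : R} (hy : y ∈ J ^ j) (hw : w ∈ J ^ l)
    (h : MvPolynomial.eval z f * y - MvPolynomial.eval z g * w ∈ J ^ (j + a) * 𝔟) :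
    ∃ ρ, y - MvPolynomial.eval z g * ρ ∈ J ^ j * 𝔟 ∧ w - MvPolynomial.eval z f * ρ ∈ J ^ l * 𝔟 := by
  obtain ⟨i, hi⟩ := qs.jm
  obtain ⟨P, hP, rfl⟩ := qs.exists_form_pow hy
  obtain ⟨Q, hQ, rfl⟩ := qs.exists_form_pow hw
  rw [← map_mul, ← map_mul, ← map_sub] at h
  have h1 : (f * P - g * Q).IsHomogeneous (j + a) := by
    refine MvPolynomial.IsHomogeneous.sub ?_ ?_
    · rw [add_comm]; exact hfa.mul hP
    · rw [hjl, add_comm]; exact hgb.mul hQ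
  obtain ⟨T, hT0, hT, hT1, hT2⟩ := coprime_lift_hom hf hg hfg 𝔟 (hi.trans hb) P Q
    (qs.coeff_mem hb h1 h) hgb hP
  refine ⟨MvPolynomial.eval z T, ?_, ?_⟩
  · rw [← map_mul, ← map_sub]
    refine qs.eval_mem (hP.sub ?_) hT1
    rcases hT0 with rfl | h
    · rw [mul_zero]; exact MvPolynomial.isHomogeneous_zero _ _ _
    · have := hgb.mul hT; rwa [Nat.add_sub_cancel' h] at this
  · rw [← map_mul, ← map_sub]
    refine qs.eval_mem (hQ.sub ?_) hT2
    rcases hT0 with rfl | h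
    · rw [mul_zero]; exact MvPolynomial.isHomogeneous_zero _ _ _
    · have := hfa.mul hT; rwa [show a + (j - b) = l by omega] at this

lemma coprime_aux (qs : QSetup R d J z) {𝔟 : Ideal R} (hb : J ≤ 𝔟) {f g : MvPolynomial (Fin d) R}
    {a b : ℕ} (hfa : f.IsHomogeneous a) (hgb : g.IsHomogeneous b)
    (hf : MvPolynomial.map (residue R) f ≠ 0) (hg : MvPolynomial.map (residue R) g ≠ 0)
    (hfg : IsRelPrime (MvPolynomial.map (residue R) f) (MvPolynomial.map (residue R) g))
    (i : ℕ) {j l : ℕ} (hjl : j + a = l + b) {y w : R} (hy : y ∈ J ^ j) (hw : w ∈ J ^ l)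
    (h : MvPolynomial.eval z f * y - MvPolynomial.eval z g * w ∈ J ^ (j + i + a) * 𝔟) :
    ∃ ρ, y - MvPolynomial.eval z g * ρ ∈ J ^ (j + i) * 𝔟 ∧
      w - MvPolynomial.eval z f * ρ ∈ J ^ (l + i) * 𝔟 := by
  induction i generalizing j l y w with
  | zero => exact qs.coprime_step hb hfa hgb hf hg hfg hjl hy hw h
  | succ i ih =>
    obtain ⟨ρ, h1, h2⟩ := qs.coprime_step le_rfl hfa hgb hf hg hfg hjl hy hw (by
      rw [← pow_succ]
      exact mem_pow_of_mem_mul h (by omega))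
    rw [← pow_succ] at h1 h2
    obtain ⟨ρ', h3, h4⟩ := ih (show j + 1 + a = l + 1 + b by omega) h1 h2 (by
      rw [show j + 1 + i + a = j + (i + 1) + a by ring]
      convert h using 1; ring)
    refine ⟨ρ + ρ', ?_, ?_⟩
    · rw [show j + (i + 1) = j + 1 + i by ring]; convert h3 using 1; ring
    · rw [show l + (i + 1) = l + 1 + i by ring]; convert h4 using 1; ring

lemma coprime (qs : QSetup R d J z) {𝔟 : Ideal R} (hb : J ≤ 𝔟) {f g : MvPolynomial (Fin d) R}
    {a b : ℕ} (hfa : f.IsHomogeneous a) (hgb : g.IsHomogeneous b)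
    (hf : MvPolynomial.map (residue R) f ≠ 0) (hg : MvPolynomial.map (residue R) g ≠ 0)
    (hfg : IsRelPrime (MvPolynomial.map (residue R) f) (MvPolynomial.map (residue R) g))
    {n m : ℕ} (hnm : n + a = m + b) {y w : R}
    (h : MvPolynomial.eval z f * y - MvPolynomial.eval z g * w ∈ J ^ (n + a) * 𝔟) :
    ∃ ρ, y - MvPolynomial.eval z g * ρ ∈ J ^ n * 𝔟 ∧ w - MvPolynomial.eval z f * ρ ∈ J ^ m * 𝔟 := by
  rcases le_total a b with hab | hab
  · have hy : y ∈ J ^ (b - a) := by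
      apply qs.cancel_pow hfa hf
      rw [Nat.sub_add_cancel hab]
      have h1 : MvPolynomial.eval z f * y - MvPolynomial.eval z g * w ∈ J ^ b :=
        mem_pow_of_mem_mul h (by omega)
      simpa using Ideal.add_mem _ h1 (Ideal.mul_mem_right w _ (qs.eval_mem_pow hgb))
    have := qs.coprime_aux hb hfa hgb hf hg hfg m (j := b - a) (l := 0) (by omega) hy (by simp : w ∈ J ^ 0)
      (by rwa [show b - a + m = n by omega])
    rwa [show b - a + m = n by omega, zero_add] at this
  · have hw : w ∈ J ^ (a - b) := by
      apply qs.cancel_pow hgb hg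
      rw [Nat.sub_add_cancel hab]
      have h1 : MvPolynomial.eval z f * y - MvPolynomial.eval z g * w ∈ J ^ a :=
        mem_pow_of_mem_mul h (by omega)
      have := Ideal.sub_mem _ (Ideal.mul_mem_right y _ (qs.eval_mem_pow hfa)) h1
      simpa using this
    have := qs.coprime_aux hb hfa hgb hf hg hfg n (j := 0) (l := a - b) (by omega) (by simp : y ∈ J ^ 0) hw
      (by rwa [zero_add])
    rwa [show a - b + n = m by omega, zero_add] at this

lemma vge_cancel (qs : QSetup R d J z) {r : ℕ} {f : MvPolynomial (Fin d) R}
    (hf : f.IsHomogeneous r) (hf0 : MvPolynomial.map (residue R) f ≠ 0) {y : R} {α : ℝ}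
    (h : MvPolynomial.eval z f * y ∈ vge J (α + r)) : y ∈ vge J α := by
  intro β hβ
  obtain ⟨C, hC⟩ := h (β + r) (by linarith)
  refine ⟨C, fun n N hN => ?_⟩
  have h1 := hC n (N + r * n) (by push_cast; linarith)
  rw [mul_pow, ← map_pow] at h1
  exact qs.cancel_pow (hf.pow n) (by rw [map_pow]; exact pow_ne_zero _ hf0) h1

lemma vgt_cancel (qs : QSetup R d J z) {r : ℕ} {f : MvPolynomial (Fin d) R}
    (hf : f.IsHomogeneous r) (hf0 : MvPolynomial.map (residue R) f ≠ 0) {y : R} {α : ℝ}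
    (h : MvPolynomial.eval z f * y ∈ vgt J (α + r)) : y ∈ vgt J α := by
  obtain ⟨β, h1, h2⟩ := h
  exact ⟨β - r, by linarith, qs.vge_cancel hf hf0 (by rw [sub_add_cancel]; exact h2)⟩

end QSetup

/-! lengths -/

noncomputable def ilen [CommRing R] (N K : Ideal R) : ℕ∞ := Module.length R (idealQuot N K)

lemma ilen_add [CommRing R] {K N P : Ideal R} (h1 : K ≤ N) (h2 : N ≤ P) :
    ilen P K = ilen N K + ilen P N := by
  unfold ilen idealQuot
  have hle : Submodule.comap N.subtype K ≤
    Submodule.comap (Submodule.inclusion h2) (Submodule.comap P.subtype K) := fun x hx => hx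
  refine Module.length_eq_add_of_exact
    (Submodule.mapQ _ _ (Submodule.inclusion h2) hle)
    (Submodule.mapQ (Submodule.comap P.subtype K) (Submodule.comap P.subtype N) LinearMap.id
      (by intro x hx; exact h1 hx)) ?_ ?_ ?_
  · rw [← LinearMap.ker_eq_bot, LinearMap.ker_eq_bot']
    intro x hx
    obtain ⟨x, rfl⟩ := Submodule.mkQ_surjective _ x
    simp only [Submodule.mkQ_apply, Submodule.mapQ_apply, Submodule.Quotient.mk_eq_zero] at hx ⊢
    exact hx
  · intro x
    obtain ⟨x, rfl⟩ := Submodule.mkQ_surjective _ x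
    exact ⟨Submodule.mkQ _ x, rfl⟩
  · intro x
    obtain ⟨x, rfl⟩ := Submodule.mkQ_surjective _ x
    simp only [Submodule.mkQ_apply, Submodule.mapQ_apply, Submodule.Quotient.mk_eq_zero, LinearMap.id_apply]
    constructor
    · intro hx
      exact ⟨Submodule.Quotient.mk ⟨x.1, hx⟩, rfl⟩
    · rintro ⟨w, hw⟩
      obtain ⟨w, rfl⟩ := Submodule.mkQ_surjective _ w
      simp only [Submodule.mkQ_apply, Submodule.mapQ_apply] at hw
      rw [Submodule.Quotient.eq] at hw
      have h3 : ((Submodule.inclusion h2 w - x : P) : R) ∈ N := h1 hw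
      have h4 : (w : R) ∈ N := w.2
      have h5 : (x : R) = w - (Submodule.inclusion h2 w - x : P) := by simp
      change (x : R) ∈ N
      rw [h5]; exact N.sub_mem h4 h3

lemma length_quot_add [CommRing R] {K N : Ideal R} (h1 : K ≤ N) :
    Module.length R (R ⧸ K) = ilen N K + Module.length R (R ⧸ N) := by
  have h : ∀ Q : Ideal R, Module.length R (R ⧸ Q) = ilen ⊤ Q := by
    intro Q
    refine LinearEquiv.length_eq (Submodule.Quotient.equiv _ _ Submodule.topEquiv.symm ?_)
    ext x; simp
  rw [h, h, ilen_add h1 le_top]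

lemma ilen_le_left [CommRing R] {N P K : Ideal R} (h : N ≤ P) : ilen N K ≤ ilen P K := by
  have hle : Submodule.comap N.subtype K ≤
    Submodule.comap (Submodule.inclusion h) (Submodule.comap P.subtype K) := fun x hx => hx
  refine Module.length_le_of_injective (Submodule.mapQ _ _ (Submodule.inclusion h) hle) ?_
  rw [← LinearMap.ker_eq_bot, LinearMap.ker_eq_bot']
  intro x hx
  obtain ⟨x, rfl⟩ := Submodule.mkQ_surjective _ x
  simp only [Submodule.mkQ_apply, Submodule.mapQ_apply, Submodule.Quotient.mk_eq_zero] at hx ⊢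
  exact hx

lemma ilen_eq_zero_iff [CommRing R] {N K : Ideal R} : ilen N K = 0 ↔ N ≤ K := by
  unfold ilen idealQuot
  rw [Module.length_eq_zero_iff, Submodule.Quotient.subsingleton_iff, Submodule.comap_subtype_eq_top]

lemma length_pow_mul [CommRing R] [IsLocalRing R] [IsNoetherianRing R] {d : ℕ} {J : Ideal R}
    {z : Fin d → R} (qs : QSetup R d J z) (n : ℕ) {a : Ideal R} (ha : J ≤ a) :
    ilen (J ^ n) (J ^ n * a) = (d + n - 1).choose n * Module.length R (R ⧸ a) := by
  classical
  let S := (Finset.univ : Finset (Fin d)).finsuppAntidiag n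
  have hS : ∀ m : Fin d →₀ ℕ, m ∈ S ↔ m.degree = n := by
    intro m; simp [S, Finsupp.degree_eq_sum]
  let poly : (S → R) →ₗ[R] MvPolynomial (Fin d) R :=
    ∑ m : S, (MvPolynomial.monomial m.1).comp (LinearMap.proj m)
  have hpoly : ∀ c, poly c = ∑ m : S, MvPolynomial.monomial m.1 (c m) := by
    intro c; simp [poly, LinearMap.sum_apply]
  have hhom : ∀ c, (poly c).IsHomogeneous n := by
    intro c; rw [hpoly]
    refine MvPolynomial.IsHomogeneous.sum _ _ _ fun m _ => ?_
    exact MvPolynomial.isHomogeneous_monomial _ ((hS _).1 m.2)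
  have hcoeff : ∀ c (m : S), (poly c).coeff m.1 = c m := by
    intro c m; rw [hpoly, MvPolynomial.coeff_sum]
    simp only [MvPolynomial.coeff_monomial]
    rw [Finset.sum_eq_single m]
    · simp
    · intro b _ hb; rw [if_neg]; intro h; exact hb (Subtype.ext h)
    · simp
  have hcoeff0 : ∀ c (m : Fin d →₀ ℕ), m ∉ S → (poly c).coeff m = 0 := by
    intro c m hm
    by_contra h
    exact hm ((hS m).2 (by rw [← hhom c h, Finsupp.degree_eq_weight_one]; rfl))
  let ev : (S → R) →ₗ[R] R := (MvPolynomial.aeval z : MvPolynomial (Fin d) R →ₐ[R] R).toLinearMap.comp poly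
  have hev : ∀ c, ev c = MvPolynomial.eval z (poly c) := by
    intro c; simp [ev, MvPolynomial.aeval_eq_eval]
  let ev' : (S → R) →ₗ[R] (J ^ n : Ideal R) := ev.codRestrict (J ^ n) (by
    intro c; rw [hev]; exact qs.eval_mem_pow (hhom c))
  let Ψ : (S → R) →ₗ[R] idealQuot (J ^ n) (J ^ n * a) := (Submodule.mkQ _).comp ev'
  have hsurj : Function.Surjective Ψ := by
    intro x
    obtain ⟨⟨x, hx⟩, rfl⟩ := Submodule.mkQ_surjective _ x
    obtain ⟨F, hF, rfl⟩ := qs.exists_form_pow hx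
    refine ⟨fun m => F.coeff m.1, ?_⟩
    change Submodule.mkQ _ _ = Submodule.mkQ _ _
    congr 1
    ext
    change ev _ = _
    rw [hev]
    congr 1
    ext m
    by_cases hm : m ∈ S
    · exact hcoeff _ ⟨m, hm⟩
    · rw [hcoeff0 _ m hm]
      by_contra h
      exact hm ((hS m).2 (by rw [← hF (Ne.symm h), Finsupp.degree_eq_weight_one]; rfl))
  have hker : LinearMap.ker Ψ = Submodule.pi Set.univ (fun _ : S => (a : Submodule R R)) := by
    ext c
    rw [LinearMap.mem_ker]
    change Submodule.mkQ _ _ = 0 ↔ _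
    rw [Submodule.mkQ_apply, Submodule.Quotient.mk_eq_zero]
    change ev c ∈ J ^ n * a ↔ _
    rw [hev, Submodule.mem_pi]
    constructor
    · intro h m _
      have := qs.coeff_mem ha (hhom c) h
      rw [MvPolynomial.mem_map_C_iff] at this
      rw [← hcoeff c m]; exact this _
    · intro h
      refine qs.eval_mem (hhom c) ?_
      rw [MvPolynomial.mem_map_C_iff]
      intro m
      by_cases hm : m ∈ S
      · rw [hcoeff c ⟨m, hm⟩]; exact h _ trivial
      · rw [hcoeff0 c m hm]; exact a.zero_mem
  have e1 := (Ψ.quotKerEquivOfSurjective hsurj).length_eq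
  unfold ilen
  rw [← e1, hker, (Submodule.quotientPi (fun _ : S => (a : Submodule R R))).length_eq, Module.length_pi]
  congr 1
  rw [ENat.card_eq_coe_fintype_card, Fintype.card_coe, Finset.card_finsuppAntidiag_nat_eq_choose]
  simp


-- part 8

/-! ## P8 : finiteness (N-2 for polynomial rings) -/

lemma exists_semilinear {k : Type*} [Field k] (p : ℕ) [ExpChar k p] (e : ℕ) (s0 : k) (hs : s0 ≠ 0) :
    ∃ g : k →+ k, (∀ t s, g (t ^ p ^ e * s) = t * g s) ∧ g s0 ≠ 0 := by
  let F := (iterateFrobenius k p e).fieldRange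
  let E : k ≃+* F := RingEquiv.ofBijective (iterateFrobenius k p e).rangeRestrictField
    (iterateFrobenius k p e).rangeRestrictField_bijective
  have hE : ∀ t, ((E t : F) : k) = t ^ p ^ e := fun t => rfl
  obtain ⟨φ, hφ⟩ : ∃ φ : Module.Dual F k, φ s0 ≠ 0 := by
    by_contra h
    push Not at h
    exact hs ((Module.forall_dual_apply_eq_zero_iff F s0).1 h)
  refine ⟨E.symm.toAddMonoidHom.comp φ.toAddMonoidHom, fun t s => ?_, ?_⟩
  · have h1 : t ^ p ^ e * s = E t • s := by rw [← hE]; rfl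
    change E.symm (φ _) = t * E.symm (φ s)
    rw [h1, map_smul, smul_eq_mul, map_mul, RingEquiv.symm_apply_apply]
  · change E.symm (φ _) ≠ 0
    simpa using hφ

lemma exists_frobSplit {k : Type*} [Field k] {d : ℕ} (p : ℕ) [ExpChar k p] (e : ℕ)
    (b0 : MvPolynomial (Fin d) k) (hb : b0 ≠ 0) :
    ∃ L : MvPolynomial (Fin d) k →+ MvPolynomial (Fin d) k,
      (∀ a b, L (a ^ p ^ e * b) = a * L b) ∧ L b0 ≠ 0 := by
  classical
  obtain ⟨m0, hm0⟩ := MvPolynomial.support_nonempty.2 hb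
  obtain ⟨g, hg1, hg2⟩ := exists_semilinear p e (b0.coeff m0) (MvPolynomial.mem_support_iff.1 hm0)
  set q := p ^ e with hq
  have hq0 : 0 < q := pow_pos (expChar_pos k p) e
  let dv : (Fin d →₀ ℕ) → (Fin d →₀ ℕ) := fun m => m.mapRange (· / q) (Nat.zero_div q)
  let h : (Fin d →₀ ℕ) → k →+ MvPolynomial (Fin d) k := fun m =>
    if ∀ i, m i % q = m0 i % q then ((MvPolynomial.monomial (dv m)).toAddMonoidHom).comp g else 0
  let L : MvPolynomial (Fin d) k →+ MvPolynomial (Fin d) k :=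
    { toFun := fun b => ∑ m ∈ b.support, h m (b.coeff m)
      map_zero' := by simp
      map_add' := by
        intro a b
        have hs : ∀ (c : MvPolynomial (Fin d) k) (S : Finset (Fin d →₀ ℕ)), c.support ⊆ S →
            ∑ m ∈ c.support, h m (c.coeff m) = ∑ m ∈ S, h m (c.coeff m) := by
          intro c S hS
          refine Finset.sum_subset hS fun m _ hm => ?_
          rw [MvPolynomial.notMem_support_iff.1 hm, map_zero]
        rw [hs (a + b) (a.support ∪ b.support) MvPolynomial.support_add,
          hs a (a.support ∪ b.support) Finset.subset_union_left,
          hs b (a.support ∪ b.support) Finset.subset_union_right, ← Finset.sum_add_distrib]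
        simp }
  have hL : ∀ m c, L (MvPolynomial.monomial m c) = h m c := by
    intro m c
    change ∑ m' ∈ (MvPolynomial.monomial m c).support, h m' (MvPolynomial.coeff m' (MvPolynomial.monomial m c)) = _
    by_cases hc : c = 0
    · subst hc; simp
    · rw [MvPolynomial.support_monomial, if_neg hc, Finset.sum_singleton, MvPolynomial.coeff_monomial, if_pos rfl]
  refine ⟨L, ?_, ?_⟩
  · intro a b
    have hX : ExpChar (MvPolynomial (Fin d) k) p := inferInstance
    induction a using MvPolynomial.induction_on' with
    | monomial i t =>
      induction b using MvPolynomial.induction_on' with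
      | monomial m c =>
        rw [MvPolynomial.monomial_pow, MvPolynomial.monomial_mul, hL, hL]
        have hc : (∀ j, (q • i + m) j % q = m0 j % q) ↔ ∀ j, m j % q = m0 j % q := by
          refine forall_congr' fun j => ?_
          rw [Finsupp.add_apply, Finsupp.smul_apply, smul_eq_mul, Nat.mul_add_mod]
        simp only [h, hc]
        split_ifs
        · change MvPolynomial.monomial _ (g _) = _ * MvPolynomial.monomial _ (g _)
          rw [MvPolynomial.monomial_mul, hg1]
          congr 2
          ext j
          simp only [dv, Finsupp.mapRange_apply, Finsupp.add_apply, Finsupp.smul_apply, smul_eq_mul]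
          rw [Nat.mul_add_div hq0]
        · simp
      | add b b' h1 h2 => rw [mul_add, map_add, h1, h2, map_add, mul_add]
    | add a a' h1 h2 =>
      rw [hq, add_pow_expChar_pow, add_mul, map_add, ← hq, h1, h2, add_mul]
  · intro h0
    have h1 : (L b0).coeff (dv m0) = g (b0.coeff m0) := by
      change MvPolynomial.coeff _ (∑ m ∈ b0.support, h m (b0.coeff m)) = _
      rw [MvPolynomial.coeff_sum, Finset.sum_eq_single m0]
      · simp [h]
      · intro m _ hm
        simp only [h]
        split_ifs with hc
        · change MvPolynomial.coeff _ (MvPolynomial.monomial (dv m) _) = 0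
          rw [MvPolynomial.coeff_monomial, if_neg]
          intro h2
          apply hm
          ext i
          have h3 := DFunLike.congr_fun h2 i
          simp only [dv, Finsupp.mapRange_apply] at h3
          rw [← Nat.div_add_mod (m i) q, ← Nat.div_add_mod (m0 i) q, h3, hc i]
        · simp
      · intro h; exact absurd hm0 h
    rw [h0, MvPolynomial.coeff_zero] at h1
    exact hg2 h1.symm

lemma exists_dual_domain {k : Type*} [Field k] {d : ℕ} (K D L : Type*) [CommRing D] [IsDomain D]
    [Field K] [Field L] [Algebra (MvPolynomial (Fin d) k) K] [IsFractionRing (MvPolynomial (Fin d) k) K]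
    [Algebra (MvPolynomial (Fin d) k) D] [Algebra.IsIntegral (MvPolynomial (Fin d) k) D]
    [Algebra D L] [IsFractionRing D L] [Algebra K L] [Algebra (MvPolynomial (Fin d) k) L]
    [IsScalarTower (MvPolynomial (Fin d) k) K L] [IsScalarTower (MvPolynomial (Fin d) k) D L]
    [FiniteDimensional K L] (μ : D) (hμ : μ ≠ 0) :
    ∃ θ : D →ₗ[MvPolynomial (Fin d) k] MvPolynomial (Fin d) k, θ μ ≠ 0 := by
  obtain ⟨p, hp⟩ := ExpChar.exists k
  let A := MvPolynomial (Fin d) k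
  have hpA : ExpChar A p := inferInstance
  have hpK : ExpChar K p := expChar_of_injective_algebraMap (IsFractionRing.injective A K) p
  have hpL : ExpChar L p := expChar_of_injective_algebraMap (algebraMap K L).injective p
  let Ls := separableClosure K L
  have hpLs : ExpChar Ls p := expChar_of_injective_algebraMap (algebraMap K Ls).injective p
  let e := IsPurelyInseparable.exponent Ls L
  have he : ∀ x : L, x ^ p ^ e ∈ Ls := by
    intro x
    obtain ⟨y, hy⟩ := IsPurelyInseparable.exponent_def' Ls p x
    rw [← hy]; exact y.2
  have hnd := traceForm_nondegenerate K Ls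
  let w : D → Ls := fun c => ⟨_, he (algebraMap D L c)⟩
  have hw0 : w μ ≠ 0 := by
    intro h
    have := congrArg (Subtype.val) h
    have h2 : algebraMap D L μ = 0 := by
      have h3 : algebraMap D L μ ^ p ^ e = 0 := this
      exact pow_eq_zero_iff (pow_pos (expChar_pos k p) e).ne' |>.1 h3
    exact hμ ((map_eq_zero_iff _ (IsFractionRing.injective D L)).1 h2)
  obtain ⟨v, hv⟩ : ∃ v, Algebra.trace K Ls (v * w μ) ≠ 0 := by
    by_contra h
    push Not at h
    refine hw0 (hnd.1 (w μ) fun v => ?_)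
    rw [Algebra.traceForm_apply, mul_comm]; exact h v
  obtain ⟨y, hy0, hy⟩ : ∃ y ≠ (0 : A), IsIntegral A (y • v) := by
    have : IsAlgebraic A v := by
      have := Algebra.IsAlgebraic.isAlgebraic (R := K) v
      exact (IsFractionRing.isAlgebraic_iff A K Ls).2 this
    exact this.exists_integral_multiple
  have hwint : ∀ c, IsIntegral A (w c) := by
    intro c
    have h1 : IsIntegral A (algebraMap D L c ^ p ^ e) :=
      ((Algebra.IsIntegral.isIntegral (R := A) c).algebraMap).pow _
    exact (isIntegral_algHom_iff ((IsScalarTower.toAlgHom K Ls L).restrictScalars A)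
      (FaithfulSMul.algebraMap_injective Ls L)).1 h1
  have hψ : ∀ c, ∃ a : A, algebraMap A K a = Algebra.trace K Ls ((y • v) * w c) := by
    intro c
    exact IsIntegrallyClosed.isIntegral_iff.1 (Algebra.isIntegral_trace (hy.mul (hwint c)))
  choose ψ hψ using hψ
  have hinj := IsFractionRing.injective A K
  have hwadd : ∀ c c', w (c + c') = w c + w c' := by
    intro c c'
    apply Subtype.ext
    change algebraMap D L (c + c') ^ p ^ e = algebraMap D L c ^ p ^ e + algebraMap D L c' ^ p ^ e
    rw [map_add, add_pow_expChar_pow]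
  have hwmul : ∀ (a : A) c, w (a • c) = (algebraMap A K a ^ p ^ e) • w c := by
    intro a c
    apply Subtype.ext
    change algebraMap D L (a • c) ^ p ^ e = (algebraMap A K a ^ p ^ e) • algebraMap D L c ^ p ^ e
    rw [Algebra.smul_def, map_mul, mul_pow, Algebra.smul_def, map_pow, ← IsScalarTower.algebraMap_apply A K L,
      ← IsScalarTower.algebraMap_apply A D L]
  have hψadd : ∀ c c', ψ (c + c') = ψ c + ψ c' := by
    intro c c'; apply hinj; rw [map_add, hψ, hψ, hψ, hwadd, mul_add, map_add]
  have hψmul : ∀ a c, ψ (a • c) = a ^ p ^ e * ψ c := by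
    intro a c; apply hinj
    rw [map_mul, hψ, hψ, hwmul, mul_smul_comm, map_smul, smul_eq_mul, map_pow]
  have hψ0 : ψ μ ≠ 0 := by
    intro h
    have h1 := hψ μ
    rw [h, map_zero] at h1
    have h2 : (y • v) * w μ = algebraMap A K y • (v * w μ) := by
      rw [algebraMap_smul, smul_mul_assoc]
    rw [h2, map_smul, smul_eq_mul] at h1
    rcases mul_eq_zero.1 h1.symm with h3 | h3
    · exact hy0 ((map_eq_zero_iff _ hinj).1 h3)
    · exact hv h3
  obtain ⟨lam, hl1, hl2⟩ := exists_frobSplit p e (ψ μ) hψ0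
  refine ⟨{ toFun := fun c => lam (ψ c), map_add' := ?_, map_smul' := ?_ }, hl2⟩
  · intro c c'; rw [hψadd, map_add]
  · intro a c; rw [hψmul, hl1]; rfl


-- part 9

/-! ## P9 : finiteness (N-2 for polynomial rings), conclusion -/

lemma exists_dual {k : Type*} [Field k] {d : ℕ} (M : Type*) [CommRing M] [IsReduced M]
    [Algebra (MvPolynomial (Fin d) k) M] [Algebra.IsIntegral (MvPolynomial (Fin d) k) M]
    (htf : ∀ (a : MvPolynomial (Fin d) k) (x : M), a ≠ 0 → a • x = 0 → x = 0)
    (hr : Module.rank (MvPolynomial (Fin d) k) M < Cardinal.aleph0) (μ : M) (hμ : μ ≠ 0) :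
    ∃ θ : M →ₗ[MvPolynomial (Fin d) k] MvPolynomial (Fin d) k, θ μ ≠ 0 := by
  let A := MvPolynomial (Fin d) k
  let S : Submonoid M :=
    { carrier := {x | ∃ a : A, a ≠ 0 ∧ ∃ n : ℕ, x = algebraMap A M a * μ ^ n}
      one_mem' := ⟨1, one_ne_zero, 0, by simp⟩
      mul_mem' := by
        rintro _ _ ⟨a, ha, n, rfl⟩ ⟨b, hb, m, rfl⟩
        exact ⟨a * b, mul_ne_zero ha hb, n + m, by rw [map_mul, pow_add]; ring⟩ }
  have hdis : Disjoint ((⊥ : Ideal M) : Set M) (S : Set M) := by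
    rw [Set.disjoint_left]
    rintro x hx ⟨a, ha, n, hxa⟩
    have hx0 : x = 0 := by simpa using hx
    have h1 : a • μ ^ n = 0 := by rw [Algebra.smul_def, ← hxa, hx0]
    exact hμ (eq_zero_of_pow_eq_zero (htf a _ ha h1))
  obtain ⟨P, hP, -, hPS⟩ := Ideal.exists_le_prime_disjoint ⊥ S hdis
  let D := M ⧸ P
  have hinj : Function.Injective (algebraMap A D) := by
    rw [injective_iff_map_eq_zero]
    intro a ha
    by_contra h0
    have h1 : algebraMap A M a ∈ P := by
      rw [← Ideal.Quotient.eq_zero_iff_mem]; exact ha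
    exact Set.disjoint_left.1 hPS h1 ⟨a, h0, 0, by simp⟩
  have : FaithfulSMul A D := (faithfulSMul_iff_algebraMap_injective A D).2 hinj
  have : Algebra.IsIntegral A D := by
    refine ⟨fun x => ?_⟩
    obtain ⟨y, rfl⟩ := Ideal.Quotient.mk_surjective x
    exact (Algebra.IsIntegral.isIntegral (R := A) y).map (Ideal.Quotient.mkₐ A P)
  have : Algebra.IsAlgebraic A D := inferInstance
  have hrD : Module.rank A D ≤ Module.rank A M :=
    LinearMap.rank_le_of_surjective (Ideal.Quotient.mkₐ A P).toLinearMap (Ideal.Quotient.mkₐ_surjective A P)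
  have : FaithfulSMul A (FractionRing D) := by
    rw [faithfulSMul_iff_algebraMap_injective, IsScalarTower.algebraMap_eq A D (FractionRing D)]
    exact (IsFractionRing.injective D (FractionRing D)).comp hinj
  let _ := FractionRing.liftAlgebra A (FractionRing D)
  have : IsScalarTower A (FractionRing A) (FractionRing D) :=
    FractionRing.isScalarTower_liftAlgebra A (FractionRing D)
  have hrk : Module.rank (FractionRing A) (FractionRing D) < Cardinal.aleph0 := by
    rw [Algebra.IsAlgebraic.rank_fractionRing A D]
    exact hrD.trans_lt hr
  have : FiniteDimensional (FractionRing A) (FractionRing D) := Module.rank_lt_aleph0_iff.1 hrk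
  have hμD : (Ideal.Quotient.mk P μ) ≠ 0 := by
    intro h
    rw [Ideal.Quotient.eq_zero_iff_mem] at h
    exact Set.disjoint_left.1 hPS h ⟨1, one_ne_zero, 1, by simp⟩
  obtain ⟨θ, hθ⟩ := exists_dual_domain (k := k) (d := d) (FractionRing A) D (FractionRing D) (Ideal.Quotient.mk P μ) hμD
  exact ⟨θ.comp (Ideal.Quotient.mkₐ A P).toLinearMap, hθ⟩

lemma module_finite_of_rank {k : Type*} [Field k] {d : ℕ} (M : Type*) [CommRing M] [IsReduced M]
    [Algebra (MvPolynomial (Fin d) k) M] [Algebra.IsIntegral (MvPolynomial (Fin d) k) M]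
    (htf : ∀ (a : MvPolynomial (Fin d) k) (x : M), a ≠ 0 → a • x = 0 → x = 0)
    (hr : Module.rank (MvPolynomial (Fin d) k) M < Cardinal.aleph0) :
    Module.Finite (MvPolynomial (Fin d) k) M := by
  let A := MvPolynomial (Fin d) k
  obtain ⟨s, hs, hli⟩ := exists_set_linearIndependent A M
  have hsfin : s.Finite := by
    rw [← Cardinal.lt_aleph0_iff_set_finite, hs]; exact hr
  have := hsfin.fintype
  have hspan : Module.rank A (Submodule.span A s) = Module.rank A M := by
    rw [← hs]; exact rank_span_set hli
  have hq : Module.rank A (M ⧸ Submodule.span A s) = 0 := by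
    have h1 := Submodule.rank_quotient_add_rank (Submodule.span A s)
    rw [hspan] at h1
    obtain ⟨n, hn⟩ := Cardinal.lt_aleph0.1 hr
    have hle : Module.rank A (M ⧸ Submodule.span A s) ≤ Module.rank A M := by
      rw [← h1]; exact le_self_add
    obtain ⟨m, hm⟩ := Cardinal.lt_aleph0.1 (hle.trans_lt hr)
    rw [hm, hn] at h1
    rw [hm]
    have : m + n = n := by exact_mod_cast h1
    have : m = 0 := by omega
    rw [this]; rfl
  rw [rank_eq_zero_iff] at hq
  let Φ : Module.Dual A M →ₗ[A] (s → A) :=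
    { toFun := fun θ i => θ i, map_add' := fun _ _ => rfl, map_smul' := fun _ _ => rfl }
  have hΦ : Function.Injective Φ := by
    rw [← LinearMap.ker_eq_bot, LinearMap.ker_eq_bot']
    intro θ hθ
    refine LinearMap.ext fun x => ?_
    obtain ⟨a, ha, hax⟩ := hq (Submodule.Quotient.mk x)
    rw [← Submodule.Quotient.mk_smul, Submodule.Quotient.mk_eq_zero] at hax
    have h1 : Submodule.span A s ≤ LinearMap.ker θ := by
      rw [Submodule.span_le]
      intro y hy
      exact congrFun hθ ⟨y, hy⟩
    have h2 := LinearMap.mem_ker.1 (h1 hax)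
    rw [map_smul, smul_eq_mul] at h2
    exact (mul_eq_zero.1 h2).resolve_left ha
  have hfin : Module.Finite A (Module.Dual A M) := Module.Finite.of_injective Φ hΦ
  obtain ⟨T, hT⟩ := hfin.fg_top
  let Ψ : M →ₗ[A] (T → A) :=
    { toFun := fun x i => i.1 x, map_add' := fun _ _ => by ext; simp, map_smul' := fun _ _ => by ext; simp }
  have hΨ : Function.Injective Ψ := by
    rw [← LinearMap.ker_eq_bot, LinearMap.ker_eq_bot']
    intro x hx
    by_contra h0
    obtain ⟨θ, hθ⟩ := exists_dual M htf hr x h0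
    apply hθ
    have h1 : (⊤ : Submodule A (Module.Dual A M)) ≤ LinearMap.ker (LinearMap.applyₗ (R := A) (M₂ := A) x) := by
      rw [← hT, Submodule.span_le]
      intro y hy
      exact congrFun hx ⟨y, hy⟩
    exact LinearMap.mem_ker.1 (h1 (Submodule.mem_top (x := θ)))
  exact Module.Finite.of_injective Ψ hΨ


-- part 10

/-! ## P10 : the real-graded associated ring -/

open AddMonoidAlgebra in
lemma coeff_mul_mem [CommRing R] (Q : Ideal R) (f g : AddMonoidAlgebra R ℝ) (c : ℝ)
    (h : ∀ a, f.coeff a * g.coeff (c - a) ∈ Q) : (f * g).coeff c ∈ Q := by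
  rw [coeff_mul_apply_left]
  refine Ideal.sum_mem _ fun a _ => ?_
  have := h a
  rwa [sub_eq_neg_add] at this

/-- The extended Rees-like algebra of the real-indexed filtration. -/
noncomputable def greB [CommRing R] (J : Ideal R) : Subalgebra R (AddMonoidAlgebra R ℝ) where
  carrier := {f | ∀ α, f.coeff α ∈ vge J α}
  mul_mem' := by
    intro f g hf hg α
    refine coeff_mul_mem _ _ _ _ fun a => ?_
    have := mul_mem_vge (hf a) (hg (α - a))
    rwa [add_sub_cancel] at this
  add_mem' := by
    intro f g hf hg α
    exact Ideal.add_mem _ (hf α) (hg α)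
  algebraMap_mem' := by
    intro r α
    rw [AddMonoidAlgebra.coe_algebraMap, Function.comp_apply, AddMonoidAlgebra.coeff_single]
    by_cases h : α = 0
    · rw [h]; exact vset_of_nonpos le_rfl
    · rw [Finsupp.single_eq_of_ne h]; exact Ideal.zero_mem _

/-- The ideal of elements of strictly larger order. -/
noncomputable def grJ [CommRing R] (J : Ideal R) : Ideal (greB J) where
  carrier := {f | ∀ α, f.1.coeff α ∈ vgt J α}
  add_mem' := by
    intro f g hf hg α
    exact Ideal.add_mem _ (hf α) (hg α)
  zero_mem' := fun α => Ideal.zero_mem _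
  smul_mem' := by
    intro f g hg α
    refine coeff_mul_mem _ _ _ _ fun a => ?_
    have := mul_mem_vgt (f.2 a) (hg (α - a))
    rwa [add_sub_cancel] at this

/-- The associated graded ring of the real-indexed filtration. -/
abbrev GrM [CommRing R] (J : Ideal R) := greB J ⧸ grJ J

lemma mem_grJ [CommRing R] {J : Ideal R} {f : greB J} : f ∈ grJ J ↔ ∀ α, f.1.coeff α ∈ vgt J α := Iff.rfl

/-- the coefficient map -/
noncomputable def grCoeff [CommRing R] (J : Ideal R) (α : ℝ) : greB J →ₗ[R] vge J α where
  toFun f := ⟨f.1.coeff α, f.2 α⟩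
  map_add' _ _ := rfl
  map_smul' _ _ := rfl

/-- the projection on the graded piece -/
noncomputable def grProj [CommRing R] (J : Ideal R) (α : ℝ) : GrM J →ₗ[R] idealQuot (vge J α) (vgt J α) :=
  (Submodule.liftQ ((grJ J).restrictScalars R)
    ((Submodule.mkQ (Submodule.comap (vge J α).subtype (vgt J α))).comp (grCoeff J α)) (by
      intro f hf
      rw [LinearMap.mem_ker, LinearMap.comp_apply, Submodule.mkQ_apply, Submodule.Quotient.mk_eq_zero]
      exact hf α)).comp (Submodule.Quotient.restrictScalarsEquiv R (grJ J)).symm.toLinearMap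

lemma grProj_mk [CommRing R] (J : Ideal R) (α : ℝ) (f : greB J) :
    grProj J α (Ideal.Quotient.mk _ f) = Submodule.Quotient.mk ⟨f.1.coeff α, f.2 α⟩ := rfl

lemma grProj_mk_eq_zero [CommRing R] {J : Ideal R} {α : ℝ} {f : greB J} :
    grProj J α (Ideal.Quotient.mk _ f) = 0 ↔ f.1.coeff α ∈ vgt J α := by
  rw [grProj_mk, Submodule.Quotient.mk_eq_zero]; rfl

lemma gr_ext [CommRing R] {J : Ideal R} {x : GrM J} (h : ∀ α, grProj J α x = 0) : x = 0 := by
  obtain ⟨f, rfl⟩ := Ideal.Quotient.mk_surjective x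
  rw [Ideal.Quotient.eq_zero_iff_mem]
  exact fun α => grProj_mk_eq_zero.1 (h α)

lemma gr_support_finite [CommRing R] {J : Ideal R} (x : GrM J) : {α | grProj J α x ≠ 0}.Finite := by
  obtain ⟨f, rfl⟩ := Ideal.Quotient.mk_surjective x
  refine f.1.coeff.support.finite_toSet.subset fun α hα => ?_
  rw [Finset.mem_coe, Finsupp.mem_support_iff]
  intro h
  apply hα
  rw [grProj_mk_eq_zero, h]
  exact Ideal.zero_mem _

lemma gr_neg [CommRing R] {J : Ideal R} (x : GrM J) {α : ℝ} (hα : α < 0) : grProj J α x = 0 := by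
  obtain ⟨f, rfl⟩ := Ideal.Quotient.mk_surjective x
  rw [grProj_mk_eq_zero]
  exact vge_le_vgt hα (vset_of_nonpos le_rfl)

lemma gr_exists_max [CommRing R] {J : Ideal R} (x : GrM J) (hx : x ≠ 0) :
    ∃ α, grProj J α x ≠ 0 ∧ ∀ β, α < β → grProj J β x = 0 := by
  have hne : (gr_support_finite x).toFinset.Nonempty := by
    by_contra h
    rw [Finset.not_nonempty_iff_eq_empty] at h
    refine hx (gr_ext fun α => ?_)
    by_contra h2
    have : α ∈ (gr_support_finite x).toFinset := by rw [Set.Finite.mem_toFinset]; exact h2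
    rw [h] at this
    simp at this
  refine ⟨_, (Set.Finite.mem_toFinset _).1 (Finset.max'_mem _ hne), fun β hβ => ?_⟩
  by_contra h2
  have : β ∈ (gr_support_finite x).toFinset := by rw [Set.Finite.mem_toFinset]; exact h2
  exact absurd (Finset.le_max' _ _ this) (not_le.2 hβ)

instance gr_reduced [CommRing R] (J : Ideal R) : IsReduced (GrM J) := by
  rw [isReduced_iff_pow_one_lt 2 one_lt_two]
  intro x hx
  by_contra h0
  obtain ⟨α, h1, h2⟩ := gr_exists_max x h0
  obtain ⟨f, rfl⟩ := Ideal.Quotient.mk_surjective x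
  rw [Ne, grProj_mk_eq_zero] at h1
  simp only [grProj_mk_eq_zero] at h2
  rw [pow_two, ← map_mul, Ideal.Quotient.eq_zero_iff_mem] at hx
  have h3 : (f.1 * f.1).coeff (α + α) - f.1.coeff α * f.1.coeff α ∈ vgt J (α + α) := by
    rw [AddMonoidAlgebra.coeff_mul_apply_left, Finsupp.sum,
      ← Finset.add_sum_erase _ _ (Finsupp.mem_support_iff.2 (fun h => h1 (by rw [h]; exact Ideal.zero_mem _)) :
        α ∈ f.1.coeff.support)]
    rw [neg_add_cancel_left, add_sub_cancel_left]
    refine Ideal.sum_mem _ fun a ha => ?_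
    rcases lt_or_gt_of_ne (Finset.ne_of_mem_erase ha) with h | h
    · have := mul_mem_vgt (f.2 a) (h2 (-a + (α + α)) (by linarith))
      rwa [add_neg_cancel_left] at this
    · have := mul_mem_vgt' (h2 a h) (f.2 (-a + (α + α)))
      rwa [add_neg_cancel_left] at this
  refine h1 (vgt_of_sq ?_)
  have h4 := Ideal.sub_mem _ (hx (α + α)) h3
  simpa using h4

/-- homogeneous element -/
noncomputable def grSingle [CommRing R] (J : Ideal R) (α : ℝ) (y : R) (hy : y ∈ vge J α) : greB J :=
  ⟨AddMonoidAlgebra.single α y, by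
    intro β
    rw [AddMonoidAlgebra.coeff_single]
    by_cases h : β = α
    · rw [h, Finsupp.single_eq_same]; exact hy
    · rw [Finsupp.single_eq_of_ne h]; exact Ideal.zero_mem _⟩

section alg
variable [CommRing R] [IsLocalRing R] {d : ℕ} {J : Ideal R} {z : Fin d → R}

lemma QSetup.max_le_vgt (qs : QSetup R d J z) : maximalIdeal R ≤ vgt J 0 := by
  intro r hr
  obtain ⟨j, hj⟩ := qs.jm
  refine ⟨1 / ((j : ℝ) + 1), by positivity, ?_⟩
  refine vset_of_witness (j := j + 1) (N := 1) (by omega) ?_ ?_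
  · rw [pow_one]; exact hj (Ideal.pow_le_pow_right (by omega) (Ideal.pow_mem_pow hr (j + 1)))
  · push_cast; rw [one_div, inv_mul_cancel₀ (by positivity)]

lemma QSetup.z_mem (qs : QSetup R d J z) (i : Fin d) : z i ∈ vge J 1 := by
  have : z i ∈ J ^ 1 := by rw [pow_one, qs.hJ]; exact Ideal.subset_span ⟨i, rfl⟩
  simpa using pow_le_vge 1 this

/-- map from the residue field -/
noncomputable def QSetup.kMap (qs : QSetup R d J z) : ResidueField R →+* GrM J :=
  Ideal.Quotient.lift (maximalIdeal R) (algebraMap R (GrM J)) (by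
    intro r hr
    refine gr_ext fun α => ?_
    change grProj J α (Ideal.Quotient.mk _ (algebraMap R (greB J) r)) = 0
    rw [grProj_mk_eq_zero]
    change (algebraMap R (AddMonoidAlgebra R ℝ) r).coeff α ∈ _
    rw [AddMonoidAlgebra.coe_algebraMap, Function.comp_apply, AddMonoidAlgebra.coeff_single]
    by_cases h : α = 0
    · rw [h, Finsupp.single_eq_same]; exact qs.max_le_vgt hr
    · rw [Finsupp.single_eq_of_ne h]; exact Ideal.zero_mem _)

/-- algebra structure over the polynomial ring -/
@[reducible] noncomputable def QSetup.grAlg (qs : QSetup R d J z) :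
    Algebra (MvPolynomial (Fin d) (ResidueField R)) (GrM J) :=
  (MvPolynomial.eval₂Hom qs.kMap (fun i => Ideal.Quotient.mk _ (grSingle J 1 (z i) (qs.z_mem i)))).toAlgebra

/-- lifted map -/
noncomputable def QSetup.phi (qs : QSetup R d J z) : MvPolynomial (Fin d) R →ₐ[R] greB J :=
  MvPolynomial.aeval (fun i => grSingle J 1 (z i) (qs.z_mem i))

lemma QSetup.algebraMap_map (qs : QSetup R d J z) (F : MvPolynomial (Fin d) R) :
    let _ := qs.grAlg
    algebraMap (MvPolynomial (Fin d) (ResidueField R)) (GrM J) (MvPolynomial.map (residue R) F) =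
      Ideal.Quotient.mk _ (qs.phi F) := by
  intro _
  change MvPolynomial.eval₂Hom (S₁ := GrM J) qs.kMap
    (fun i => Ideal.Quotient.mk _ (grSingle J 1 (z i) (qs.z_mem i))) (MvPolynomial.map (residue R) F) = _
  induction F using MvPolynomial.induction_on with
  | C a => 
    simp only [MvPolynomial.map_C, MvPolynomial.coe_eval₂Hom, MvPolynomial.eval₂_C, QSetup.phi, MvPolynomial.aeval_C]
    rfl
  | add p q hp hq => rw [map_add, map_add, hp, hq, map_add, map_add]
  | mul_X p i hp =>
    rw [map_mul, map_mul, hp, map_mul, map_mul]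
    congr 1
    simp [QSetup.phi]

lemma QSetup.phi_hom (qs : QSetup R d J z) {m : ℕ} {F : MvPolynomial (Fin d) R} (hF : F.IsHomogeneous m) :
    (qs.phi F).1 = AddMonoidAlgebra.single (m : ℝ) (MvPolynomial.eval z F) := by
  have h0 : (qs.phi F).1 = MvPolynomial.aeval (fun i => AddMonoidAlgebra.single (1 : ℝ) (z i)) F := by
    change (greB J).val (qs.phi F) = _
    rw [QSetup.phi, MvPolynomial.comp_aeval_apply]
    rfl
  rw [h0, MvPolynomial.aeval_def, MvPolynomial.eval₂_eq, MvPolynomial.eval_eq]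
  have h1 : ∀ s ∈ F.support, (algebraMap R (AddMonoidAlgebra R ℝ) (F.coeff s)) *
      ∏ i ∈ s.support, AddMonoidAlgebra.single (1 : ℝ) (z i) ^ s i =
      AddMonoidAlgebra.single (m : ℝ) (F.coeff s * ∏ i ∈ s.support, z i ^ s i) := by
    intro s hs
    have h2 := hF (MvPolynomial.mem_support_iff.1 hs)
    have h3 : ∏ i ∈ s.support, AddMonoidAlgebra.single (1 : ℝ) (z i) ^ s i =
        AddMonoidAlgebra.single (m : ℝ) (∏ i ∈ s.support, z i ^ s i) := by
      simp only [AddMonoidAlgebra.single_pow]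
      rw [AddMonoidAlgebra.prod_single]
      congr 1
      rw [← h2, Finsupp.weight_apply, Finsupp.sum]
      push_cast
      simp
    rw [h3, AddMonoidAlgebra.coe_algebraMap, Function.comp_apply, AddMonoidAlgebra.single_mul_single, zero_add]
    rfl
  rw [Finset.sum_congr rfl h1]
  exact (map_sum (AddMonoidAlgebra.singleAddHom (m : ℝ)) _ _).symm

lemma QSetup.phi_mul_coeff (qs : QSetup R d J z) (F : MvPolynomial (Fin d) R) (f : greB J) (α : ℝ) :
    (qs.phi F * f).1.coeff α = ∑ j ∈ Finset.range (F.totalDegree + 1),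
      MvPolynomial.eval z (F.homogeneousComponent j) * f.1.coeff (α - j) := by
  conv_lhs => rw [← MvPolynomial.sum_homogeneousComponent F, map_sum, Finset.sum_mul]
  change ((greB J).val (∑ _ ∈ _, _)).coeff α = _
  rw [map_sum, AddMonoidAlgebra.coeff_sum, Finsupp.finsetSum_apply]
  refine Finset.sum_congr rfl fun j _ => ?_
  change ((qs.phi _).1 * f.1).coeff α = _
  rw [qs.phi_hom (MvPolynomial.homogeneousComponent_isHomogeneous j F),
    AddMonoidAlgebra.coeff_single_mul_apply, sub_eq_neg_add]

end alg


-- part 11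

/-! ## P11 : rank of the associated graded ring -/

lemma hockey (d n : ℕ) (hd : 0 < d) : ∑ j ∈ Finset.range n, (d + j - 1).choose j = (d + n - 1).choose d := by
  induction n with
  | zero => rw [Finset.sum_range_zero, add_zero, Nat.choose_eq_zero_of_lt (by omega)]
  | succ n ih =>
    rw [Finset.sum_range_succ, ih]
    obtain ⟨e, rfl⟩ : ∃ e, d = e + 1 := ⟨d - 1, by omega⟩
    have h1 : e + 1 + n - 1 = e + n := by omega
    have h2 : e + 1 + (n + 1) - 1 = e + n + 1 := by omega
    rw [h1, h2, Nat.choose_succ_succ, add_comm]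
    congr 1
    have := Nat.choose_symm_add (a := e) (b := n)
    rw [this]

lemma choose_two (d D : ℕ) : (d + 2 * D).choose d ≤ 2 ^ d * (d + D).choose d := by
  induction d with
  | zero => simp
  | succ d ih =>
    have h1 := Nat.add_one_mul_choose_eq (d + 2 * D) d
    have h2 := Nat.add_one_mul_choose_eq (d + D) d
    have e1 : d + 1 + 2 * D = (d + 2 * D).succ := by omega
    have e2 : d + 1 + D = (d + D).succ := by omega
    rw [e1, e2]
    have h3 : (d + 2 * D).succ.choose d.succ * d.succ ≤ 2 ^ (d + 1) * (d + D).succ.choose d.succ * d.succ := by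
      rw [← h1, mul_assoc, ← h2]
      calc (d + 2 * D).succ * (d + 2 * D).choose d ≤ (2 * (d + D).succ) * (2 ^ d * (d + D).choose d) :=
            Nat.mul_le_mul (by omega) ih
        _ = _ := by rw [Nat.succ_eq_add_one]; ring
    exact Nat.le_of_mul_le_mul_right h3 (Nat.succ_pos d)

lemma length_quot_anti [CommRing R] {K N : Ideal R} (h : K ≤ N) :
    Module.length R (R ⧸ N) ≤ Module.length R (R ⧸ K) := by
  rw [length_quot_add h]; exact le_add_self

lemma length_quot_pow [CommRing R] [IsLocalRing R] [IsNoetherianRing R] {d : ℕ} {J : Ideal R}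
    {z : Fin d → R} (qs : QSetup R d J z) (hd : 0 < d) (n : ℕ) :
    Module.length R (R ⧸ J ^ n) = (d + n - 1).choose d * Module.length R (R ⧸ J) := by
  rw [← hockey d n hd]
  induction n with
  | zero =>
    simp only [Finset.sum_range_zero, Nat.cast_zero, zero_mul]
    rw [Module.length_eq_zero_iff, pow_zero, Ideal.one_eq_top]
    infer_instance
  | succ n ih =>
    rw [length_quot_add (Ideal.pow_le_pow_right (Nat.le_succ n)), ih, pow_succ,
      length_pow_mul qs n le_rfl, Finset.sum_range_succ, Nat.cast_add, add_mul, add_comm]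

lemma sum_ilen_le [CommRing R] {J : Ideal R} (T : Finset ℝ) (a : ℝ) (h : ∀ β ∈ T, β < a) :
    ∑ β ∈ T, ilen (vge J β) (vgt J β) ≤ Module.length R (R ⧸ vge J a) := by
  induction T using Finset.induction_on_max generalizing a with
  | empty => simp
  | insert b s hb ih =>
    rw [Finset.sum_insert (fun h => lt_irrefl _ (hb b h))]
    calc _ ≤ ilen (vge J b) (vgt J b) + Module.length R (R ⧸ vge J b) := by gcongr; exact ih b hb
      _ = Module.length R (R ⧸ vgt J b) := (length_quot_add vgt_le_vge).symm
      _ ≤ _ := length_quot_anti (vge_le_vgt (h b (Finset.mem_insert_self _ _)))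

lemma homComp_map {S T : Type*} [CommRing S] [CommRing T] (g : S →+* T) {d : ℕ} (j : ℕ)
    (F : MvPolynomial (Fin d) S) : MvPolynomial.map g (F.homogeneousComponent j) =
      (MvPolynomial.map g F).homogeneousComponent j := by
  ext m
  rw [MvPolynomial.coeff_map, MvPolynomial.coeff_homogeneousComponent, MvPolynomial.coeff_homogeneousComponent,
    MvPolynomial.coeff_map]
  split_ifs <;> simp

lemma exists_lift_deg [CommRing R] [IsLocalRing R] {d : ℕ} (a : MvPolynomial (Fin d) (ResidueField R)) :
    ∃ F : MvPolynomial (Fin d) R, MvPolynomial.map (residue R) F = a ∧ F.totalDegree ≤ a.totalDegree := by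
  obtain ⟨G, rfl⟩ := MvPolynomial.map_surjective (residue R) residue_surjective a
  refine ⟨∑ j ∈ Finset.range ((MvPolynomial.map (residue R) G).totalDegree + 1), G.homogeneousComponent j, ?_, ?_⟩
  · rw [map_sum]
    simp only [homComp_map]
    exact MvPolynomial.sum_homogeneousComponent _
  · refine MvPolynomial.totalDegree_finsetSum_le fun j hj => ?_
    refine (MvPolynomial.IsHomogeneous.totalDegree_le (MvPolynomial.homogeneousComponent_isHomogeneous j G)).trans ?_
    have := Finset.mem_range.1 hj
    omega

lemma top_comp_ne_zero {S : Type*} [CommRing S] {d : ℕ} {a : MvPolynomial (Fin d) S} (ha : a ≠ 0) :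
    a.homogeneousComponent a.totalDegree ≠ 0 := by
  intro h
  obtain ⟨m, hm, h2⟩ := Finset.exists_mem_eq_sup a.support (MvPolynomial.support_nonempty.2 ha)
    (fun s => s.sum fun _ e => e)
  have h3 := MvPolynomial.coeff_homogeneousComponent a.totalDegree a m
  rw [h, MvPolynomial.coeff_zero, if_pos] at h3
  · exact MvPolynomial.mem_support_iff.1 hm h3.symm
  · rw [MvPolynomial.totalDegree, h2]; rfl

section alg
variable [CommRing R] [IsLocalRing R] [IsNoetherianRing R] {d : ℕ} {J : Ideal R} {z : Fin d → R}

lemma QSetup.eval_comp_mem (qs : QSetup R d J z) (F : MvPolynomial (Fin d) R) (j : ℕ) :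
    MvPolynomial.eval z (F.homogeneousComponent j) ∈ vge J j :=
  pow_le_vge j (qs.eval_mem_pow (MvPolynomial.homogeneousComponent_isHomogeneous j F))

lemma QSetup.smul_proj_zero (qs : QSetup R d J z) (a : MvPolynomial (Fin d) (ResidueField R)) (x : GrM J)
    (β : ℝ) (h : ∀ j : ℕ, j ≤ a.totalDegree → grProj J (β - j) x = 0) :
    let _ := qs.grAlg
    grProj J β (a • x) = 0 := by
  intro _
  obtain ⟨F, rfl, hF⟩ := exists_lift_deg a
  obtain ⟨f, rfl⟩ := Ideal.Quotient.mk_surjective x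
  rw [Algebra.smul_def, qs.algebraMap_map, ← map_mul, grProj_mk_eq_zero, qs.phi_mul_coeff]
  refine Ideal.sum_mem _ fun j hj => ?_
  have := Finset.mem_range.1 hj
  have h2 := mul_mem_vgt (qs.eval_comp_mem F j) (grProj_mk_eq_zero.1 (h j (by omega)))
  rwa [add_sub_cancel] at h2

lemma QSetup.gr_torsionFree (qs : QSetup R d J z) (a : MvPolynomial (Fin d) (ResidueField R)) (x : GrM J)
    (ha : a ≠ 0) :
    let _ := qs.grAlg
    a • x = 0 → x = 0 := by
  intro _ hax
  by_contra h0
  obtain ⟨α, h1, h2⟩ := gr_exists_max x h0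
  obtain ⟨F, hFa, hF⟩ := exists_lift_deg a
  obtain ⟨f, rfl⟩ := Ideal.Quotient.mk_surjective x
  have hdeg : F.totalDegree = a.totalDegree := by
    refine le_antisymm hF ?_
    rw [← hFa]
    unfold MvPolynomial.totalDegree
    exact Finset.sup_mono (MvPolynomial.support_map_subset _ _)
  rw [← hFa, Algebra.smul_def, qs.algebraMap_map, ← map_mul] at hax
  have h3 : grProj J (α + a.totalDegree) (Ideal.Quotient.mk _ (qs.phi F * f)) = 0 := by rw [hax, map_zero]
  rw [grProj_mk_eq_zero, qs.phi_mul_coeff, Finset.sum_range_succ, hdeg] at h3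
  have h4 : ∑ j ∈ Finset.range a.totalDegree,
      MvPolynomial.eval z (F.homogeneousComponent j) * f.1.coeff (α + a.totalDegree - j) ∈
        vgt J (α + a.totalDegree) := by
    refine Ideal.sum_mem _ fun j hj => ?_
    have hj' : (j : ℝ) < a.totalDegree := by exact_mod_cast Finset.mem_range.1 hj
    have h2 := mul_mem_vgt (qs.eval_comp_mem F j)
      (grProj_mk_eq_zero.1 (h2 (α + a.totalDegree - j) (by linarith)))
    rwa [add_sub_cancel] at h2
  have h5 := Ideal.sub_mem _ h3 h4
  rw [add_sub_cancel_left, add_sub_cancel_right] at h5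
  apply h1
  rw [grProj_mk_eq_zero]
  refine qs.vgt_cancel (MvPolynomial.homogeneousComponent_isHomogeneous _ F) ?_ h5
  rw [homComp_map, hFa]
  intro h6
  exact top_comp_ne_zero ha h6

end alg


-- part 12

/-! ## P12 : finiteness of the associated graded ring -/

section alg
variable [CommRing R] [IsLocalRing R] [IsNoetherianRing R] {d : ℕ} {J : Ideal R} {z : Fin d → R}

lemma QSetup.length_J_ne_top (qs : QSetup R d J z) : Module.length R (R ⧸ J) ≠ ⊤ := by
  obtain ⟨j, hj⟩ := qs.jm
  have h1 : IsArtinianRing (R ⧸ J) := quot_artinian hj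
  have h2 : IsArtinian R (R ⧸ J) := isArtinian_of_surjective_algebraMap (R := R ⧸ J) (M := R ⧸ J) Ideal.Quotient.mk_surjective
  have h3 : IsFiniteLength R (R ⧸ J) := isFiniteLength_iff_isNoetherian_isArtinian.2 ⟨inferInstance, h2⟩
  exact Module.length_ne_top_iff.2 h3

lemma length_residue : Module.length R (ResidueField R) = 1 := by
  rw [Module.length_eq_one_iff]
  have : IsSimpleModule R (R ⧸ maximalIdeal R) := isSimpleModule_iff_isCoatom.2 (maximalIdeal.isMaximal R).out
  exact this

lemma QSetup.gr_rank (qs : QSetup R d J z) (hd : 0 < d) :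
    let _ := qs.grAlg
    Module.rank (MvPolynomial (Fin d) (ResidueField R)) (GrM J) < Cardinal.aleph0 := by
  classical
  intro _
  obtain ⟨e0, he0⟩ := ENat.ne_top_iff_exists.1 qs.length_J_ne_top
  refine lt_of_le_of_lt (rank_le (n := 2 ^ d * e0) ?_) (Cardinal.natCast_lt_aleph0)
  intro s hs
  let T : Finset ℝ := s.biUnion fun x => (gr_support_finite x).toFinset
  have hT : ∀ x ∈ s, ∀ α, α ∉ T → grProj J α x = 0 := by
    intro x hx α hα
    by_contra h
    exact hα (Finset.mem_biUnion.2 ⟨x, hx, by rw [Set.Finite.mem_toFinset]; exact h⟩)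
  obtain ⟨D, hD⟩ : ∃ D : ℕ, ∀ t ∈ T, t < D := by
    obtain ⟨M, hM⟩ := T.bddAbove
    obtain ⟨D, hD⟩ := exists_nat_gt M
    exact ⟨D, fun t ht => lt_of_le_of_lt (hM ht) hD⟩
  let S : Finset (Fin d →₀ ℕ) := (Finset.range (D + 1)).biUnion fun j => (Finset.univ : Finset (Fin d)).finsuppAntidiag j
  have hS : ∀ m : Fin d →₀ ℕ, m ∈ S ↔ m.degree ≤ D := by
    intro m
    simp only [S, Finset.mem_biUnion, Finset.mem_finsuppAntidiag, Finset.mem_range]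
    constructor
    · rintro ⟨j, hj, h, _⟩
      rw [Finsupp.degree_eq_sum, h]; omega
    · intro h
      exact ⟨m.degree, by omega, by rw [Finsupp.degree_eq_sum], Finset.subset_univ _⟩
  have hScard : S.card = (d + D).choose d := by
    rw [Finset.card_biUnion]
    · have := hockey d (D + 1) hd
      rw [show d + (D + 1) - 1 = d + D by omega] at this
      rw [← this]
      refine Finset.sum_congr rfl fun j _ => ?_
      rw [Finset.card_finsuppAntidiag_nat_eq_choose]
      simp
    · intro i _ j _ hij
      rw [Function.onFun, Finset.disjoint_left]
      intro m h1 h2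
      rw [Finset.mem_finsuppAntidiag] at h1 h2
      exact hij (h1.1.symm.trans h2.1)
  let T' : Finset ℝ := (T ×ˢ Finset.range (D + 1)).image fun p => p.1 + (p.2 : ℝ)
  let pol : (s × S → ResidueField R) → s → MvPolynomial (Fin d) (ResidueField R) := fun v i => ∑ m : S, MvPolynomial.monomial m.1 (v (i, m))
  have hpol : ∀ v i (m : S), (pol v i).coeff m.1 = v (i, m) := by
    intro v i m; simp only [pol]; rw [MvPolynomial.coeff_sum]
    simp only [MvPolynomial.coeff_monomial]
    rw [Finset.sum_eq_single m]
    · simp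
    · intro b _ hb; rw [if_neg]; intro h; exact hb (Subtype.ext h)
    · simp
  have hpdeg : ∀ v i, (pol v i).totalDegree ≤ D := by
    intro v i
    refine MvPolynomial.totalDegree_finsetSum_le fun m _ => ?_
    refine (MvPolynomial.totalDegree_monomial_le _ _).trans ?_
    have := (hS m.1).1 m.2
    rw [Finsupp.degree_eq_sum] at this
    refine le_trans (le_of_eq ?_) this
    rw [Finsupp.sum_fintype]
    · rfl
    · intro; rfl
  have hC : ∀ (r : R) (x : GrM J), (MvPolynomial.C (residue R r) : MvPolynomial (Fin d) (ResidueField R)) • x = r • x := by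
    intro r x
    have h1 := qs.algebraMap_map (MvPolynomial.C r)
    rw [MvPolynomial.map_C] at h1
    rw [Algebra.smul_def, h1, QSetup.phi, MvPolynomial.aeval_C]
    obtain ⟨f, rfl⟩ := Ideal.Quotient.mk_surjective x
    rw [← map_mul, ← Algebra.smul_def]
    rfl
  let Ψ : (s × S → ResidueField R) →ₗ[R] GrM J :=
    { toFun := fun v => ∑ i : s, pol v i • i.1
      map_add' := by
        intro v w
        rw [← Finset.sum_add_distrib]
        refine Finset.sum_congr rfl fun i _ => ?_
        have hp : pol (v + w) i = pol v i + pol w i := by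
          simp only [pol, Pi.add_apply, map_add, Finset.sum_add_distrib]
        rw [hp, Algebra.smul_def, Algebra.smul_def, Algebra.smul_def, map_add, add_mul]
      map_smul' := by
        intro r v
        rw [RingHom.id_apply, Finset.smul_sum]
        refine Finset.sum_congr rfl fun i _ => ?_
        rw [← hC, smul_smul]
        congr 1
        simp only [pol, Finset.mul_sum, MvPolynomial.C_mul_monomial]
        refine Finset.sum_congr rfl fun m _ => ?_
        congr 1 }
  have hΨ : ∀ v, Ψ v = ∑ i : s, pol v i • i.1 := fun v => rfl
  let Φ : (s × S → ResidueField R) →ₗ[R] (∀ β : T', idealQuot (vge J β.1) (vgt J β.1)) :=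
    (LinearMap.pi fun β => grProj J β.1).comp Ψ
  have hΦ : Function.Injective Φ := by
    rw [← LinearMap.ker_eq_bot, LinearMap.ker_eq_bot']
    intro v hv
    have h1 : Ψ v = 0 := by
      refine gr_ext fun β => ?_
      by_cases hβ : β ∈ T'
      · exact congrFun hv ⟨β, hβ⟩
      · rw [hΨ, map_sum]
        refine Finset.sum_eq_zero fun i _ => ?_
        refine qs.smul_proj_zero _ _ _ fun j hj => hT _ i.2 _ fun h => hβ ?_
        refine Finset.mem_image.2 ⟨(β - j, j), Finset.mem_product.2 ⟨h, Finset.mem_range.2 ?_⟩, by simp⟩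
        have := hpdeg v i
        omega
    have h2 := Fintype.linearIndependent_iff.1 hs (pol v) h1
    ext ⟨i, m⟩
    rw [← hpol v i m, h2 i]; simp
  have hlen := Module.length_le_of_injective Φ hΦ
  rw [Module.length_pi, length_residue, mul_one, ENat.card_eq_coe_fintype_card, Fintype.card_prod,
    Fintype.card_coe, Fintype.card_coe, hScard, Module.length_pi_of_fintype] at hlen
  have hsum : ∑ β : T', Module.length R (idealQuot (vge J β.1) (vgt J β.1)) ≤
      Module.length R (R ⧸ J ^ (2 * D + 1)) := by
    have h1 : ∑ β : T', Module.length R (idealQuot (vge J β.1) (vgt J β.1)) =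
        ∑ β ∈ T', ilen (vge J β) (vgt J β) := Finset.sum_coe_sort T' (fun β => ilen (vge J β) (vgt J β))
    rw [h1]
    refine (sum_ilen_le T' ((2 * D + 1 : ℕ) : ℝ) ?_).trans (length_quot_anti (pow_le_vge _))
    intro β hβ
    obtain ⟨⟨t, j⟩, h1, rfl⟩ := Finset.mem_image.1 hβ
    rw [Finset.mem_product] at h1
    have h2 := hD t h1.1
    have h3 : (j : ℝ) < D + 1 := by exact_mod_cast Finset.mem_range.1 h1.2
    push_cast
    linarith
  rw [length_quot_pow qs hd, ← he0] at hsum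
  have h5 := hlen.trans hsum
  rw [show d + (2 * D + 1) - 1 = d + 2 * D by omega] at h5
  have h6 : s.card * (d + D).choose d ≤ (d + 2 * D).choose d * e0 := by exact_mod_cast h5
  have h7 : s.card * (d + D).choose d ≤ (2 ^ d * e0) * (d + D).choose d := by
    refine h6.trans ?_
    calc (d + 2 * D).choose d * e0 ≤ (2 ^ d * (d + D).choose d) * e0 := Nat.mul_le_mul_right _ (choose_two d D)
      _ = _ := by ring
  exact Nat.le_of_mul_le_mul_right h7 (Nat.choose_pos (by omega))

end alg


-- part 13

/-! ## P13 : integrality -/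

lemma grSingle_pow [CommRing R] (J : Ideal R) {α : ℝ} {y : R} (hy : y ∈ vge J α) (n : ℕ) :
    grSingle J α y hy ^ n = grSingle J (n * α) (y ^ n) (vset_pow n hy) := by
  apply Subtype.ext
  change (AddMonoidAlgebra.single α y) ^ n = AddMonoidAlgebra.single _ _
  rw [AddMonoidAlgebra.single_pow, nsmul_eq_mul]

lemma grSingle_coeff_self [CommRing R] (J : Ideal R) {α : ℝ} {y : R} (hy : y ∈ vge J α) :
    (grSingle J α y hy).1.coeff α = y := by
  change (AddMonoidAlgebra.single α y).coeff α = y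
  rw [AddMonoidAlgebra.coeff_single, Finsupp.single_eq_same]

lemma grSingle_coeff_ne [CommRing R] (J : Ideal R) {α β : ℝ} {y : R} (hy : y ∈ vge J α) (h : β ≠ α) :
    (grSingle J α y hy).1.coeff β = 0 := by
  change (AddMonoidAlgebra.single α y).coeff β = 0
  rw [AddMonoidAlgebra.coeff_single, Finsupp.single_eq_of_ne h]

lemma grSingle_proj_ne [CommRing R] (J : Ideal R) {α β : ℝ} {y : R} (hy : y ∈ vge J α) (h : β ≠ α) :
    grProj J β (Ideal.Quotient.mk _ (grSingle J α y hy)) = 0 := by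
  rw [grProj_mk_eq_zero, grSingle_coeff_ne J hy h]; exact Ideal.zero_mem _

lemma grSingle_eq_zero [CommRing R] (J : Ideal R) {α : ℝ} {y : R} (hy : y ∈ vge J α) :
    (Ideal.Quotient.mk (grJ J) (grSingle J α y hy)) = 0 ↔ y ∈ vgt J α := by
  constructor
  · intro h
    have : grProj J α (Ideal.Quotient.mk (grJ J) (grSingle J α y hy)) = 0 := by rw [h, map_zero]
    rwa [grProj_mk_eq_zero, grSingle_coeff_self] at this
  · intro h
    refine gr_ext fun β => ?_
    by_cases hβ : β = α
    · subst hβ; rwa [grProj_mk_eq_zero, grSingle_coeff_self]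
    · exact grSingle_proj_ne J hy hβ

section alg
variable [CommRing R] [IsLocalRing R] [IsNoetherianRing R] {d : ℕ} {J : Ideal R} {z : Fin d → R}

lemma QSetup.irr (qs : QSetup R d J z) (hd : 0 < d) {α : ℝ} (hα : Irrational α) {y : R}
    (hy : y ∈ vge J α) : y ∈ vgt J α := by
  by_contra hcon
  let _ := qs.grAlg
  let Y : ℕ → GrM J := fun n => Ideal.Quotient.mk _ (grSingle J (n * α) (y ^ n) (vset_pow n hy))
  have hY0 : ∀ n, Y n ≠ 0 := by
    intro n
    have h1 : Y n = (Ideal.Quotient.mk _ (grSingle J α y hy)) ^ n := by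
      rw [← map_pow, grSingle_pow]
    rw [h1]
    intro h
    exact hcon ((grSingle_eq_zero J hy).1 (eq_zero_of_pow_eq_zero h))
  have key : ∀ (a : MvPolynomial (Fin d) (ResidueField R)) n β, grProj J β (a • Y n) ≠ 0 → ∃ j : ℕ, β = n * α + j := by
    intro a n β h
    by_contra! hc
    refine h (qs.smul_proj_zero a _ β fun j _ => grSingle_proj_ne J _ ?_)
    intro hj
    exact hc j (by linarith)
  have hli : LinearIndependent (MvPolynomial (Fin d) (ResidueField R)) Y := by
    rw [linearIndependent_iff']
    intro s g hs i hi
    by_contra hg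
    have h1 : g i • Y i ≠ 0 := fun h => hY0 i (qs.gr_torsionFree _ _ hg h)
    obtain ⟨β, hβ⟩ : ∃ β, grProj J β (g i • Y i) ≠ 0 := by
      by_contra! hc; exact h1 (gr_ext hc)
    have h2 : grProj J β (∑ i ∈ s, g i • Y i) = 0 := by rw [hs, map_zero]
    rw [map_sum, Finset.sum_eq_single i] at h2
    · exact hβ h2
    · intro i' _ hi'
      by_contra hc
      obtain ⟨j, hj⟩ := key _ _ _ hβ
      obtain ⟨j', hj'⟩ := key _ _ _ hc
      apply hα
      have hne : (i : ℝ) - i' ≠ 0 := by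
        intro h; exact hi' (by exact_mod_cast (sub_eq_zero.1 h).symm)
      refine ⟨((j' : ℚ) - j) / ((i : ℚ) - i'), ?_⟩
      push_cast
      rw [div_eq_iff hne]
      linarith
    · intro h; exact absurd hi h
  exact absurd (qs.gr_rank hd) (not_lt.2 hli.aleph0_le_rank)

lemma QSetup.gr_integral_nat (qs : QSetup R d J z) {a : ℕ} {y : R} (hy : y ∈ vge J (a : ℝ)) :
    let _ := qs.grAlg
    IsIntegral (MvPolynomial (Fin d) (ResidueField R)) (Ideal.Quotient.mk (grJ J) (grSingle J a y hy)) := by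
  intro _
  obtain ⟨n, hn, c, hc, heq⟩ := isIntegralOverIdeal_of_vset hy
  have hF : ∀ i ∈ Finset.Icc 1 n, ∃ F : MvPolynomial (Fin d) R, F.IsHomogeneous (a * i) ∧ MvPolynomial.eval z F = c i := by
    intro i hi
    have := hc i hi
    rw [← pow_mul] at this
    exact qs.exists_form_pow this
  choose! F hF1 hF2 using hF
  set X0 := Ideal.Quotient.mk (grJ J) (grSingle J a y hy) with hX0
  refine ⟨Polynomial.X ^ n + ∑ i ∈ Finset.Icc 1 n, Polynomial.C (MvPolynomial.map (residue R) (F i)) * Polynomial.X ^ (n - i), ?_, ?_⟩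
  · apply Polynomial.monic_X_pow_add
    refine (Polynomial.degree_sum_le _ _).trans_lt ?_
    rw [Finset.sup_lt_iff (by exact WithBot.bot_lt_coe n)]
    intro i hi
    refine (Polynomial.degree_C_mul_X_pow_le _ _).trans_lt ?_
    rw [Finset.mem_Icc] at hi
    exact_mod_cast (by omega : n - i < n)
  · change Polynomial.eval₂RingHom (algebraMap (MvPolynomial (Fin d) (ResidueField R)) (GrM J)) X0 _ = 0
    have hXX : Polynomial.eval₂RingHom (algebraMap (MvPolynomial (Fin d) (ResidueField R)) (GrM J)) X0 Polynomial.X = X0 := Polynomial.eval₂_X _ _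
    have hCC : ∀ p, Polynomial.eval₂RingHom (algebraMap (MvPolynomial (Fin d) (ResidueField R)) (GrM J)) X0 (Polynomial.C p) = algebraMap (MvPolynomial (Fin d) (ResidueField R)) (GrM J) p := fun p => Polynomial.eval₂_C _ _
    rw [map_add, map_pow, hXX, map_sum]
    have h1 : ∀ i ∈ Finset.Icc 1 n, Polynomial.eval₂RingHom (algebraMap (MvPolynomial (Fin d) (ResidueField R)) (GrM J)) X0 (Polynomial.C (MvPolynomial.map (residue R) (F i)) * Polynomial.X ^ (n - i))
        = Ideal.Quotient.mk (grJ J) (qs.phi (F i) * (grSingle J a y hy) ^ (n - i)) := by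
      intro i hi
      rw [map_mul, map_pow, hXX, hCC, map_mul, map_pow, qs.algebraMap_map]
    rw [Finset.sum_congr rfl h1, hX0, ← map_pow, ← map_sum, ← map_add]
    convert map_zero (Ideal.Quotient.mk (grJ J))
    apply Subtype.ext
    have h2 : ∀ i ∈ Finset.Icc 1 n, (qs.phi (F i) * (grSingle J a y hy) ^ (n - i)).1 = AddMonoidAlgebra.single ((n : ℝ) * a) (c i * y ^ (n - i)) := by
      intro i hi
      rw [grSingle_pow]
      change (qs.phi (F i)).1 * AddMonoidAlgebra.single _ _ = _
      rw [qs.phi_hom (hF1 i hi), AddMonoidAlgebra.single_mul_single, hF2 i hi]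
      congr 1
      rw [Finset.mem_Icc] at hi
      rw [Nat.cast_sub hi.2]; push_cast; ring
    rw [grSingle_pow]
    change AddMonoidAlgebra.single _ _ + (greB J).val (∑ i ∈ _, _) = 0
    rw [map_sum]
    have h3 : ∑ i ∈ Finset.Icc 1 n, (greB J).val (qs.phi (F i) * (grSingle J a y hy) ^ (n - i)) = 
       ∑ i ∈ Finset.Icc 1 n, AddMonoidAlgebra.single ((n : ℝ) * a) (c i * y ^ (n - i)) := Finset.sum_congr rfl h2
    rw [h3]
    have h4 : ∀ s : Finset ℕ, ∑ i ∈ s, AddMonoidAlgebra.single ((n : ℝ) * a) (c i * y ^ (n - i)) = AddMonoidAlgebra.single ((n : ℝ) * a) (∑ i ∈ s, (c i * y ^ (n - i))) := by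
      intro s
      exact (map_sum (AddMonoidAlgebra.singleAddHom ((n : ℝ) * a)) _ _).symm
    rw [h4, ← AddMonoidAlgebra.single_add, heq, AddMonoidAlgebra.single_zero]

lemma QSetup.gr_integral (qs : QSetup R d J z) (hd : 0 < d) :
    let _ := qs.grAlg
    Algebra.IsIntegral (MvPolynomial (Fin d) (ResidueField R)) (GrM J) := by
  intro _
  have hom : ∀ (α : ℝ) (y : R) (hy : y ∈ vge J α), IsIntegral (MvPolynomial (Fin d) (ResidueField R)) (Ideal.Quotient.mk (grJ J) (grSingle J α y hy)) := by
    intro α y hy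
    by_cases h0 : y ∈ vgt J α
    · rw [(grSingle_eq_zero J hy).2 h0]; exact isIntegral_zero
    have hα0 : 0 ≤ α := by
      by_contra h
      apply h0
      have := gr_neg (Ideal.Quotient.mk (grJ J) (grSingle J α y hy)) (not_le.1 h)
      rwa [grProj_mk_eq_zero, grSingle_coeff_self] at this
    have hα : ¬ Irrational α := fun h => h0 (qs.irr hd h hy)
    rw [irrational_iff_ne_rational] at hα
    push Not at hα
    obtain ⟨a, b, hb, hab⟩ := hα
    -- make b a positive natural
    obtain ⟨p, q, hq, hpq⟩ : ∃ p q : ℕ, 0 < q ∧ (q : ℝ) * α = p := by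
      refine ⟨a.natAbs, b.natAbs, Int.natAbs_pos.2 hb, ?_⟩
      have h1 : (b : ℝ) ≠ 0 := by exact_mod_cast hb
      rw [Nat.cast_natAbs, Nat.cast_natAbs, Int.cast_abs, Int.cast_abs, ← abs_of_nonneg hα0, ← abs_mul, hab, mul_div_cancel₀ _ h1]
    refine IsIntegral.of_pow hq ?_
    rw [← map_pow, grSingle_pow]
    have h2 := vset_pow q hy
    have h3 : grSingle J (q * α) (y ^ q) (vset_pow q hy) = grSingle J p (y ^ q) (by rw [hpq] at h2; exact h2) := by
      apply Subtype.ext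
      change AddMonoidAlgebra.single _ _ = AddMonoidAlgebra.single _ _
      rw [hpq]
    rw [h3]
    exact qs.gr_integral_nat _
  refine ⟨fun x => ?_⟩
  obtain ⟨f, rfl⟩ := Ideal.Quotient.mk_surjective x
  have hf : f = ∑ α ∈ f.1.coeff.support, grSingle J α (f.1.coeff α) (f.2 α) := by
    apply Subtype.ext
    change f.1 = (greB J).val _
    rw [map_sum]
    change f.1 = ∑ α ∈ f.1.coeff.support, AddMonoidAlgebra.single α (f.1.coeff α)
    have h := AddMonoidAlgebra.sum_coeff_single f.1
    exact h.symm
  rw [hf, map_sum]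
  exact IsIntegral.sum (R := MvPolynomial (Fin d) (ResidueField R)) (A := GrM J) _ fun α _ => hom _ _ _

lemma QSetup.gr_finite (qs : QSetup R d J z) (hd : 0 < d) :
    let _ := qs.grAlg
    Module.Finite (MvPolynomial (Fin d) (ResidueField R)) (GrM J) := by
  intro _
  have := qs.gr_integral hd
  exact module_finite_of_rank _ (fun a x ha => qs.gr_torsionFree a x ha) (qs.gr_rank hd)

end alg


-- part 14

/-! ## P14 : the filtration is eventually stable -/

section alg
variable [CommRing R] [IsLocalRing R] [IsNoetherianRing R] {d : ℕ} {J : Ideal R} {z : Fin d → R}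

lemma QSetup.gen_step (qs : QSetup R d J z) (hd : 0 < d) :
    ∃ D0 : ℝ, 1 ≤ D0 ∧ ∀ α : ℝ, D0 < α → vge J α ≤ J * vge J (α - 1) ⊔ vgt J α := by
  classical
  let _ := qs.grAlg
  obtain ⟨s, hs⟩ := (qs.gr_finite hd).fg_top
  let T : Finset ℝ := s.biUnion fun x => (gr_support_finite x).toFinset
  obtain ⟨D, hD⟩ := T.bddAbove
  refine ⟨max 1 D, le_max_left _ _, fun α hα y hy => ?_⟩
  have hT : ∀ x ∈ s, grProj J α x = 0 := by
    intro x hx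
    by_contra h
    have : α ∈ T := Finset.mem_biUnion.2 ⟨x, hx, by rw [Set.Finite.mem_toFinset]; exact h⟩
    have := hD this
    have := le_max_right 1 D
    linarith
  have hmem : Ideal.Quotient.mk (grJ J) (grSingle J α y hy) ∈ Submodule.span (MvPolynomial (Fin d) (ResidueField R)) (s : Set (GrM J)) := by
    rw [hs]; exact Submodule.mem_top
  obtain ⟨a, -, ha⟩ := Submodule.mem_span_finset.1 hmem
  choose F hF using fun g : GrM J => exists_lift_deg (a g)
  choose f hf using fun g : GrM J => Ideal.Quotient.mk_surjective g
  have h1 : Ideal.Quotient.mk (grJ J) (∑ g ∈ s, qs.phi (F g) * f g) = Ideal.Quotient.mk (grJ J) (grSingle J α y hy) := by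
    rw [← ha, map_sum]
    refine Finset.sum_congr rfl fun g _ => ?_
    rw [Algebra.smul_def, map_mul, hf, ← (hF g).1, qs.algebraMap_map]
  rw [Ideal.Quotient.eq] at h1
  have h2 := h1 α
  have h3 : ((∑ g ∈ s, qs.phi (F g) * f g) - grSingle J α y hy : greB J).1.coeff α = (∑ g ∈ s, (qs.phi (F g) * f g).1.coeff α) - y := by
    have e1 : grCoeff J α ((∑ g ∈ s, qs.phi (F g) * f g) - grSingle J α y hy) = ∑ g ∈ s, grCoeff J α (qs.phi (F g) * f g) - grCoeff J α (grSingle J α y hy) := by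
      rw [map_sub, map_sum]
    have e2 := congrArg (vge J α).subtype e1
    refine e2.trans ?_
    rw [map_sub, map_sum]
    congr 1
    exact grSingle_coeff_self J hy
  rw [h3] at h2
  have h4 : ∑ g ∈ s, (qs.phi (F g) * f g).1.coeff α ∈ J * vge J (α - 1) ⊔ vgt J α := by
    refine Ideal.sum_mem _ fun g hg => ?_
    rw [qs.phi_mul_coeff]
    refine Ideal.sum_mem _ fun j _ => ?_
    rcases Nat.eq_zero_or_pos j with rfl | hj
    · refine Ideal.mem_sup_right (Ideal.mul_mem_left _ _ ?_)
      have := hT g hg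
      rw [← hf g, grProj_mk_eq_zero] at this
      simpa using this
    · refine Ideal.mem_sup_left ?_
      have e1 := qs.eval_mem_pow (MvPolynomial.homogeneousComponent_isHomogeneous j (F g))
      have e2 := (f g).2 (α - j)
      have e3 := Ideal.mul_mem_mul e1 e2
      refine (?_ : J ^ j * vge J (α - j) ≤ _) e3
      obtain ⟨i, rfl⟩ : ∃ i, j = i + 1 := ⟨j - 1, by omega⟩
      rw [pow_succ', mul_assoc]
      refine Ideal.mul_mono le_rfl (Ideal.mul_le.2 fun r hr t ht => ?_)
      have := mul_mem_vge (pow_le_vge i hr) ht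
      convert this using 2
      push_cast; ring
  have h5 : y = (∑ g ∈ s, (qs.phi (F g) * f g).1.coeff α) - ((∑ g ∈ s, (qs.phi (F g) * f g).1.coeff α) - y) := by ring
  rw [h5]
  exact Ideal.sub_mem _ h4 (Ideal.mem_sup_right h2)

lemma vgt_eq_vge (J : Ideal R) (γ : ℝ) : ∃ γ' > γ, vgt J γ ≤ vge J γ' := by
  obtain ⟨s, hs⟩ := (isNoetherianRing_iff_ideal_fg R).1 inferInstance (vgt J γ)
  have h : ∀ t : Finset R, (t : Set R) ⊆ vgt J γ → ∃ γ' > γ, (t : Set R) ⊆ vge J γ' := by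
    classical
    intro t
    induction t using Finset.induction_on with
    | empty => intro _; exact ⟨γ + 1, by linarith, by simp⟩
    | insert a t _ ih =>
      intro h
      rw [Finset.coe_insert, Set.insert_subset_iff] at h
      obtain ⟨γ1, h1, h2⟩ := ih h.2
      obtain ⟨γ2, h3, h4⟩ := h.1
      refine ⟨min γ1 γ2, lt_min h1 h3, ?_⟩
      rw [Finset.coe_insert, Set.insert_subset_iff]
      exact ⟨vset_mono (min_le_right _ _) h4, fun x hx => vset_mono (min_le_left _ _) (h2 hx)⟩
  obtain ⟨γ', h1, h2⟩ := h s (by rw [← hs]; exact Ideal.subset_span)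
  exact ⟨γ', h1, by rw [← hs]; exact Ideal.span_le.2 h2⟩

lemma stable_aux (J Q : Ideal R) (α N0 : ℝ) (hJm : ∃ j, maximalIdeal R ^ j ≤ J)
    (hstep : ∀ γ, α ≤ γ → vge J γ ≤ Q ⊔ vgt J γ) (hN : vge J N0 ≤ Q) : vge J α ≤ Q := by
  by_contra hcon
  obtain ⟨j, hj⟩ := hJm
  obtain ⟨M, hM⟩ := exists_nat_gt N0
  have hjm : maximalIdeal R ^ (j * M) ≤ J ^ M := by
    rw [pow_mul]; exact Ideal.pow_right_mono hj M
  have hart : IsArtinianRing (R ⧸ J ^ M) := quot_artinian hjm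
  let S : Set ℝ := {γ | α ≤ γ ∧ γ ≤ N0 ∧ vge J α ≤ Q ⊔ vge J γ}
  have hα : α < N0 := by
    by_contra h
    exact hcon ((vge_anti (not_lt.1 h)).trans hN)
  have hSα : α ∈ S := ⟨le_rfl, hα.le, le_sup_right⟩
  have wf : WellFounded (α := Ideal (R ⧸ J ^ M)) (· < ·) := wellFounded_lt
  obtain ⟨_, ⟨γ, hγ, rfl⟩, hmin⟩ := wf.has_min (Set.image (fun γ => (vge J γ).map (Ideal.Quotient.mk (J ^ M))) S) ⟨_, α, hSα, rfl⟩
  let S' : Set ℝ := {γ' | vge J γ ≤ vge J γ'}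
  have hb : ∀ γ' ∈ S', γ' ≤ N0 := by
    intro γ' h
    by_contra hc
    apply hcon
    refine hγ.2.2.trans (sup_le le_rfl (le_trans h ((vge_anti (not_le.1 hc).le).trans hN)))
  have hne : γ ∈ S' := le_refl (vge J γ)
  have hbdd : BddAbove S' := ⟨N0, hb⟩
  set γs := sSup S' with hγs
  have h1 : γ ≤ γs := le_csSup hbdd hne
  have h2 : vge J γ ≤ vge J γs := by
    intro y hy
    refine vset_of_forall_lt fun β hβ => ?_
    obtain ⟨γ', h3, h4⟩ := exists_lt_of_lt_csSup ⟨γ, hne⟩ hβ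
    exact vset_mono h4.le (h3 hy)
  obtain ⟨γ', h3, h4⟩ := vgt_eq_vge J γs
  have h5 : vge J α ≤ Q ⊔ vge J γ' := by
    refine hγ.2.2.trans (sup_le le_sup_left (h2.trans ((hstep γs (hγ.1.trans h1)).trans (sup_le_sup_left h4 _))))
  have h6 : γ' ≤ N0 := by
    by_contra hc
    exact hcon (h5.trans (sup_le le_rfl ((vge_anti (not_le.1 hc).le).trans hN)))
  have h7 := hmin _ ⟨γ', ⟨by linarith [hγ.1], h6, h5⟩, rfl⟩
  apply h7
  refine lt_of_le_of_ne (Ideal.map_mono (vge_anti (by linarith))) fun heq => ?_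
  have h8 : vge J γ ≤ vge J γ' := by
    intro y hy
    have h9 : Ideal.Quotient.mk (J ^ M) y ∈ (vge J γ').map (Ideal.Quotient.mk (J ^ M)) := by
      simp only at heq
      rw [heq]; exact Ideal.mem_map_of_mem _ hy
    rw [Ideal.mem_quotient_iff_mem] at h9
    · exact h9
    · exact (pow_le_vge M).trans (vge_anti (by linarith))
  have := le_csSup hbdd h8
  linarith

lemma QSetup.stable (qs : QSetup R d J z) (hd : 0 < d) (hAU : AnalyticallyUnramified R) :
    ∃ D0 : ℝ, 1 ≤ D0 ∧ ∀ α : ℝ, D0 < α → vge J α ≤ J * vge J (α - 1) := by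
  obtain ⟨D0, hD1, hD⟩ := qs.gen_step hd
  refine ⟨D0, hD1, fun α hα => ?_⟩
  obtain ⟨M, hM⟩ := exists_nat_gt α
  obtain ⟨j, hj⟩ := qs.jm
  have hrad : J.radical = maximalIdeal R := by
    apply le_antisymm
    · intro x hx
      obtain ⟨n, hn⟩ := hx
      exact (inferInstance : (maximalIdeal R).IsPrime).mem_of_pow_mem n (qs.le hn)
    · intro x hx
      exact ⟨j, hj (Ideal.pow_mem_pow hx j)⟩
  obtain ⟨N0, hN0⟩ := chevalley hAU J hrad (j * (M + 1))
  refine stable_aux J _ α N0 qs.jm ?_ ?_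
  · intro γ hγ
    refine (hD γ (by linarith)).trans (sup_le_sup_right (Ideal.mul_mono le_rfl (vge_anti (by linarith))) _)
  · refine hN0.trans ?_
    rw [pow_mul]
    refine (Ideal.pow_right_mono hj _).trans ?_
    rw [pow_succ']
    exact Ideal.mul_mono le_rfl ((pow_le_vge M).trans (vge_anti (by linarith)))

/-- uniform bound: `F_α ⊆ J^m` when `α ≥ m + κ` -/
lemma QSetup.bound (qs : QSetup R d J z) (hd : 0 < d) (hAU : AnalyticallyUnramified R) :
    ∃ κ : ℕ, ∀ (m : ℕ) (α : ℝ), (m : ℝ) + κ ≤ α → vge J α ≤ J ^ m := by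
  obtain ⟨D0, hD1, hD⟩ := qs.stable hd hAU
  obtain ⟨κ, hκ⟩ := exists_nat_gt D0
  refine ⟨κ, fun m => ?_⟩
  induction m with
  | zero => intro α _; simp
  | succ m ih =>
    intro α hα
    push_cast at hα
    have : (0 : ℝ) ≤ m := Nat.cast_nonneg m
    refine (hD α (by linarith)).trans ?_
    rw [pow_succ']
    exact Ideal.mul_mono le_rfl (ih _ (by linarith))

end alg


-- part 15

/-! ## P15 : numerical lemmas -/

lemma num_step (k M nt : ℕ) (c : ℕ → ℤ)
    (h : ∀ m ≥ M, ((m + (k + 1)).choose (k + 1) : ℤ) = ∑ j ∈ Finset.range (k + 2), c j * ((m + nt + j).choose j : ℤ)) :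
    ∀ m ≥ M + 1, ((m + k).choose k : ℤ) = ∑ j ∈ Finset.range (k + 1), c (j + 1) * ((m + nt + j).choose j : ℤ) := by
  intro m hm
  obtain ⟨l, rfl⟩ : ∃ l, m = l + 1 := ⟨m - 1, by omega⟩
  have h1 := h (l + 1) (by omega)
  have h2 := h l (by omega)
  rw [Finset.sum_range_succ'] at h1 h2
  have e : ∀ x j : ℕ, ((x + 1 + (j + 1)).choose (j + 1) : ℤ) = ((x + 1 + j).choose j : ℤ) + ((x + (j + 1)).choose (j + 1) : ℤ) := by
    intro x j
    rw [show x + 1 + (j + 1) = (x + 1 + j) + 1 by ring, Nat.choose_succ_succ]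
    push_cast
    rw [show x + (j + 1) = x + 1 + j by ring]
  rw [e] at h1
  have h3 : ∑ j ∈ Finset.range (k + 1), c (j + 1) * ((l + 1 + nt + (j + 1)).choose (j + 1) : ℤ) =
     ∑ j ∈ Finset.range (k + 1), c (j + 1) * ((l + 1 + nt + j).choose j : ℤ) + ∑ j ∈ Finset.range (k + 1), c (j + 1) * ((l + nt + (j + 1)).choose (j + 1) : ℤ) := by
    rw [← Finset.sum_add_distrib]
    refine Finset.sum_congr rfl fun j _ => ?_
    have := e (l + nt) j
    rw [show l + 1 + nt = l + nt + 1 by ring, this]; ring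
  rw [h3] at h1
  simp only [Nat.choose_zero_right] at h1 h2
  linarith

lemma num_final (k : ℕ) : ∀ (nt : ℕ) (M : ℕ) (c : ℕ → ℤ), c (k + 2) = 1 → c k = 0 →
    (∀ m ≥ M, ((m + (k + 2)).choose (k + 2) : ℤ) = ∑ j ∈ Finset.range (k + 3), c j * ((m + nt + j).choose j : ℤ)) →
    nt ≤ 1 := by
  induction k with
  | zero =>
    intro nt M c h1 h2 h
    have a1 := h M le_rfl
    have a2 := h (M + 1) (by omega)
    have e : ∀ x : ℕ, 2 * ((x + 2).choose 2 : ℤ) = (x + 2) * (x + 1) := by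
      intro x
      have := Nat.add_one_mul_choose_eq (x + 1) 1
      rw [Nat.choose_one_right] at this
      have h : ((x + 1 + 1 : ℕ) : ℤ) * ((x + 1 : ℕ) : ℤ) = ((x + 1 + 1).choose (1 + 1) : ℤ) * ((1 + 1 : ℕ) : ℤ) := by exact_mod_cast this
      push_cast at h
      rw [show x + 1 + 1 = x + 2 by ring] at h
      linarith
    simp only [Finset.sum_range_succ, Finset.sum_range_zero, zero_add] at a1 a2 h1
    rw [h1, h2] at a1 a2
    simp only [Nat.choose_one_right] at a1 a2
    have e1 := e M
    have e2 := e (M + 1)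
    have e3 := e (M + nt)
    have e4 := e (M + 1 + nt)
    push_cast at *
    have hc : c 1 = - (nt : ℤ) := by linarith
    rw [hc] at a1
    have : (nt : ℤ) * (nt - 1) = 0 := by nlinarith
    rcases mul_eq_zero.1 this with h | h
    · have : nt = 0 := by exact_mod_cast h
      omega
    · have : nt = 1 := by
        have : (nt : ℤ) = 1 := by linarith
        exact_mod_cast this
      omega
  | succ k ih =>
    intro nt M c h1 h2 h
    exact ih nt (M + 1) (fun j => c (j + 1)) h1 h2 (num_step (k + 2) M nt c h)

open Filter Topology in
lemma choose_lim (k c : ℕ) : Tendsto (fun n : ℕ => ((n + c).choose k : ℝ) / (n : ℝ) ^ k) atTop (𝓝 (1 / k.factorial)) := by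
  have hk : (k.factorial : ℝ) ≠ 0 := by exact_mod_cast k.factorial_ne_zero
  have h0 := isEquivalent_choose k
  have hne : ∀ᶠ n : ℕ in atTop, ((n : ℝ) ^ k / k.factorial) ≠ 0 := by
    filter_upwards [eventually_gt_atTop 0] with n hn
    have : (n : ℝ) ≠ 0 := by exact_mod_cast hn.ne'
    positivity
  have h1 := (Asymptotics.isEquivalent_iff_tendsto_one hne).1 h0
  have h2 := h1.comp (tendsto_add_atTop_nat c)
  have h3 : Tendsto (fun n : ℕ => (((n + c : ℕ) : ℝ) / n) ^ k) atTop (𝓝 (1 ^ k)) := by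
    refine Tendsto.pow ?_ k
    have h4 : Tendsto (fun n : ℕ => 1 + (c : ℝ) / n) atTop (𝓝 (1 + 0)) :=
      tendsto_const_nhds.add (tendsto_const_div_atTop_nhds_zero_nat (c : ℝ))
    rw [add_zero] at h4
    refine h4.congr' ?_
    filter_upwards [eventually_gt_atTop 0] with n hn
    have : (n : ℝ) ≠ 0 := by exact_mod_cast hn.ne'
    push_cast
    field_simp
  have h5 := (h2.mul h3).mul_const (1 / (k.factorial : ℝ))
  rw [one_pow, one_mul, one_mul] at h5
  refine h5.congr' ?_
  filter_upwards [eventually_gt_atTop 0] with n hn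
  have h6 : (n : ℝ) ≠ 0 := by exact_mod_cast hn.ne'
  have h7 : ((n + c : ℕ) : ℝ) ≠ 0 := by exact_mod_cast (by omega : n + c ≠ 0)
  simp only [Function.comp, Pi.div_apply]
  rw [div_pow]
  field_simp

open Filter Topology in
lemma choose_lim0 {j k : ℕ} (h : j < k) (c : ℕ) : Tendsto (fun n : ℕ => ((n + c).choose j : ℝ) / (n : ℝ) ^ k) atTop (𝓝 0) := by
  obtain ⟨l, rfl⟩ : ∃ l, k = j + (l + 1) := ⟨k - j - 1, by omega⟩
  have h1 := choose_lim j c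
  have h2 : Tendsto (fun n : ℕ => ((n : ℝ) ^ (l + 1))⁻¹) atTop (𝓝 0) :=
    (tendsto_pow_atTop (by omega)).comp tendsto_natCast_atTop_atTop |>.inv_tendsto_atTop
  have h3 := h1.mul h2
  rw [mul_zero] at h3
  refine h3.congr fun n => ?_
  rw [pow_add _ j, div_mul_eq_div_div, div_eq_mul_inv (_ / _)]

open Filter Topology in
lemma sum_lim (k p N : ℕ) (c : ℕ → ℤ) (s : ℕ → ℤ)
    (h : ∀ n ≥ N, s n = ∑ j ∈ Finset.range (k + 1), c j * ((n + j).choose j : ℤ)) :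
    Tendsto (fun m : ℕ => (s (m + p) : ℝ) / (m : ℝ) ^ k) atTop (𝓝 (c k / k.factorial)) := by
  have h1 : Tendsto (fun m : ℕ => ∑ j ∈ Finset.range (k + 1), (c j : ℝ) * (((m + (p + j)).choose j : ℝ) / (m : ℝ) ^ k)) atTop
      (𝓝 (∑ j ∈ Finset.range (k + 1), (c j : ℝ) * (if j = k then 1 / (k.factorial : ℝ) else 0))) := by
    refine tendsto_finsetSum _ fun j hj => Tendsto.const_mul _ ?_
    split_ifs with hjk
    · subst hjk; exact choose_lim _ _
    · exact choose_lim0 (by rw [Finset.mem_range] at hj; omega) _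
  have h2 : (∑ j ∈ Finset.range (k + 1), (c j : ℝ) * (if j = k then 1 / (k.factorial : ℝ) else 0)) = c k / k.factorial := by
    rw [Finset.sum_eq_single k]
    · simp; rfl
    · intro b _ hb; simp [hb]
    · simp
  rw [h2] at h1
  refine h1.congr' ?_
  filter_upwards [eventually_ge_atTop N] with m hm
  rw [h (m + p) (by omega)]
  push_cast
  rw [Finset.sum_div]
  refine Finset.sum_congr rfl fun j _ => ?_
  rw [add_assoc, mul_div_assoc]

open Filter Topology in
lemma num_contra (k p N : ℕ) (c : ℕ → ℤ) (s : ℕ → ℕ)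
    (h : ∀ n ≥ N, (s n : ℤ) = ∑ j ∈ Finset.range (k + 1), c j * ((n + j).choose j : ℤ)) (hc : c k = 1) (c1 c2 : ℕ)
    (hs : ∀ m, (m + c1).choose k + (m + c2).choose k ≤ s (m + p)) : False := by
  have h1 := sum_lim k p N c (fun n => s n) h
  have h2 := (choose_lim k c1).add (choose_lim k c2)
  have h3 := le_of_tendsto_of_tendsto h2 h1 (Eventually.of_forall fun m => by
    beta_reduce
    rw [← add_div]
    have h4 : ((m + c1).choose k : ℝ) + (m + c2).choose k ≤ s (m + p) := by exact_mod_cast hs m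
    push_cast
    exact div_le_div_of_nonneg_right h4 (by positivity))
  rw [hc] at h3
  have hk : (0 : ℝ) < 1 / k.factorial := by positivity
  push_cast at h3
  linarith

open Filter Topology in
lemma num_ne (k N : ℕ) (c : ℕ → ℤ) (s : ℕ → ℕ)
    (h : ∀ n ≥ N, (s n : ℤ) = ∑ j ∈ Finset.range (k + 1), c j * ((n + j).choose j : ℤ)) (hc : c k = 1)
    (hs : ∀ n, s n = 0) : False := by
  have h1 := sum_lim k 0 N c (fun n => s n) h
  simp only [hs] at h1
  have hk : (0 : ℝ) < 1 / k.factorial := by positivity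
  have h0 : Tendsto (fun m : ℕ => (((0 : ℕ) : ℤ) : ℝ) / (m : ℝ) ^ k) atTop (𝓝 0) := by
    have : (fun m : ℕ => (((0 : ℕ) : ℤ) : ℝ) / (m : ℝ) ^ k) = fun _ => 0 := by funext m; simp
    rw [this]; exact tendsto_const_nhds
  have h2 := tendsto_nhds_unique h1 h0
  rw [hc] at h2
  push_cast at h2
  linarith

open Filter Topology in
lemma num_e0 (k N κ e0 : ℕ) (c : ℕ → ℤ) (L : ℕ → ℕ)
    (h : ∀ n ≥ N, (L n : ℤ) = ∑ j ∈ Finset.range (k + 1), c j * ((n + j).choose j : ℤ))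
    (h1 : ∀ n, L n ≤ (n + k).choose k * e0) (h2 : ∀ n, (n + k).choose k * e0 ≤ L (n + κ)) : c k = e0 := by
  have a1 := sum_lim k 0 N c (fun n => L n) h
  have a2 := sum_lim k κ N c (fun n => L n) h
  have a3 := (choose_lim k k).mul_const (e0 : ℝ)
  have b1 := le_of_tendsto_of_tendsto a1 a3 (Eventually.of_forall fun m => by
    have h4 : (L m : ℝ) ≤ (m + k).choose k * e0 := by exact_mod_cast h1 m
    beta_reduce
    rw [div_mul_eq_mul_div]
    push_cast
    exact div_le_div_of_nonneg_right h4 (by positivity))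
  have b2 := le_of_tendsto_of_tendsto a3 a2 (Eventually.of_forall fun m => by
    have h4 : ((m + k).choose k * e0 : ℝ) ≤ L (m + κ) := by exact_mod_cast h2 m
    beta_reduce
    rw [div_mul_eq_mul_div]
    push_cast
    exact div_le_div_of_nonneg_right h4 (by positivity))
  have hk : (0 : ℝ) < k.factorial := by positivity
  have b3 : (c k : ℝ) / k.factorial = e0 / k.factorial := by
    apply le_antisymm
    · rw [div_mul_eq_mul_div, one_mul] at b1; exact b1
    · rw [div_mul_eq_mul_div, one_mul] at b2; exact b2
  rw [div_left_inj' hk.ne'] at b3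
  exact_mod_cast b3


-- part 16

/-! ## P16 : counting lemmas -/

lemma length_le_of_ker [CommRing R] {P M N : Type*} [AddCommGroup P] [Module R P] [AddCommGroup M] [Module R M]
    [AddCommGroup N] [Module R N] (φ : P →ₗ[R] M) (π : P →ₗ[R] N) (h : LinearMap.ker φ ≤ LinearMap.ker π)
    (hπ : Function.Surjective π) : Module.length R N ≤ Module.length R M := by
  have h1 : Module.length R N = Module.length R (P ⧸ LinearMap.ker π) :=
    (LinearEquiv.length_eq (LinearMap.quotKerEquivOfSurjective π hπ)).symm
  rw [h1]
  refine (Module.length_le_of_surjective (Submodule.factor h) (Submodule.factor_surjective h)).trans ?_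
  exact Module.length_le_of_injective ((LinearMap.ker φ).liftQ φ le_rfl) (by
    rw [← LinearMap.ker_eq_bot]; exact Submodule.ker_liftQ_eq_bot _ _ _ le_rfl)

section alg
variable [CommRing R] [IsLocalRing R] [IsNoetherianRing R] {d : ℕ} {J : Ideal R} {z : Fin d → R}

/-- polynomial of degree `a` with given coefficients -/
noncomputable def polOf (d a : ℕ) (v : ((Finset.univ : Finset (Fin d)).finsuppAntidiag a) → R) : MvPolynomial (Fin d) R :=
  ∑ m : ((Finset.univ : Finset (Fin d)).finsuppAntidiag a), MvPolynomial.monomial m.1 (v m)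

lemma polOf_coeff (d a : ℕ) (v : ((Finset.univ : Finset (Fin d)).finsuppAntidiag a) → R) (m) :
    (polOf d a v).coeff m.1 = v m := by
  classical
  simp only [polOf]; rw [MvPolynomial.coeff_sum]
  simp only [MvPolynomial.coeff_monomial]
  rw [Finset.sum_eq_single m]
  · simp
  · intro b _ hb; rw [if_neg]; intro h; exact hb (Subtype.ext h)
  · simp

lemma mem_anti_iff (d a : ℕ) (m : Fin d →₀ ℕ) : m ∈ ((Finset.univ : Finset (Fin d)).finsuppAntidiag a) ↔ m.degree = a := by
  rw [Finset.mem_finsuppAntidiag, Finsupp.degree_eq_sum]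
  simp

lemma polOf_hom (d a : ℕ) (v : ((Finset.univ : Finset (Fin d)).finsuppAntidiag a) → R) :
    (polOf d a v).IsHomogeneous a := by
  refine MvPolynomial.IsHomogeneous.sum _ _ _ fun m _ => ?_
  exact MvPolynomial.isHomogeneous_monomial _ ((mem_anti_iff d a m.1).1 m.2)

lemma polOf_self {a : ℕ} {f : MvPolynomial (Fin d) R} (hf : f.IsHomogeneous a) :
    polOf d a (fun m => f.coeff m.1) = f := by
  ext m
  by_cases hm : m.degree = a
  · exact polOf_coeff d a _ ⟨m, (mem_anti_iff d a m).2 hm⟩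
  · rw [(polOf_hom d a _).coeff_eq_zero hm, hf.coeff_eq_zero hm]

lemma card_anti (d a : ℕ) : Fintype.card ((Finset.univ : Finset (Fin d)).finsuppAntidiag a) = (d + a - 1).choose a := by
  rw [Fintype.card_coe, Finset.card_finsuppAntidiag_nat_eq_choose]
  simp

/-- the map `v ↦ f_v τ` -/
noncomputable def polMap (d a : ℕ) (z : Fin d → R) (N : Ideal R) (τ : R)
    (hN : ∀ f : MvPolynomial (Fin d) R, f.IsHomogeneous a → MvPolynomial.eval z f * τ ∈ N) :
    (((Finset.univ : Finset (Fin d)).finsuppAntidiag a) → R) →ₗ[R] N where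
  toFun v := ⟨MvPolynomial.eval z (polOf d a v) * τ, hN _ (polOf_hom d a v)⟩
  map_add' v w := by
    apply Subtype.ext
    have : polOf d a (v + w) = polOf d a v + polOf d a w := by
      simp only [polOf, Pi.add_apply, map_add, Finset.sum_add_distrib]
    simp only [this, map_add, add_mul]; rfl
  map_smul' r v := by
    apply Subtype.ext
    have : polOf d a (r • v) = MvPolynomial.C r * polOf d a v := by
      simp only [polOf, Finset.mul_sum, MvPolynomial.C_mul_monomial]; rfl
    simp only [this, map_mul, MvPolynomial.eval_C, mul_assoc]; rfl

/-- reduction of coefficients -/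
noncomputable def resMap (R : Type*) [CommRing R] [IsLocalRing R] (d a : ℕ) :
    (((Finset.univ : Finset (Fin d)).finsuppAntidiag a) → R) →ₗ[R]
    (((Finset.univ : Finset (Fin d)).finsuppAntidiag a) → ResidueField R) :=
  (Algebra.linearMap R (ResidueField R)).compLeft _

lemma resMap_apply (d a : ℕ) (v) (m) : resMap R d a v m = residue R (v m) := rfl

lemma resMap_surj (d a : ℕ) : Function.Surjective (resMap R d a) := by
  intro w
  choose v hv using fun m => residue_surjective (w m)
  exact ⟨v, funext hv⟩

lemma mem_ker_resMap (d a : ℕ) (v) : v ∈ LinearMap.ker (resMap R d a) ↔ MvPolynomial.map (residue R) (polOf d a v) = 0 := by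
  rw [LinearMap.mem_ker]
  constructor
  · intro h
    ext m
    rw [MvPolynomial.coeff_map, MvPolynomial.coeff_zero]
    by_cases hm : m.degree = a
    · rw [polOf_coeff d a v ⟨m, (mem_anti_iff d a m).2 hm⟩, ← resMap_apply, h]; rfl
    · rw [(polOf_hom d a _).coeff_eq_zero hm, map_zero]
  · intro h
    funext m
    rw [resMap_apply, ← polOf_coeff d a v m, ← MvPolynomial.coeff_map, h]; rfl

lemma length_resTarget (d a : ℕ) : Module.length R (((Finset.univ : Finset (Fin d)).finsuppAntidiag a) → ResidueField R) =
    ((d + a - 1).choose a : ℕ) := by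
  rw [Module.length_pi, length_residue, mul_one, ENat.card_eq_coe_fintype_card, card_anti]

lemma count_le (z : Fin d → R) (a : ℕ) (N K : Ideal R) (τ : R)
    (hN : ∀ f : MvPolynomial (Fin d) R, f.IsHomogeneous a → MvPolynomial.eval z f * τ ∈ N)
    (hK : ∀ f : MvPolynomial (Fin d) R, f.IsHomogeneous a → MvPolynomial.eval z f * τ ∈ K → MvPolynomial.map (residue R) f = 0) :
    (((d + a - 1).choose a : ℕ) : ℕ∞) ≤ ilen N K := by
  rw [← length_resTarget (R := R)]
  refine length_le_of_ker ((Submodule.mkQ _).comp (polMap d a z N τ hN)) (resMap R d a) ?_ (resMap_surj d a)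
  intro v hv
  rw [mem_ker_resMap]
  rw [LinearMap.mem_ker, LinearMap.comp_apply, Submodule.mkQ_apply, Submodule.Quotient.mk_eq_zero] at hv
  exact hK _ (polOf_hom d a v) hv

lemma le_count (z : Fin d → R) (a : ℕ) (N K : Ideal R) (τ : R)
    (hN : ∀ f : MvPolynomial (Fin d) R, f.IsHomogeneous a → MvPolynomial.eval z f * τ ∈ N)
    (hNK : ∀ x ∈ N, ∃ f : MvPolynomial (Fin d) R, f.IsHomogeneous a ∧ x - MvPolynomial.eval z f * τ ∈ K)
    (hK : ∀ f : MvPolynomial (Fin d) R, f.IsHomogeneous a → MvPolynomial.map (residue R) f = 0 → MvPolynomial.eval z f * τ ∈ K) :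
    ilen N K ≤ (((d + a - 1).choose a : ℕ) : ℕ∞) := by
  rw [← length_resTarget (R := R)]
  refine length_le_of_ker (resMap R d a) ((Submodule.mkQ _).comp (polMap d a z N τ hN)) ?_ ?_
  · intro v hv
    rw [mem_ker_resMap] at hv
    rw [LinearMap.mem_ker, LinearMap.comp_apply, Submodule.mkQ_apply, Submodule.Quotient.mk_eq_zero]
    exact hK _ (polOf_hom d a v) hv
  · intro y
    obtain ⟨⟨x, hx⟩, rfl⟩ := Submodule.mkQ_surjective _ y
    obtain ⟨f, hf, h⟩ := hNK x hx
    refine ⟨fun m => f.coeff m.1, ?_⟩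
    rw [LinearMap.comp_apply, Submodule.mkQ_apply, Submodule.mkQ_apply, eq_comm, Submodule.Quotient.eq]
    change x - MvPolynomial.eval z (polOf d a (fun m => f.coeff m.1)) * τ ∈ K
    rw [polOf_self hf]; exact h

end alg


-- part 17

/-! ## P17 : structure of the Sally-type module -/

lemma top_mul {k : Type*} [Field k] {d a : ℕ} {f h u : MvPolynomial (Fin d) k} (hf : f.IsHomogeneous a) (hf0 : f ≠ 0)
    (hfu : f = h * u) : h.totalDegree + u.totalDegree = a ∧
      f = h.homogeneousComponent h.totalDegree * u.homogeneousComponent u.totalDegree := by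
  have hh : h ≠ 0 := by rintro rfl; exact hf0 (by rw [hfu, zero_mul])
  have hu : u ≠ 0 := by rintro rfl; exact hf0 (by rw [hfu, mul_zero])
  have h1 : h.totalDegree + u.totalDegree = a := by
    rw [← MvPolynomial.totalDegree_mul_of_isDomain hh hu, ← hfu, hf.totalDegree hf0]
  refine ⟨h1, ?_⟩
  have h2 : MvPolynomial.homogeneousComponent a f = f := by
    rw [MvPolynomial.homogeneousComponent_of_mem hf, if_pos rfl]
  rw [← h2, hfu]
  conv_lhs => rw [← MvPolynomial.sum_homogeneousComponent h, Finset.sum_mul, map_sum]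
  rw [Finset.sum_eq_single h.totalDegree]
  · rw [homComp_mul_of_le (MvPolynomial.homogeneousComponent_isHomogeneous _ _) (by omega)]
    rw [show a - h.totalDegree = u.totalDegree by omega]
  · intro i hi hne
    rw [Finset.mem_range] at hi
    rw [homComp_mul_of_le (MvPolynomial.homogeneousComponent_isHomogeneous _ _) (by omega),
      MvPolynomial.homogeneousComponent_eq_zero _ u (by omega), mul_zero]
  · intro h; simp at h

lemma exists_lift_hom [CommRing R] [IsLocalRing R] {d b : ℕ} {a : MvPolynomial (Fin d) (ResidueField R)} (ha : a.IsHomogeneous b) :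
    ∃ F : MvPolynomial (Fin d) R, F.IsHomogeneous b ∧ MvPolynomial.map (residue R) F = a := by
  obtain ⟨G, rfl⟩ := MvPolynomial.map_surjective (residue R) residue_surjective a
  refine ⟨G.homogeneousComponent b, MvPolynomial.homogeneousComponent_isHomogeneous _ _, ?_⟩
  rw [homComp_map, MvPolynomial.homogeneousComponent_of_mem ha, if_pos rfl]

section alg
variable [CommRing R] [IsLocalRing R] [IsNoetherianRing R] {d : ℕ} {J : Ideal R} {z : Fin d → R}

lemma J_le_B (J : Ideal R) : J ≤ vge J 1 := by
  have := pow_le_vge (J := J) 1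
  rwa [pow_one, Nat.cast_one] at this

lemma pow_mul_B_le (J : Ideal R) (n : ℕ) : J ^ n * vge J 1 ≤ vge J ((n : ℝ) + 1) :=
  Ideal.mul_le.2 fun _ hr _ ht => mul_mem_vge (pow_le_vge n hr) ht

lemma QSetup.eval_mul_mem (qs : QSetup R d J z) {f : MvPolynomial (Fin d) R} {a p : ℕ} (hf : f.IsHomogeneous a) {τ : R}
    (hτ : τ ∈ J ^ p * vge J 1) : MvPolynomial.eval z f * τ ∈ J ^ (p + a) * vge J 1 := by
  rw [add_comm, pow_add, mul_assoc]
  exact Ideal.mul_mem_mul (qs.eval_mem_pow hf) hτ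

lemma QSetup.eval_mul_vge (qs : QSetup R d J z) {f : MvPolynomial (Fin d) R} {a p : ℕ} (hf : f.IsHomogeneous a) {τ : R}
    (hτ : τ ∈ vge J ((p : ℝ) + 1)) : MvPolynomial.eval z f * τ ∈ vge J (((p + a : ℕ) : ℝ) + 1) := by
  have := mul_mem_vge (pow_le_vge a (qs.eval_mem_pow hf)) hτ
  convert this using 1
  push_cast; ring_nf

lemma choose_comm' (hd : 0 < d) (a c : ℕ) : (d + (a + c) - 1).choose (a + c) = (a + (c + (d - 1))).choose (d - 1) := by
  rw [show d + (a + c) - 1 = (a + c) + (d - 1) by omega, Nat.choose_symm_add]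
  congr 1; omega

lemma two_count (qs : QSetup R d J z) (hd : 0 < d) {p q : ℕ} {σ τ : R} (a b n : ℕ) (hpa : p + a = n) (hqb : q + b = n)
    (hσ : σ ∈ vge J ((p : ℝ) + 1)) (hτ : τ ∈ vge J ((q : ℝ) + 1)) (hσ' : σ ∉ J ^ p * vge J 1)
    (h : ∀ f g : MvPolynomial (Fin d) R, f.IsHomogeneous a → g.IsHomogeneous b →
      MvPolynomial.eval z f * σ - MvPolynomial.eval z g * τ ∈ J ^ n * vge J 1 → MvPolynomial.map (residue R) g = 0) :
    (((d + a - 1).choose a + (d + b - 1).choose b : ℕ) : ℕ∞) ≤ ilen (vge J ((n : ℝ) + 1)) (J ^ n * vge J 1) := by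
  have hσn : ∀ f : MvPolynomial (Fin d) R, f.IsHomogeneous a → MvPolynomial.eval z f * σ ∈ vge J ((n : ℝ) + 1) := by
    intro f hf; rw [← hpa]; exact qs.eval_mul_vge hf hσ
  have hτn : ∀ f : MvPolynomial (Fin d) R, f.IsHomogeneous b → MvPolynomial.eval z f * τ ∈ vge J ((n : ℝ) + 1) := by
    intro f hf; rw [← hqb]; exact qs.eval_mul_vge hf hτ
  let K1 : Ideal R := J ^ a * Ideal.span {σ} ⊔ J ^ n * vge J 1
  have hK1 : K1 ≤ vge J ((n : ℝ) + 1) := by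
    refine sup_le (Ideal.mul_le.2 fun r hr s hs => ?_) (pow_mul_B_le J n)
    obtain ⟨c, rfl⟩ := Ideal.mem_span_singleton'.1 hs
    obtain ⟨f, hf, rfl⟩ := qs.exists_form_pow hr
    rw [show MvPolynomial.eval z f * (c * σ) = c * (MvPolynomial.eval z f * σ) by ring]
    exact Ideal.mul_mem_left _ _ (hσn f hf)
  rw [ilen_add (le_sup_right : _ ≤ K1) hK1]
  push_cast
  refine add_le_add (count_le z a _ _ σ ?_ ?_) (count_le z b _ _ τ hτn ?_)
  · intro f hf
    exact Ideal.mem_sup_left (Ideal.mul_mem_mul (qs.eval_mem_pow hf) (Ideal.mem_span_singleton_self σ))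
  · intro f hf h1
    by_contra hc
    rw [← hpa] at h1
    exact hσ' (qs.cancel (J_le_B J) hf hc h1)
  · intro g hg h1
    obtain ⟨x, hx, y, hy, hxy⟩ := Submodule.mem_sup.1 h1
    obtain ⟨w, hw, rfl⟩ := Ideal.mem_mul_span_singleton.1 hx
    obtain ⟨f, hf, rfl⟩ := qs.exists_form_pow hw
    refine h f g hf hg ?_
    rw [← hxy]
    have : MvPolynomial.eval z f * σ - (MvPolynomial.eval z f * σ + y) = -y := by ring
    rw [this]; exact Ideal.neg_mem_iff _ |>.2 hy

/-- numerical input -/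
structure SData (J : Ideal R) (d : ℕ) (s : ℕ → ℕ) (c : ℕ → ℤ) (N : ℕ) : Prop where
  hs : ∀ n : ℕ, ilen (vge J ((n : ℝ) + 1)) (J ^ n * vge J 1) = (s n : ℕ∞)
  hc : ∀ n ≥ N, (s n : ℤ) = ∑ j ∈ Finset.range (d - 1 + 1), c j * ((n + j).choose j : ℤ)
  hk : c (d - 1) = 1

variable {s : ℕ → ℕ} {c : ℕ → ℤ} {N : ℕ}

lemma SData.kill (sd : SData J d s c N) (qs : QSetup R d J z) (hd : 0 < d) {p : ℕ} {τ : R} (hτ : τ ∈ vge J ((p : ℝ) + 1))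
    {r : R} (hr : r ∈ maximalIdeal R) : r * τ ∈ J ^ p * vge J 1 := by
  by_contra hcon
  refine num_contra (d - 1) p N c s sd.hc sd.hk (d - 1) (d - 1) fun m => ?_
  have h := two_count qs hd (σ := r * τ) (τ := τ) (p := p) (q := p) m m (m + p) (by ring) (by ring)
    (Ideal.mul_mem_left _ _ hτ) hτ hcon ?_
  · rw [sd.hs] at h
    have h2 := choose_comm' (d := d) hd m 0
    simp only [add_zero, zero_add] at h2
    rw [h2] at h
    exact_mod_cast h
  · intro f g hf hg h1
    by_contra hc
    have h2 : MvPolynomial.eval z (g - MvPolynomial.C r * f) * τ ∈ J ^ (p + m) * vge J 1 := by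
      rw [add_comm p m]
      have : MvPolynomial.eval z (g - MvPolynomial.C r * f) * τ = -(MvPolynomial.eval z f * (r * τ) - MvPolynomial.eval z g * τ) := by
        rw [map_sub, map_mul, MvPolynomial.eval_C]; ring
      rw [this]; exact Ideal.neg_mem_iff _ |>.2 h1
    have h3 := qs.cancel (J_le_B J) (hg.sub (by simpa using (MvPolynomial.isHomogeneous_C (Fin d) r).mul hf)) ?_ h2
    · exact hcon (Ideal.mul_mem_left _ _ h3)
    · rw [map_sub, map_mul, MvPolynomial.map_C, (residue_eq_zero_iff r).2 hr, MvPolynomial.C_0, zero_mul, sub_zero]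
      exact hc

lemma SData.kill_form (sd : SData J d s c N) (qs : QSetup R d J z) (hd : 0 < d) {p a : ℕ} {τ : R} (hτ : τ ∈ vge J ((p : ℝ) + 1))
    {f : MvPolynomial (Fin d) R} (hf : f.IsHomogeneous a) (hf0 : MvPolynomial.map (residue R) f = 0) :
    MvPolynomial.eval z f * τ ∈ J ^ (p + a) * vge J 1 := by
  have h1 := qs.eval_mem hf (map_residue_eq_zero_iff.1 hf0)
  have h2 := Ideal.mul_mem_mul h1 (Ideal.mem_span_singleton_self τ)
  refine (?_ : J ^ a * maximalIdeal R * Ideal.span {τ} ≤ _) h2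
  rw [add_comm p a, pow_add, mul_assoc, mul_assoc]
  refine Ideal.mul_mono le_rfl (Ideal.mul_le.2 fun r hr x hx => ?_)
  obtain ⟨w, rfl⟩ := Ideal.mem_span_singleton'.1 hx
  rw [show r * (w * τ) = w * (r * τ) by ring]
  exact Ideal.mul_mem_left _ _ (sd.kill qs hd hτ hr)

lemma SData.rel (sd : SData J d s c N) (qs : QSetup R d J z) (hd : 0 < d) {p q : ℕ} {σ τ : R}
    (hσ : σ ∈ vge J ((p : ℝ) + 1)) (hτ : τ ∈ vge J ((q : ℝ) + 1)) (hσ' : σ ∉ J ^ p * vge J 1)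
    (hτ' : τ ∉ J ^ q * vge J 1) :
    ∃ a b, p + a = q + b ∧ ∃ f g : MvPolynomial (Fin d) R, f.IsHomogeneous a ∧ g.IsHomogeneous b ∧
      MvPolynomial.map (residue R) f ≠ 0 ∧ MvPolynomial.map (residue R) g ≠ 0 ∧
      MvPolynomial.eval z f * σ - MvPolynomial.eval z g * τ ∈ J ^ (p + a) * vge J 1 := by
  by_contra! hcon
  refine num_contra (d - 1) (p + q) N c s sd.hc sd.hk (q + (d - 1)) (p + (d - 1)) fun m => ?_
  have h := two_count qs hd (σ := σ) (τ := τ) (p := p) (q := q) (m + q) (m + p) (m + (p + q)) (by ring) (by ring)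
    hσ hτ hσ' ?_
  · rw [sd.hs, choose_comm' hd, choose_comm' hd] at h
    exact_mod_cast h
  · intro f g hf hg h1
    by_contra hg0
    have hpq : p + (m + q) = q + (m + p) := by ring
    rw [show m + (p + q) = q + (m + p) by ring] at h1
    by_cases hf0 : MvPolynomial.map (residue R) f = 0
    · have h2 := sd.kill_form qs hd hσ hf hf0
      rw [hpq] at h2
      have h3 : MvPolynomial.eval z g * τ ∈ J ^ (q + (m + p)) * vge J 1 := by
        have := Ideal.sub_mem _ h2 h1
        rwa [sub_sub_cancel] at this
      exact hτ' (qs.cancel (J_le_B J) hg hg0 h3)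
    · exact hcon _ _ hpq f g hf hg hf0 hg0 (by rw [hpq]; exact h1)

lemma SData.rel_prime (sd : SData J d s c N) (qs : QSetup R d J z) (hd : 0 < d) {p q : ℕ} {σ τ : R}
    (hσ : σ ∈ vge J ((p : ℝ) + 1)) (hτ : τ ∈ vge J ((q : ℝ) + 1)) (hσ' : σ ∉ J ^ p * vge J 1)
    (hτ' : τ ∉ J ^ q * vge J 1) :
    ∃ a b, p + a = q + b ∧ ∃ f g : MvPolynomial (Fin d) R, f.IsHomogeneous a ∧ g.IsHomogeneous b ∧
      MvPolynomial.map (residue R) f ≠ 0 ∧ MvPolynomial.map (residue R) g ≠ 0 ∧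
      IsRelPrime (MvPolynomial.map (residue R) f) (MvPolynomial.map (residue R) g) ∧
      MvPolynomial.eval z f * σ - MvPolynomial.eval z g * τ ∈ J ^ (p + a) * vge J 1 := by
  classical
  have hex := sd.rel qs hd hσ hτ hσ' hτ'
  obtain ⟨b, hab, f, g, hf, hg, hf0, hg0, hrel⟩ := Nat.find_spec hex
  have hmin := fun {m} => Nat.find_min hex (m := m)
  set a := Nat.find hex with ha
  refine ⟨a, b, hab, f, g, hf, hg, hf0, hg0, ?_, hrel⟩
  rintro h ⟨u, hu⟩ ⟨v, hv⟩
  by_contra hunit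
  obtain ⟨d1, t1⟩ := top_mul (hf.map _) hf0 hu
  obtain ⟨d2, t2⟩ := top_mul (hg.map _) hg0 hv
  have hh0 : h ≠ 0 := by rintro rfl; exact hf0 (by rw [hu, zero_mul])
  have hdeg : 0 < h.totalDegree := by
    rw [Nat.pos_iff_ne_zero]
    intro h0
    rw [MvPolynomial.totalDegree_eq_zero_iff_eq_C] at h0
    apply hunit
    rw [h0]
    refine IsUnit.map MvPolynomial.C (isUnit_iff_ne_zero.2 ?_)
    intro h1; rw [h1, map_zero] at h0; exact hh0 h0
  obtain ⟨H, hH, eH⟩ := exists_lift_hom (MvPolynomial.homogeneousComponent_isHomogeneous h.totalDegree h)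
  obtain ⟨U, hU, eU⟩ := exists_lift_hom (MvPolynomial.homogeneousComponent_isHomogeneous u.totalDegree u)
  obtain ⟨V, hV, eV⟩ := exists_lift_hom (MvPolynomial.homogeneousComponent_isHomogeneous v.totalDegree v)
  rw [← eH, ← eU] at t1
  rw [← eH, ← eV] at t2
  have hU0 : MvPolynomial.map (residue R) U ≠ 0 := fun h => hf0 (by rw [t1, h, mul_zero])
  have hV0 : MvPolynomial.map (residue R) V ≠ 0 := fun h => hg0 (by rw [t2, h, mul_zero])
  have hH0 : MvPolynomial.map (residue R) H ≠ 0 := fun h => hf0 (by rw [t1, h, zero_mul])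
  refine hmin (m := u.totalDegree) (by omega) ⟨v.totalDegree, by omega, U, V, hU, hV, hU0, hV0, ?_⟩
  have k1 := sd.kill_form qs hd hσ (f := H * U - f) (a := a) ((by rw [← d1]; exact hH.mul hU : (H * U).IsHomogeneous a).sub hf)
    (by rw [map_sub, map_mul, t1, sub_self])
  have k2 := sd.kill_form qs hd hτ (f := H * V - g) (a := b) ((by rw [← d2]; exact hH.mul hV : (H * V).IsHomogeneous b).sub hg)
    (by rw [map_sub, map_mul, t2, sub_self])
  rw [← hab] at k2
  refine qs.cancel (J_le_B J) hH hH0 ?_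
  rw [show p + u.totalDegree + h.totalDegree = p + a by omega]
  have := Ideal.sub_mem _ (Ideal.add_mem _ hrel k1) k2
  convert this using 1
  rw [map_sub, map_sub, map_mul, map_mul]; ring

lemma SData.exists_rho (sd : SData J d s c N) (qs : QSetup R d J z) (hd : 0 < d) {p q : ℕ} {σ τ : R}
    (hmin : ∀ n < p, vge J ((n : ℝ) + 1) ≤ J ^ n * vge J 1)
    (hσ : σ ∈ vge J ((p : ℝ) + 1)) (hτ : τ ∈ vge J ((q : ℝ) + 1)) (hσ' : σ ∉ J ^ p * vge J 1) (hpq : p ≤ q) :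
    ∃ f : MvPolynomial (Fin d) R, f.IsHomogeneous (q - p) ∧ τ - MvPolynomial.eval z f * σ ∈ J ^ q * vge J 1 := by
  by_cases hτ' : τ ∈ J ^ q * vge J 1
  · exact ⟨0, MvPolynomial.isHomogeneous_zero _ _ _, by simpa using hτ'⟩
  obtain ⟨a, b, hab, f, g, hf, hg, hf0, hg0, hfg, hrel⟩ := sd.rel_prime qs hd hσ hτ hσ' hτ'
  obtain ⟨ρ, h1, h2⟩ := qs.coprime (J_le_B J) hf hg hf0 hg0 hfg hab hrel
  have hb : b ≤ p := by
    by_contra hc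
    apply hσ'
    have h3 : MvPolynomial.eval z g * ρ ∈ J ^ p * vge J 1 := by
      refine Ideal.mul_mem_right _ _ ?_
      have := Ideal.pow_le_pow_right (by omega : p + 1 ≤ b) (qs.eval_mem_pow hg)
      rw [pow_succ] at this
      exact Ideal.mul_mono le_rfl (J_le_B J) this
    have := Ideal.add_mem _ h1 h3
    rwa [sub_add_cancel] at this
  have hρ : ρ ∈ vge J (((p - b : ℕ) : ℝ) + 1) := by
    refine qs.vge_cancel hg hg0 ?_
    have h3 := Ideal.sub_mem _ hσ (pow_mul_B_le J p h1)
    rw [sub_sub_cancel] at h3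
    convert h3 using 1
    rw [Nat.cast_sub hb]; congr 1; ring
  have hb0 : b = 0 := by
    by_contra hb0
    have h3 := hmin (p - b) (by omega) hρ
    have h4 := qs.eval_mul_mem hg h3
    rw [Nat.sub_add_cancel hb] at h4
    have := Ideal.add_mem _ h1 h4
    rw [sub_add_cancel] at this
    exact hσ' this
  subst hb0
  have hgC := MvPolynomial.totalDegree_eq_zero_iff_eq_C.1 (Nat.le_zero.1 hg.totalDegree_le)
  set w := MvPolynomial.coeff 0 g
  have hw : IsUnit w := by
    by_contra hc
    have : w ∈ maximalIdeal R := hc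
    apply hg0
    rw [hgC, MvPolynomial.map_C, (residue_eq_zero_iff w).2 this, map_zero]
  obtain ⟨w', hw'⟩ := hw.exists_left_inv
  have ha : a = q - p := by omega
  subst ha
  refine ⟨MvPolynomial.C w' * f, by simpa using (MvPolynomial.isHomogeneous_C (Fin d) w').mul hf, ?_⟩
  have h5 := qs.eval_mul_mem hf h1
  rw [show p + (q - p) = q by omega] at h5
  have h6 : τ - MvPolynomial.eval z (MvPolynomial.C w' * f) * σ =
      (τ - MvPolynomial.eval z f * ρ) - w' * (MvPolynomial.eval z f * (σ - MvPolynomial.eval z g * ρ)) := by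
    have : MvPolynomial.eval z g = w := by rw [hgC, MvPolynomial.eval_C]
    rw [map_mul, MvPolynomial.eval_C, this]
    linear_combination (-MvPolynomial.eval z f * ρ) * hw'
  rw [h6]
  exact Ideal.sub_mem _ h2 (Ideal.mul_mem_left _ _ h5)

end alg


-- part 18

section hilb
variable [CommRing R] [IsLocalRing R] [IsNoetherianRing R] {J : Ideal R}

lemma exists_sdata {k : ℕ} {z : Fin (k + 3) → R} (qs : QSetup R (k + 3) J z) (hAU : AnalyticallyUnramified R)
    (L : ℕ → ℕ) (e : ℕ → ℤ) (hL : ∀ n : ℕ, Module.length R (R ⧸ vge J ((n : ℝ) + 1)) = (L n : ℕ∞))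
    (N : ℕ) (hN : ∀ n ≥ N, (L n : ℤ) =
      ∑ i ∈ Finset.range (k + 3 + 1), (-1 : ℤ) ^ i * e i * ((n + (k + 3) - i).choose (k + 3 - i)))
    (he1 : e 1 = e 0 - L 0 + 1) (he3 : e 3 = 0) :
    ∃ (s : ℕ → ℕ) (c : ℕ → ℤ), SData J (k + 3) s c N ∧ c k = 0 := by
  have hd : 0 < k + 3 := by omega
  let cL : ℕ → ℤ := fun j => (-1) ^ (k + 3 - j) * e (k + 3 - j)
  have hcL : ∀ n ≥ N, (L n : ℤ) = ∑ j ∈ Finset.range (k + 3 + 1), cL j * ((n + j).choose j : ℤ) := by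
    intro n hn
    rw [hN n hn, ← Finset.sum_range_reflect]
    refine Finset.sum_congr rfl fun j hj => ?_
    rw [Finset.mem_range] at hj
    have h1 : k + 3 + 1 - 1 - j = k + 3 - j := by omega
    have h2 : k + 3 - (k + 3 - j) = j := by omega
    have h3 : n + (k + 3) - (k + 3 - j) = n + j := by omega
    rw [h1, h2, h3]
  obtain ⟨e0, he0⟩ := ENat.ne_top_iff_exists.1 qs.length_J_ne_top
  have hJn : ∀ n : ℕ, Module.length R (R ⧸ J ^ (n + 1)) = (((n + (k + 3)).choose (k + 3) * e0 : ℕ) : ℕ∞) := by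
    intro n
    rw [length_quot_pow qs hd, ← he0, show k + 3 + (n + 1) - 1 = n + (k + 3) by omega]
    push_cast; rfl
  obtain ⟨κ, hκ⟩ := qs.bound hd hAU
  have hE : cL (k + 3) = e0 := by
    refine num_e0 (k + 3) N κ e0 cL L hcL ?_ ?_
    · intro n
      have := length_quot_anti (R := R) (pow_le_vge (J := J) (n + 1))
      rw [hJn, Nat.cast_succ, hL] at this
      exact_mod_cast this
    · intro n
      have := length_quot_anti (R := R) (hκ (n + 1) (((n + κ : ℕ) : ℝ) + 1) (by push_cast; linarith))
      rw [hJn, hL] at this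
      exact_mod_cast this
  have hE' : e 0 = e0 := by
    have : cL (k + 3) = e 0 := by simp [cL]
    rw [← this, hE]
  have hB : Module.length R (R ⧸ vge J 1) = (L 0 : ℕ∞) := by
    rw [← hL 0, Nat.cast_zero, zero_add]
  have key : ∀ n : ℕ, ilen (vge J ((n : ℝ) + 1)) (J ^ n * vge J 1) + (L n : ℕ∞) =
      (((n + (k + 2)).choose n * L 0 + (n + (k + 2)).choose (k + 3) * e0 : ℕ) : ℕ∞) := by
    intro n
    rw [← hL n, ← length_quot_add (pow_mul_B_le J n), length_quot_add (Ideal.mul_le_left : J ^ n * vge J 1 ≤ J ^ n),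
      length_pow_mul qs n (J_le_B J), length_quot_pow qs hd, hB, ← he0, show k + 3 + n - 1 = n + (k + 2) by omega]
    push_cast; rfl
  have hfin : ∀ n : ℕ, ∃ t : ℕ, ilen (vge J ((n : ℝ) + 1)) (J ^ n * vge J 1) = (t : ℕ∞) := by
    intro n
    have : ilen (vge J ((n : ℝ) + 1)) (J ^ n * vge J 1) ≠ ⊤ := by
      intro h
      have := key n
      rw [h, top_add] at this
      exact ENat.natCast_ne_top _ this.symm
    obtain ⟨t, ht⟩ := ENat.ne_top_iff_exists.1 this
    exact ⟨t, ht.symm⟩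
  choose s hs using hfin
  have key2 : ∀ n : ℕ, s n + L n = (n + (k + 2)).choose n * L 0 + (n + (k + 2)).choose (k + 3) * e0 := by
    intro n
    have := key n
    rw [hs] at this
    exact_mod_cast this
  refine ⟨s, fun j => if j = k + 2 then 1 else - cL j, ⟨hs, ?_, ?_⟩, ?_⟩
  · intro n hn
    have h1 := hcL n hn
    have h2 := key2 n
    rw [Finset.sum_range_succ, Finset.sum_range_succ, hE] at h1
    change _ = ∑ j ∈ Finset.range (k + 2 + 1), _
    rw [Finset.sum_range_succ]
    have h3 : ∑ j ∈ Finset.range (k + 2), (if j = k + 2 then (1:ℤ) else - cL j) * ((n + j).choose j : ℤ)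
      = - ∑ j ∈ Finset.range (k + 2), cL j * ((n + j).choose j : ℤ) := by
      rw [← Finset.sum_neg_distrib]
      refine Finset.sum_congr rfl fun j hj => ?_
      rw [Finset.mem_range] at hj
      rw [if_neg (by omega)]; ring
    rw [h3, if_pos rfl]
    have h4 : cL (k + 2) = - e 1 := by
      simp [cL, show k + 3 - (k + 2) = 1 by omega]
    rw [h4, he1, hE'] at h1
    have h5 : (n + (k + 3)).choose (k + 3) = (n + (k + 2)).choose (k + 2) + (n + (k + 2)).choose (k + 3) :=
      Nat.choose_succ_succ _ _
    have h6 : (n + (k + 2)).choose n = (n + (k + 2)).choose (k + 2) := Nat.choose_symm_add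
    rw [h6] at h2
    rw [h5] at h1
    have h2' : (s n : ℤ) + L n = (n + (k + 2)).choose (k + 2) * L 0 + (n + (k + 2)).choose (k + 3) * e0 := by
      exact_mod_cast h2
    push_cast at h1
    linear_combination h2' - h1
  · change (if k + 2 = k + 2 then (1:ℤ) else _) = 1
    rw [if_pos rfl]
  · change (if k = k + 2 then (1:ℤ) else - cL k) = 0
    rw [if_neg (by omega)]
    simp [cL, show k + 3 - k = 3 by omega, he3]

/-- structure of the filtration -/
lemma exists_sigma {k : ℕ} {z : Fin (k + 3) → R} (qs : QSetup R (k + 3) J z) {s : ℕ → ℕ} {c : ℕ → ℤ} {N : ℕ}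
    (sd : SData J (k + 3) s c N) (hck : c k = 0) :
    ∃ σ : R, σ ∈ vge J 2 ∧ σ ∉ J * vge J 1 ∧ (∀ r ∈ maximalIdeal R, r * σ ∈ J * vge J 1) ∧
      ∀ q : ℕ, 1 ≤ q → ∀ τ ∈ vge J ((q : ℝ) + 1), ∃ w ∈ J ^ (q - 1), τ - w * σ ∈ J ^ q * vge J 1 := by
  classical
  have hd : 0 < k + 3 := by omega
  have hex : ∃ n : ℕ, ¬ vge J ((n : ℝ) + 1) ≤ J ^ n * vge J 1 := by
    by_contra! h
    refine num_ne (k + 2) N c s sd.hc sd.hk fun n => ?_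
    have := ilen_eq_zero_iff.2 (h n)
    rw [sd.hs] at this
    exact_mod_cast this
  obtain ⟨p, hp, hmin⟩ : ∃ p : ℕ, ¬ vge J ((p : ℝ) + 1) ≤ J ^ p * vge J 1 ∧
      ∀ n < p, vge J ((n : ℝ) + 1) ≤ J ^ n * vge J 1 :=
    ⟨Nat.find hex, Nat.find_spec hex, fun n hn => not_not.1 (Nat.find_min hex hn)⟩
  obtain ⟨σ, hσ, hσ'⟩ := SetLike.not_le_iff_exists.1 hp
  have hp0 : p ≠ 0 := by
    rintro rfl
    apply hσ'
    simpa using hσ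
  have hcount : ∀ m : ℕ, s (m + p) = (m + (k + 2)).choose (k + 2) := by
    intro m
    have h1 := count_le z m (vge J (((p + m : ℕ) : ℝ) + 1)) (J ^ (p + m) * vge J 1) σ
      (fun f hf => qs.eval_mul_vge hf hσ) (fun f hf h => by
        by_contra hc
        exact hσ' (qs.cancel (J_le_B J) hf hc h))
    have h2 := le_count z m (vge J (((p + m : ℕ) : ℝ) + 1)) (J ^ (p + m) * vge J 1) σ
      (fun f hf => qs.eval_mul_vge hf hσ) (fun x hx => by
        have := sd.exists_rho qs hd hmin hσ hx hσ' (by omega)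
        rwa [Nat.add_sub_cancel_left] at this) (fun f hf h => sd.kill_form qs hd hσ hf h)
    rw [sd.hs] at h1 h2
    have h3 := choose_comm' (d := k + 3) hd m 0
    simp only [add_zero, zero_add] at h3
    rw [h3] at h1 h2
    have h4 : s (p + m) = _ := le_antisymm (by exact_mod_cast h2) (by exact_mod_cast h1)
    rw [add_comm m p, h4]; rfl
  have hp1 : p ≤ 1 := by
    refine num_final k p N c sd.hk hck fun m hm => ?_
    have := sd.hc (m + p) (by omega)
    rw [hcount m] at this
    exact this
  obtain rfl : p = 1 := by omega
  refine ⟨σ, ?_, by simpa using hσ', ?_, ?_⟩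
  · convert hσ using 1; norm_num
  · intro r hr; simpa using sd.kill qs hd hσ hr
  · intro q hq τ hτ
    obtain ⟨f, hf, h⟩ := sd.exists_rho qs hd hmin hσ hτ hσ' hq
    exact ⟨_, qs.eval_mem_pow hf, h⟩

end hilb


-- part 19

section huneke
variable [CommRing R]

/-- values of forms of degree `l + b` whose degree in the `a`-th variable is at most `b` -/
def tI {d : ℕ} (z : Fin d → R) (a : Fin d) (l b : ℕ) : Ideal R where
  carrier := {y | ∃ G : MvPolynomial (Fin d) R, G.IsHomogeneous (l + b) ∧ MvPolynomial.degreeOf a G ≤ b ∧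
    MvPolynomial.eval z G = y}
  add_mem' := by
    rintro x y ⟨G, h1, h2, rfl⟩ ⟨H, k1, k2, rfl⟩
    exact ⟨G + H, h1.add k1, (MvPolynomial.degreeOf_add_le _ _ _).trans (max_le h2 k2), map_add _ _ _⟩
  zero_mem' := ⟨0, MvPolynomial.isHomogeneous_zero _ _ _, by simp, map_zero _⟩
  smul_mem' := by
    rintro r x ⟨G, h1, h2, rfl⟩
    refine ⟨MvPolynomial.C r * G, by simpa using (MvPolynomial.isHomogeneous_C (Fin d) r).mul h1,
      (MvPolynomial.degreeOf_C_mul_le _ _ _).trans h2, by simp⟩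

variable {d : ℕ} {z : Fin d → R} {a : Fin d}

lemma tI_mul {l b l' b' : ℕ} {x y : R} (hx : x ∈ tI z a l b) (hy : y ∈ tI z a l' b') : x * y ∈ tI z a (l + l') (b + b') := by
  obtain ⟨G, h1, h2, rfl⟩ := hx
  obtain ⟨H, k1, k2, rfl⟩ := hy
  refine ⟨G * H, ?_, (MvPolynomial.degreeOf_mul_le _ _ _).trans (add_le_add h2 k2), map_mul _ _ _⟩
  rw [show l + l' + (b + b') = (l + b) + (l' + b') by ring]
  exact h1.mul k1

lemma tI_J : Ideal.span (Set.range z) ≤ tI z a 0 1 := by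
  rw [Ideal.span_le]
  rintro _ ⟨i, rfl⟩
  refine ⟨MvPolynomial.X i, by simpa using MvPolynomial.isHomogeneous_X R i, ?_, by simp⟩
  rw [MvPolynomial.degreeOf_le_iff]
  intro m hm
  obtain rfl := Finset.mem_singleton.1 (MvPolynomial.support_monomial_subset (hm : m ∈ (MvPolynomial.monomial (Finsupp.single i 1) (1 : R)).support))
  rw [Finsupp.single_apply]; split_ifs <;> omega

lemma tI_pow (l : ℕ) : Ideal.span {x | ∃ i, i ≠ a ∧ x = z i} ^ l ≤ tI z a l 0 := by
  induction l with
  | zero => 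
    intro x _
    refine ⟨MvPolynomial.C x, by simpa using MvPolynomial.isHomogeneous_C (Fin d) x, by simp, by simp⟩
  | succ l ih =>
    rw [pow_succ]
    refine Ideal.mul_le.2 fun x hx y hy => ?_
    refine tI_mul (ih hx) (b' := 0) (l' := 1) ?_
    refine (Ideal.span_le.2 ?_ : Ideal.span {x | ∃ i, i ≠ a ∧ x = z i} ≤ tI z a 1 0) hy
    rintro _ ⟨i, hi, rfl⟩
    refine ⟨MvPolynomial.X i, by simpa using MvPolynomial.isHomogeneous_X R i, ?_, by simp⟩
    rw [MvPolynomial.degreeOf_le_iff]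
    intro m hm
    obtain rfl := Finset.mem_singleton.1 (MvPolynomial.support_monomial_subset (hm : m ∈ (MvPolynomial.monomial (Finsupp.single i 1) (1 : R)).support))
    rw [Finsupp.single_apply, if_neg hi]

variable [IsLocalRing R] [IsNoetherianRing R] {J : Ideal R}

lemma tI_step (qs : QSetup R d J z) {l b : ℕ} {y : R} (hy : y ∈ tI z a l b) (h : y ∈ J ^ (l + b + 1)) : y ∈ tI z a l (b + 1) := by
  obtain ⟨G, h1, h2, rfl⟩ := hy
  rw [pow_succ] at h
  have h3 := MvPolynomial.mem_map_C_iff.1 (qs.coeff_mem le_rfl h1 h)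
  rw [G.as_sum, map_sum]
  refine Ideal.sum_mem _ fun m hm => ?_
  have h4 : MvPolynomial.eval z (MvPolynomial.monomial m (MvPolynomial.coeff m G)) =
      MvPolynomial.eval z (MvPolynomial.monomial m 1) * MvPolynomial.coeff m G := by
    rw [MvPolynomial.eval_monomial, MvPolynomial.eval_monomial, one_mul, mul_comm]
  rw [h4]
  refine tI_mul (l' := 0) (b' := 1) ⟨_, ?_, ?_, rfl⟩ (tI_J (by rw [← qs.hJ]; exact h3 m))
  · apply MvPolynomial.isHomogeneous_monomial
    have := h1 (MvPolynomial.mem_support_iff.1 hm)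
    rw [← this, Finsupp.degree_eq_weight_one]; rfl
  · rw [MvPolynomial.degreeOf_monomial_eq _ _ one_ne_zero]
    exact MvPolynomial.degreeOf_le_iff.1 h2 m hm

lemma tI_steps (qs : QSetup R d J z) {l : ℕ} {y : R} (hy : y ∈ tI z a l 0) (b : ℕ) (h : y ∈ J ^ (l + b)) : y ∈ tI z a l b := by
  induction b with
  | zero => exact hy
  | succ b ih =>
    exact tI_step qs (ih (Ideal.pow_le_pow_right (by omega) h)) h

lemma sup_attained {ι : Type*} [Finite ι] (c : ι → R) (h : ∃ i, c i ∉ vge J 1) :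
    ∃ r : ℝ, 0 ≤ r ∧ r < 1 ∧ (∀ i, c i ∈ vge J r) ∧ ∃ a, ∀ α > r, c a ∉ vge J α := by
  classical
  obtain ⟨i0, hi0⟩ := h
  let S : Set ℝ := {α | ∀ i, c i ∈ vge J α}
  have h0 : (0 : ℝ) ∈ S := fun i => vset_of_nonpos le_rfl
  have hb : ∀ α ∈ S, α ≤ 1 := by
    intro α hα
    by_contra hc
    exact hi0 (vge_anti (not_le.1 hc).le (hα i0))
  have hbd : BddAbove S := ⟨1, hb⟩
  have hr : ∀ i, c i ∈ vge J (sSup S) := fun i => vset_of_forall_lt fun β hβ => by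
    obtain ⟨α, hα, hlt⟩ := exists_lt_of_lt_csSup ⟨0, h0⟩ hβ
    exact vset_mono hlt.le (hα i)
  refine ⟨sSup S, le_csSup hbd h0, ?_, hr, ?_⟩
  · refine lt_of_le_of_ne (csSup_le ⟨0, h0⟩ hb) fun he => hi0 ?_
    rw [← he]; exact hr i0
  · by_contra! hc
    choose α h1 h2 using hc
    cases nonempty_fintype ι
    have hne : (Finset.univ : Finset ι).Nonempty := ⟨i0, mem_univ _⟩
    have : Finset.univ.inf' hne α ∈ S := fun i => vge_anti (Finset.inf'_le _ (mem_univ i)) (h2 i)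
    have h3 := le_csSup hbd this
    have h4 : sSup S < Finset.univ.inf' hne α := (Finset.lt_inf'_iff _).2 fun i _ => h1 i
    linarith

lemma huneke_itoh (qs : QSetup R d J z) (hd : 0 < d) (hAU : AnalyticallyUnramified R) {σ : R}
    (hσ : σ ∈ vge J 2) (hσJ : σ ∈ J) : σ ∈ J * vge J 1 := by
  classical
  have hzJ : ∀ i, z i ∈ J := fun i => by rw [qs.hJ]; exact Ideal.subset_span ⟨i, rfl⟩
  obtain ⟨c, hc⟩ : ∃ c : Fin d → R, ∑ i, c i * z i = σ := by
    rw [qs.hJ] at hσJ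
    exact (Ideal.mem_span_range_iff_exists_fun).1 hσJ
  by_cases hall : ∀ i, c i ∈ vge J 1
  · rw [← hc]
    refine Ideal.sum_mem _ fun i _ => ?_
    rw [mul_comm (c i)]; exact Ideal.mul_mem_mul (hzJ i) (hall i)
  exfalso
  push Not at hall
  obtain ⟨r, hr0, hr1, hr, a, ha⟩ := sup_attained c hall
  obtain ⟨κ, hκ⟩ := qs.bound hd hAU
  obtain ⟨j, hj⟩ := exists_nat_ge (((κ : ℝ) + 1) / (1 - r) ^ 2)
  have hpos : 0 < (1 - r) ^ 2 := by have : 0 < 1 - r := by linarith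
                                    positivity
  rw [div_le_iff₀ hpos] at hj
  have hj0 : 0 < j := by
    rcases Nat.eq_zero_or_pos j with rfl | h
    · simp at hj; have : (0:ℝ) ≤ κ := Nat.cast_nonneg _; linarith
    · exact h
  have hij : ∀ N : ℕ, c a ^ j ∈ J ^ N → (N : ℝ) ≤ r * j := by
    intro N hN
    by_contra hcon
    have hj' : (0 : ℝ) < j := by exact_mod_cast hj0
    have h1 : r < N / j := by rw [lt_div_iff₀ hj']; linarith
    exact ha _ h1 (vset_of_witness hj0 hN (by rw [div_mul_cancel₀ _ hj'.ne']))
  obtain ⟨i, hi, hi'⟩ : ∃ i, c a ^ j ∈ J ^ i ∧ c a ^ j ∉ J ^ (i + 1) := by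
    have hex : ∃ N, c a ^ j ∉ J ^ N := by
      obtain ⟨N, hN⟩ := exists_nat_gt (r * j)
      exact ⟨N, fun h => absurd (hij N h) (not_le.2 hN)⟩
    have h1 := Nat.find_spec hex
    have h2 := fun {m} => Nat.find_min hex (m := m)
    rcases hN : Nat.find hex with _ | N
    · rw [hN] at h1; simp at h1
    · rw [hN] at h1
      exact ⟨N, not_not.1 (h2 (by omega)), h1⟩
  have hir := hij i hi
  obtain ⟨W, hW, hWe⟩ := qs.exists_form_pow hi
  obtain ⟨m, hm⟩ : ∃ m, MvPolynomial.coeff m W ∉ J := by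
    by_contra! h
    apply hi'
    rw [← hWe, pow_succ]
    exact qs.eval_mem hW (MvPolynomial.mem_map_C_iff.2 h)
  -- binomial expansion
  let J' : Ideal R := Ideal.span {x | ∃ i, i ≠ a ∧ x = z i}
  let β : R := ∑ i ∈ Finset.univ.erase a, c i * z i
  have hβ : c a * z a = σ + -β := by
    rw [← hc, ← Finset.add_sum_erase _ _ (Finset.mem_univ a)]; ring
  have hβ1 : -β ∈ vge J (1 + r) := by
    refine (Ideal.neg_mem_iff _).2 (Ideal.sum_mem _ fun i _ => ?_)
    rw [mul_comm]
    exact mul_mem_vge (J_le_B J (hzJ i)) (hr i)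
  have hβ2 : -β ∈ J' := by
    refine (Ideal.neg_mem_iff _).2 (Ideal.sum_mem _ fun i hi => ?_)
    exact Ideal.mul_mem_left _ _ (Ideal.subset_span ⟨i, Finset.ne_of_mem_erase hi, rfl⟩)
  have hexp : c a ^ j * z a ^ j = ∑ l ∈ Finset.range (j + 1), (-β) ^ l * σ ^ (j - l) * (j.choose l : R) := by
    rw [← mul_pow, hβ, add_comm, add_pow]
  have hij' : i + 1 ≤ j + 1 := by
    have : (i : ℝ) ≤ j := hir.trans (by nlinarith [(Nat.cast_nonneg j : (0:ℝ) ≤ j)])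
    have : i ≤ j := by exact_mod_cast this
    omega
  rw [← Finset.sum_range_add_sum_Ico _ hij'] at hexp
  set y1 := ∑ l ∈ Finset.range (i + 1), (-β) ^ l * σ ^ (j - l) * (j.choose l : R)
  set y2 := ∑ l ∈ Finset.Ico (i + 1) (j + 1), (-β) ^ l * σ ^ (j - l) * (j.choose l : R)
  have hy1 : y1 ∈ J ^ (i + j + 1) := by
    refine Ideal.sum_mem _ fun l hl => Ideal.mul_mem_right _ _ ?_
    rw [Finset.mem_range] at hl
    have h1 := mul_mem_vge (vset_pow l hβ1 : (-β) ^ l ∈ vge J _) (vset_pow (j - l) hσ : σ ^ (j - l) ∈ vge J _)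
    refine hκ _ _ ?_ h1
    have hl' : (l : ℝ) ≤ i := by exact_mod_cast (by omega : l ≤ i)
    rw [Nat.cast_sub (by omega)]
    push_cast
    nlinarith
  have hy2 : y2 ∈ J' ^ (i + 1) := by
    refine Ideal.sum_mem _ fun l hl => Ideal.mul_mem_right _ _ (Ideal.mul_mem_right _ _ ?_)
    rw [Finset.mem_Ico] at hl
    exact Ideal.pow_le_pow_right hl.1 (Ideal.pow_mem_pow hβ2 l)
  have hV : (MvPolynomial.monomial (Finsupp.single a j) 1 * W).IsHomogeneous (j + i) := by
    refine MvPolynomial.IsHomogeneous.mul (MvPolynomial.isHomogeneous_monomial _ ?_) hW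
    simp [Finsupp.degree_single]
  have hVe : MvPolynomial.eval z (MvPolynomial.monomial (Finsupp.single a j) 1 * W) = y1 + y2 := by
    rw [map_mul, hWe, ← hexp, MvPolynomial.eval_monomial]
    simp [mul_comm]
  have hy2J : y2 ∈ J ^ (i + 1 + (j - 1)) := by
    rw [show i + 1 + (j - 1) = j + i by omega]
    have h1 := qs.eval_mem_pow hV
    rw [hVe] at h1
    have h2 := Ideal.pow_le_pow_right (by omega : j + i ≤ i + j + 1) hy1
    have := Ideal.sub_mem _ h1 h2
    rwa [add_sub_cancel_left] at this
  obtain ⟨G, hG, hGd, hGe⟩ := tI_steps qs (tI_pow (i + 1) hy2) (j - 1) hy2J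
  rw [show i + 1 + (j - 1) = j + i by omega] at hG
  have hfin := qs.coeff_mem le_rfl (hV.sub hG) (by
    rw [map_sub, hVe, hGe, add_sub_cancel_right, ← pow_succ, add_comm j i]; exact hy1)
  have h3 := MvPolynomial.mem_map_C_iff.1 hfin (Finsupp.single a j + m)
  rw [MvPolynomial.coeff_sub, MvPolynomial.coeff_monomial_mul, one_mul] at h3
  have h4 : MvPolynomial.coeff (Finsupp.single a j + m) G = 0 := by
    by_contra h
    have := MvPolynomial.degreeOf_le_iff.1 hGd _ (MvPolynomial.mem_support_iff.2 h)
    simp at this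
    omega
  rw [h4, sub_zero] at h3
  exact hm h3

end huneke


-- part 20

lemma mlen_eq (R M : Type*) [CommRing R] [AddCommGroup M] [Module R M] : mlen R M = (Module.length R M : WithBot ℕ∞) := by
  rw [mlen, Module.coe_length]

lemma radical_reduction [CommRing R] {I J : Ideal R} (h : J ≤ I) (hred : ∃ N : ℕ, ∀ n ≥ N, I ^ (n + 1) = J * I ^ n) :
    J.radical = I.radical := by
  refine le_antisymm (Ideal.radical_mono h) ?_
  obtain ⟨N, hN⟩ := hred
  have : I ^ (N + 1) ≤ J := by rw [hN N le_rfl]; exact Ideal.mul_le_left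
  intro x hx
  rw [← Ideal.radical_pow I (Nat.succ_ne_zero N)] at hx
  exact Ideal.radical_mono this hx

lemma main_ell [CommRing R] [IsLocalRing R] [IsNoetherianRing R] {J : Ideal R} {d : ℕ} {z : Fin d → R} (qs : QSetup R d J z)
    (hd : 0 < d) (hAU : AnalyticallyUnramified R) {σ : R}
    (h1 : σ ∈ vge J 2) (h2 : σ ∉ J * vge J 1) (h3 : ∀ r ∈ maximalIdeal R, r * σ ∈ J * vge J 1)
    (h4 : ∀ q : ℕ, 1 ≤ q → ∀ τ ∈ vge J ((q : ℝ) + 1), ∃ w ∈ J ^ (q - 1), τ - w * σ ∈ J ^ q * vge J 1) (n : ℕ) (hn : 1 ≤ n) :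
    ilen (vge J ((n : ℝ) + 1)) J = if n = 1 then 1 else 0 := by
  have hle : ∀ q : ℕ, 1 ≤ q → J ^ q * vge J 1 ≤ J := fun q hq =>
    Ideal.mul_le_left.trans (Ideal.pow_le_self (by omega))
  split_ifs with hn1
  · subst hn1
    rw [show ((1 : ℕ) : ℝ) + 1 = 2 by norm_num]
    apply le_antisymm
    · have := le_count z 0 (vge J 2) J σ ?_ ?_ ?_
      · simpa using this
      · intro f _; exact Ideal.mul_mem_left _ _ h1
      · intro x hx
        obtain ⟨w, _, hw⟩ := h4 1 le_rfl x (by rw [show ((1 : ℕ) : ℝ) + 1 = 2 by norm_num]; exact hx)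
        exact ⟨MvPolynomial.C w, MvPolynomial.isHomogeneous_C _ _, by
          rw [MvPolynomial.eval_C]; exact hle 1 le_rfl hw⟩
      · intro f hf hf0
        have := qs.eval_mem hf (map_residue_eq_zero_iff.1 hf0)
        rw [pow_zero, one_mul] at this
        exact Ideal.mul_le_left (h3 _ this)
    · rw [Order.one_le_iff_ne_zero, Ne, ilen_eq_zero_iff]
      intro h
      exact h2 (huneke_itoh qs hd hAU h1 (h h1))
  · rw [ilen_eq_zero_iff]
    intro τ hτ
    obtain ⟨w, hw, h⟩ := h4 n hn τ hτ
    have h5 : w * σ ∈ J := Ideal.mul_mem_right _ _ (Ideal.pow_le_self (by omega) hw)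
    have := Ideal.add_mem _ (hle n hn h) h5
    rwa [sub_add_cancel] at this

theorem sum_lengths_eq_one_of_e1_almost_extremal_e3_zero
    (R : Type*) [CommRing R] [IsLocalRing R] [IsNoetherianRing R]
    (d : ℕ) (hd : 3 ≤ d) (hdim : ringKrullDim R = d)
    (hCM : IsCMLocal R) (hAU : AnalyticallyUnramified R)
    (hres : Infinite (ResidueField R))
    (I J : Ideal R) (hI : IsMPrimary I) (hJ : IsMinimalReduction d J I)
    (L : ℕ → ℕ) (e : ℕ → ℤ) (hHilb : NormalHilbertData d I L e)
    (he1 : e 1 = e 0 - L 0 + 1) (he3 : e 3 = 0)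
    -- `ℓ n = λ( intCl(Iⁿ⁺¹) / (J ∩ intCl(Iⁿ⁺¹)) )` for `n ≥ 1`
    (ℓ : ℕ → ℕ)
    (hℓ : ∀ n, 1 ≤ n →
      mlen R (idealQuot (intCl (I ^ (n + 1))) J) = ((ℓ n : ℕ) : WithBot ℕ∞)) :
    ∑' n : ℕ, ((ℓ (n + 1) : ℕ) : ℕ∞) = 1 := by
  obtain ⟨hJI, ⟨s0, hs0⟩, hred⟩ := hJ
  have hrad : J.radical = maximalIdeal R := (radical_reduction hJI hred).trans hI
  obtain ⟨z, hz, hreg⟩ := exists_reg_gens hdim hCM J hrad s0 hs0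
  have qs : QSetup R d J z :=
    { hJ := hz
      qr := qreg_of_weaklyRegular z hreg
      jm := by
        obtain ⟨k, hk⟩ := Ideal.exists_radical_pow_le_of_fg J (IsNoetherian.noetherian _)
        exact ⟨k, by rw [← hrad]; exact hk⟩
      le := by rw [← hrad]; exact Ideal.le_radical }
  have hcl : ∀ n : ℕ, intCl (I ^ (n + 1)) = vge J ((n : ℝ) + 1) := by
    intro n; rw [intCl_pow_eq_vge hJI hred, Nat.cast_succ]
  obtain ⟨hL, N, hN⟩ := hHilb
  have hL' : ∀ n : ℕ, Module.length R (R ⧸ vge J ((n : ℝ) + 1)) = (L n : ℕ∞) := by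
    intro n
    have := hL n
    rw [hcl, mlen_eq] at this
    exact WithBot.coe_injective this
  have hd0 : 0 < d := by omega
  obtain ⟨σ, h1, h2, h3, h4⟩ : ∃ σ : R, σ ∈ vge J 2 ∧ σ ∉ J * vge J 1 ∧ (∀ r ∈ maximalIdeal R, r * σ ∈ J * vge J 1) ∧
      ∀ q : ℕ, 1 ≤ q → ∀ τ ∈ vge J ((q : ℝ) + 1), ∃ w ∈ J ^ (q - 1), τ - w * σ ∈ J ^ q * vge J 1 := by
    clear hs0 s0 hdim
    obtain ⟨k, rfl⟩ : ∃ k, d = k + 3 := ⟨d - 3, by omega⟩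
    obtain ⟨s, c, sd, hck⟩ := exists_sdata qs hAU L e hL' N hN he1 he3
    exact exists_sigma qs sd hck
  have hell : ∀ n : ℕ, ((ℓ (n + 1) : ℕ) : ℕ∞) = if n = 0 then 1 else 0 := by
    intro n
    have a1 := hℓ (n + 1) (by omega)
    rw [hcl, mlen_eq] at a1
    have a2 : ilen (vge J (((n + 1 : ℕ) : ℝ) + 1)) J = (ℓ (n + 1) : ℕ∞) := WithBot.coe_injective a1
    rw [← a2, main_ell qs hd0 hAU h1 h2 h3 h4 (n + 1) (by omega)]
    simp
  rw [tsum_eq_single 0]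
  · rw [hell 0, if_pos rfl]
  · intro n hn
    rw [hell n, if_neg hn]
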